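/- arXiv:1312.5038 — 2 statements merged into one kernel-verified Lean document; each statement's English description precedes it below -/
import Mathlib

section
/- For every 0 < p < 1 and every c < C_p there exist a complete filtered probability space and a martingale X = (X_t)_{t≥0} with continuous sample paths and X_0 = 0 almost surely such that 0 < sup_{t≥0} (E[(−M⁻_t)^p])^{1/p} < ∞ and sup_{t≥0} (E[|X_t|^p])^{1/p} > c · sup_{t≥0} (E[(−M⁻_t)^p])^{1/p}. Here C_p = (1−p)/p if p ≤ p₀ and C_p = (1 + α_p^{−1})^{1/p} if p > p₀, where p₀ ∈ (0,1) is the unique solution of 1/p₀ − 1 = (1/p₀ − 1)^{1−p₀} + 1 and, for p > p₀, α_p is the unique positive solution of (1−p)·(α^{1/(1−p)} + 1) = α + 1; M⁻_t(ω) = inf_{0≤s≤t} min(X_s(ω),0). -/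
open MeasureTheory Filter Set
open scoped NNReal

section AuxiliaryLemmas

open ProbabilityTheory Topology

lemma hasLaw_gaussianReal_of_tendsto {Ω : Type*} {mΩ : MeasurableSpace Ω} {P : Measure Ω}
    [IsProbabilityMeasure P] {X : ℕ → Ω → ℝ} {Y : Ω → ℝ} {v : ℕ → ℝ≥0} {w : ℝ≥0}
    (hX : ∀ n, HasLaw (X n) (gaussianReal 0 (v n)) P) (hv : Tendsto v atTop (𝓝 w))
    (hY : AEMeasurable Y P) (h : ∀ᵐ ω ∂P, Tendsto (fun n ↦ X n ω) atTop (𝓝 (Y ω))) :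
    HasLaw Y (gaussianReal 0 w) P := by
  refine ⟨hY, ?_⟩
  have := Measure.isProbabilityMeasure_map hY (μ := P)
  refine Measure.ext_of_charFun (funext fun t ↦ ?_)
  have hlim : Tendsto (fun n ↦ charFun (P.map (X n)) t) atTop (𝓝 (charFun (P.map Y) t)) := by
    simp only [charFun_apply]
    rw [integral_map hY (by fun_prop)]
    have : ∀ n, ∫ x, Complex.exp (inner ℝ x t * Complex.I) ∂(P.map (X n)) =
        ∫ ω, Complex.exp (inner ℝ (X n ω) t * Complex.I) ∂P := fun n ↦
      integral_map (hX n).aemeasurable (by fun_prop)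
    simp only [this]
    refine tendsto_integral_of_dominated_convergence (fun _ ↦ 1) (fun n ↦ ?_)
      (integrable_const _) (fun n ↦ ?_) ?_
    · have := (hX n).aemeasurable
      exact AEMeasurable.aestronglyMeasurable (by fun_prop)
    · exact Eventually.of_forall fun ω ↦ (Complex.norm_exp_ofReal_mul_I _).le
    · filter_upwards [h] with ω hω
      exact ((by fun_prop : Continuous fun x : ℝ ↦
        Complex.exp (inner ℝ x t * Complex.I)).tendsto _).comp hω
  refine tendsto_nhds_unique hlim ?_
  simp only [(hX _).map_eq, charFun_gaussianReal]
  have : Continuous fun v : ℝ≥0 ↦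
      Complex.exp (t * (0 : ℝ) * Complex.I - (v : ℝ) * t ^ 2 / 2) := by fun_prop
  exact (this.tendsto w).comp hv

lemma hasLaw_sum_mul_of_tendsto {Ω T : Type*} {mΩ : MeasurableSpace Ω} {P : Measure Ω}
    {X : ℕ → T → Ω → ℝ} {Y : T → Ω → ℝ} {C : T → T → ℝ}
    (hX : ∀ n, IsGaussianProcess (X n) P) (hmean : ∀ n t, P[X n t] = 0)
    (hcov : ∀ s t, Tendsto (fun n ↦ cov[X n s, X n t; P]) atTop (𝓝 (C s t)))
    (hY : ∀ t, AEMeasurable (Y t) P)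
    (h : ∀ t, ∀ᵐ ω ∂P, Tendsto (fun n ↦ X n t ω) atTop (𝓝 (Y t ω)))
    {ι : Type*} [Fintype ι] (f : ι → T) (a : ι → ℝ) :
    HasLaw (fun ω ↦ ∑ i, a i * Y (f i) ω)
      (gaussianReal 0 (∑ i, ∑ j, a i * a j * C (f i) (f j)).toNNReal) P := by
  have := (hX 0).isProbabilityMeasure
  have hL n : HasGaussianLaw (fun ω ↦ ∑ i, a i * X n (f i) ω) P := by
    have hp : IsGaussianProcess (fun (i : ι) ω ↦ a i • X n (f i) ω) P :=
      ((hX n).comp_right f).smul a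
    simpa using hp.hasGaussianLaw_fun_sum (I := Finset.univ)
  have hm n (i : ι) : MemLp (fun ω ↦ a i * X n (f i) ω) 2 P :=
    ((hX n).hasGaussianLaw_eval (f i)).memLp_two.const_mul (a i)
  refine hasLaw_gaussianReal_of_tendsto
    (X := fun n ω ↦ ∑ i, a i * X n (f i) ω)
    (v := fun n ↦ (∑ i, ∑ j, a i * a j * cov[X n (f i), X n (f j); P]).toNNReal)
    (fun n ↦ ⟨(hL n).aemeasurable, ?_⟩) ?_ (by fun_prop) ?_
  · rw [(hL n).map_eq_gaussianReal]
    congr 1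
    · rw [integral_finsetSum _ fun i _ ↦ (hm n i).integrable (by norm_num)]
      simp [integral_const_mul, hmean]
    · congr 1
      rw [← covariance_self (hL n).aemeasurable,
        covariance_fun_sum_fun_sum (fun i ↦ hm n i) (fun i ↦ hm n i)]
      refine Finset.sum_congr rfl fun i _ ↦ Finset.sum_congr rfl fun j _ ↦ ?_
      rw [covariance_const_mul_left, covariance_const_mul_right]
      ring
  · refine (continuous_real_toNNReal.tendsto _).comp ?_
    exact tendsto_finsetSum _ fun i _ ↦ tendsto_finsetSum _ fun j _ ↦
      (hcov (f i) (f j)).const_mul _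
  · filter_upwards [ae_all_iff.2 fun i ↦ h (f i)] with ω hω
    exact tendsto_finsetSum _ fun i _ ↦ (hω i).const_mul _

lemma isGaussianProcess_of_tendsto {Ω T : Type*} {mΩ : MeasurableSpace Ω} {P : Measure Ω}
    {X : ℕ → T → Ω → ℝ} {Y : T → Ω → ℝ} {C : T → T → ℝ}
    (hX : ∀ n, IsGaussianProcess (X n) P) (hmean : ∀ n t, P[X n t] = 0)
    (hcov : ∀ s t, Tendsto (fun n ↦ cov[X n s, X n t; P]) atTop (𝓝 (C s t)))
    (hY : ∀ t, AEMeasurable (Y t) P)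
    (h : ∀ t, ∀ᵐ ω ∂P, Tendsto (fun n ↦ X n t ω) atTop (𝓝 (Y t ω))) :
    IsGaussianProcess Y P where
  hasGaussianLaw I := by
    classical
    have hm : AEMeasurable (fun ω ↦ I.restrict (Y · ω)) P :=
      aemeasurable_pi_lambda _ fun i ↦ hY i
    refine ⟨isGaussian_of_map_eq_gaussianReal fun L ↦ ⟨0,
      (∑ i : I, ∑ j : I, L (Pi.single i 1) * L (Pi.single j 1) * C i j).toNNReal, ?_⟩⟩
    rw [AEMeasurable.map_map_of_aemeasurable (by fun_prop) hm]
    rw [← (hasLaw_sum_mul_of_tendsto hX hmean hcov hY h (fun i : I ↦ (i : T))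
      (fun i ↦ L (Pi.single i 1))).map_eq]
    refine congrArg (fun f ↦ P.map f) (funext fun ω ↦ ?_)
    have := LinearMap.pi_apply_eq_sum_univ L.toLinearMap (I.restrict (Y · ω))
    simp only [Function.comp_apply]
    refine this.trans (Finset.sum_congr rfl fun i _ ↦ ?_)
    have hi : (fun j ↦ if i = j then (1 : ℝ) else 0) = Pi.single i 1 := by
      ext j
      simp [Pi.single_apply, eq_comm]
    rw [smul_eq_mul, mul_comm, Finset.restrict, hi]
    rfl

lemma integral_eq_zero_of_tendsto_gaussian {Ω T : Type*} {mΩ : MeasurableSpace Ω} {P : Measure Ω}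
    {X : ℕ → T → Ω → ℝ} {Y : T → Ω → ℝ} {C : T → T → ℝ}
    (hX : ∀ n, IsGaussianProcess (X n) P) (hmean : ∀ n t, P[X n t] = 0)
    (hcov : ∀ s t, Tendsto (fun n ↦ cov[X n s, X n t; P]) atTop (𝓝 (C s t)))
    (hY : ∀ t, AEMeasurable (Y t) P)
    (h : ∀ t, ∀ᵐ ω ∂P, Tendsto (fun n ↦ X n t ω) atTop (𝓝 (Y t ω))) (t : T) :
    P[Y t] = 0 := by
  have := (hasLaw_sum_mul_of_tendsto hX hmean hcov hY h (fun _ : Fin 1 ↦ t) 1).integral_eq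
  simpa using this

lemma covariance_eq_of_tendsto_gaussian {Ω T : Type*} {mΩ : MeasurableSpace Ω} {P : Measure Ω}
    {X : ℕ → T → Ω → ℝ} {Y : T → Ω → ℝ} {C : T → T → ℝ}
    (hX : ∀ n, IsGaussianProcess (X n) P) (hmean : ∀ n t, P[X n t] = 0)
    (hcov : ∀ s t, Tendsto (fun n ↦ cov[X n s, X n t; P]) atTop (𝓝 (C s t)))
    (hY : ∀ t, AEMeasurable (Y t) P)
    (h : ∀ t, ∀ᵐ ω ∂P, Tendsto (fun n ↦ X n t ω) atTop (𝓝 (Y t ω))) (s t : T) :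
    cov[Y s, Y t; P] = C s t := by
  have := (hX 0).isProbabilityMeasure
  have hG := isGaussianProcess_of_tendsto hX hmean hcov hY h
  have hm u := (hG.hasGaussianLaw_eval u).memLp_two
  have hsymm : C t s = C s t := by
    refine tendsto_nhds_unique (hcov t s) ?_
    simp_rw [fun n ↦ covariance_comm (μ := P) (X n t) (X n s)]
    exact hcov s t
  have hvar (a b : ℝ) : Var[fun ω ↦ a * Y s ω + b * Y t ω; P] =
      (a * a * C s s + a * b * C s t + (b * a * C s t + b * b * C t t)).toNNReal := by
    have := (hasLaw_sum_mul_of_tendsto hX hmean hcov hY h ![s, t] ![a, b]).variance_eq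
    rw [variance_id_gaussianReal] at this
    simpa [Fin.sum_univ_two, hsymm] using this
  have hnn (a b : ℝ) :
      0 ≤ a * a * C s s + a * b * C s t + (b * a * C s t + b * b * C t t) := by
    have hlim := ((((hcov s s).const_mul (a * a)).add ((hcov s t).const_mul (a * b))).add
      (((hcov s t).const_mul (b * a)).add ((hcov t t).const_mul (b * b))))
    refine ge_of_tendsto' hlim fun n ↦ ?_
    have hn u := ((hX n).hasGaussianLaw_eval u).memLp_two
    have : Var[fun ω ↦ a * X n s ω + b * X n t ω; P] =
        a * a * cov[X n s, X n s; P] + a * b * cov[X n s, X n t; P] +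
        (b * a * cov[X n s, X n t; P] + b * b * cov[X n t, X n t; P]) := by
      rw [variance_fun_add ((hn s).const_mul a) ((hn t).const_mul b),
        variance_const_mul, variance_const_mul, covariance_const_mul_left,
        covariance_const_mul_right, covariance_self (hn s).aemeasurable,
        covariance_self (hn t).aemeasurable]
      ring
    exact this ▸ variance_nonneg _ _
  have h1 := hvar 1 1
  have h2 := hvar 1 0
  have h3 := hvar 0 1
  have h4 : Var[fun ω ↦ 1 * Y s ω + 1 * Y t ω; P] = Var[Y s; P] + 2 * cov[Y s, Y t; P] +
      Var[Y t; P] := by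
    simpa using variance_fun_add (hm s) (hm t)
  rw [Real.coe_toNNReal _ (hnn _ _)] at h1 h2 h3
  simp only [one_mul, zero_mul, add_zero, zero_add] at h1 h2 h3 h4
  linarith

/-- The hat function supported on `[0, 1]` with maximum `1` at `1 / 2`. -/
noncomputable def hat (x : ℝ) : ℝ := max 0 (min (2 * x) (2 - 2 * x))

lemma continuous_hat : Continuous hat := by unfold hat; fun_prop

lemma hat_nonneg (x : ℝ) : 0 ≤ hat x := le_max_left _ _

lemma hat_le_one (x : ℝ) : hat x ≤ 1 := by
  unfold hat; grind

lemma hat_eq_zero {x : ℝ} (hx : x ∉ Ioo (0 : ℝ) 1) : hat x = 0 := by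
  unfold hat
  simp only [mem_Ioo] at hx
  grind

/-- The level-`n` kernel of the Schauder expansion of the Brownian bridge. -/
noncomputable def schauderLevel (n : ℕ) (s t : ℝ) : ℝ :=
  ∑ k ∈ Finset.range (2 ^ n), hat (2 ^ n * s - k) * hat (2 ^ n * t - k)

/-- The covariance of the Brownian bridge, extended by zero. -/
noncomputable def bridgeCov (s t : ℝ) : ℝ :=
  if s ∈ Ioo (0 : ℝ) 1 ∧ t ∈ Ioo (0 : ℝ) 1 then min s t - s * t else 0

lemma schauderLevel_succ (n : ℕ) (s t : ℝ) :
    schauderLevel (n + 1) s t =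
      schauderLevel n (2 * s) (2 * t) + schauderLevel n (2 * s - 1) (2 * t - 1) := by
  unfold schauderLevel
  rw [pow_succ, mul_two, Finset.sum_range_add]
  congr 1
  · refine Finset.sum_congr rfl fun k _ ↦ ?_
    ring_nf
  · refine Finset.sum_congr rfl fun k _ ↦ ?_
    push_cast
    ring_nf

lemma schauderLevel_eq_zero (n : ℕ) {s : ℝ} (t : ℝ) (hs : s ∉ Ioo (0 : ℝ) 1) :
    schauderLevel n s t = 0 := by
  refine Finset.sum_eq_zero fun k hk ↦ ?_
  rw [hat_eq_zero, zero_mul]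
  rintro ⟨h1, h2⟩
  have hk' : (k : ℝ) + 1 ≤ 2 ^ n := by exact_mod_cast Finset.mem_range.1 hk
  have : (0 : ℝ) < 2 ^ n := by positivity
  refine hs ⟨?_, ?_⟩
  · by_contra! h
    nlinarith [(Nat.cast_nonneg k : (0 : ℝ) ≤ k)]
  · by_contra! h
    nlinarith

lemma bridgeCov_eq (s t : ℝ) :
    bridgeCov s t = 1 / 4 * (hat s * hat t) +
      1 / 2 * (bridgeCov (2 * s) (2 * t) + bridgeCov (2 * s - 1) (2 * t - 1)) := by
  wlog hst : s ≤ t generalizing s t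
  · have hc (a b) : bridgeCov a b = bridgeCov b a := by
      unfold bridgeCov; simp only [and_comm, min_comm, mul_comm]
    rw [hc s, hc (2 * s), hc (2 * s - 1), this t s (by linarith), mul_comm (hat s)]
  unfold bridgeCov hat
  simp only [mem_Ioo]
  rw [min_eq_left hst, min_eq_left (by linarith : 2 * s ≤ 2 * t),
    min_eq_left (by linarith : 2 * s - 1 ≤ 2 * t - 1)]
  rcases le_or_gt s 0 with h0 | h0
  · have : max 0 (min (2 * s) (2 - 2 * s)) = 0 := by grind
    rw [this, if_neg (by grind), if_neg (by grind), if_neg (by grind)]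
    ring
  rcases le_or_gt 1 t with h1 | h1
  · have : max 0 (min (2 * t) (2 - 2 * t)) = 0 := by grind
    rw [this, if_neg (by grind), if_neg (by grind), if_neg (by grind)]
    ring
  rw [if_pos (by grind)]
  rcases lt_or_ge t (1 / 2) with h2 | h2
  · have e1 : max 0 (min (2 * s) (2 - 2 * s)) = 2 * s := by grind
    have e2 : max 0 (min (2 * t) (2 - 2 * t)) = 2 * t := by grind
    rw [e1, e2, if_pos (by grind), if_neg (by grind)]
    ring
  · have e2 : max 0 (min (2 * t) (2 - 2 * t)) = 2 - 2 * t := by grind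
    rw [e2, if_neg (c := (0 < 2 * s ∧ _) ∧ _) (by grind)]
    rcases le_or_gt s (1 / 2) with h3 | h3
    · have e1 : max 0 (min (2 * s) (2 - 2 * s)) = 2 * s := by grind
      rw [e1, if_neg (by grind)]
      ring
    · have e1 : max 0 (min (2 * s) (2 - 2 * s)) = 2 - 2 * s := by grind
      rw [e1, if_pos (by grind)]
      ring

lemma abs_sum_schauderLevel_sub_le (n : ℕ) (s t : ℝ) :
    |∑ i ∈ Finset.range n, 1 / 4 * (1 / 2) ^ i * schauderLevel i s t - bridgeCov s t|
      ≤ (1 / 2) ^ n := by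
  induction n generalizing s t with
  | zero =>
    simp only [Finset.range_zero, Finset.sum_empty, zero_sub, abs_neg, pow_zero]
    unfold bridgeCov
    split_ifs with h
    · obtain ⟨⟨h1, h2⟩, h3, h4⟩ := h
      rw [abs_le]
      constructor
      · rcases min_choice s t with h | h <;> rw [h] <;> nlinarith
      · rcases min_choice s t with h | h <;> rw [h] <;> nlinarith
    · simp
  | succ n ih =>
    have h0 : schauderLevel 0 s t = hat s * hat t := by simp [schauderLevel]
    have key : ∑ i ∈ Finset.range (n + 1), 1 / 4 * (1 / 2) ^ i * schauderLevel i s t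
        - bridgeCov s t =
        1 / 2 * ((∑ i ∈ Finset.range n, 1 / 4 * (1 / 2) ^ i * schauderLevel i (2 * s) (2 * t)
          - bridgeCov (2 * s) (2 * t)) +
        (∑ i ∈ Finset.range n, 1 / 4 * (1 / 2) ^ i * schauderLevel i (2 * s - 1) (2 * t - 1)
          - bridgeCov (2 * s - 1) (2 * t - 1))) := by
      rw [Finset.sum_range_succ', h0, bridgeCov_eq s t]
      have : ∑ i ∈ Finset.range n, 1 / 4 * (1 / 2 : ℝ) ^ (i + 1) * schauderLevel (i + 1) s t =
          1 / 2 * (∑ i ∈ Finset.range n,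
            1 / 4 * (1 / 2) ^ i * schauderLevel i (2 * s) (2 * t)) +
          1 / 2 * ∑ i ∈ Finset.range n,
            1 / 4 * (1 / 2) ^ i * schauderLevel i (2 * s - 1) (2 * t - 1) := by
        rw [Finset.mul_sum, Finset.mul_sum, ← Finset.sum_add_distrib]
        refine Finset.sum_congr rfl fun i _ ↦ ?_
        rw [schauderLevel_succ]
        ring
      rw [this]
      ring
    have hz (a b : ℝ) (ha : a ∉ Ioo (0 : ℝ) 1) :
        ∑ i ∈ Finset.range n, 1 / 4 * (1 / 2) ^ i * schauderLevel i a b - bridgeCov a b = 0 := by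
      rw [Finset.sum_eq_zero fun i _ ↦ by rw [schauderLevel_eq_zero i b ha, mul_zero], bridgeCov,
        if_neg fun h ↦ ha h.1, sub_zero]
    rw [key, abs_mul, pow_succ, mul_comm, abs_of_pos (by norm_num : (0 : ℝ) < 1 / 2)]
    refine mul_le_mul_of_nonneg_right ?_ (by norm_num)
    by_cases h : 2 * s ∈ Ioo (0 : ℝ) 1
    · rw [hz (2 * s - 1) _ fun h' ↦ by linarith [h.2, h'.1], add_zero]
      exact ih _ _
    · rw [hz (2 * s) _ h, zero_add]
      exact ih _ _

lemma tendsto_sum_schauderLevel (s t : ℝ) :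
    Tendsto (fun n ↦ ∑ i ∈ Finset.range n, 1 / 4 * (1 / 2) ^ i * schauderLevel i s t) atTop
      (𝓝 (bridgeCov s t)) := by
  rw [tendsto_iff_norm_sub_tendsto_zero]
  exact squeeze_zero (fun _ ↦ norm_nonneg _) (fun n ↦ abs_sum_schauderLevel_sub_le n s t)
    (tendsto_pow_atTop_nhds_zero_of_lt_one (by norm_num) (by norm_num))

lemma abs_sum_mul_hat_le (N : ℕ) (f : ℕ → ℝ) (y : ℝ) {M : ℝ} (hM : ∀ k < N, |f k| ≤ M)
    (hM0 : 0 ≤ M) : |∑ k ∈ Finset.range N, f k * hat (y - k)| ≤ M := by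
  have hz : ∀ k ∈ Finset.range N, k ≠ ⌊y⌋₊ → f k * hat (y - k) = 0 := fun k _ hne ↦ by
    rw [hat_eq_zero, mul_zero]
    rintro ⟨h1, h2⟩
    refine hne ((Nat.floor_eq_iff ?_).2 ⟨?_, ?_⟩).symm
    · linarith [(Nat.cast_nonneg k : (0 : ℝ) ≤ k)]
    · linarith
    · linarith
  by_cases hN : ⌊y⌋₊ ∈ Finset.range N
  · rw [Finset.sum_eq_single_of_mem _ hN hz, abs_mul, abs_of_nonneg (hat_nonneg _)]
    nlinarith [hM _ (Finset.mem_range.1 hN), hat_le_one (y - ⌊y⌋₊), hat_nonneg (y - ⌊y⌋₊),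
      abs_nonneg (f ⌊y⌋₊)]
  · rw [Finset.sum_eq_zero fun k hk ↦ hz k hk fun h ↦ hN (h ▸ hk)]
    simpa using hM0

lemma isGaussianProcess_of_iIndepFun {Ω ι : Type*} {mΩ : MeasurableSpace Ω} {P : Measure Ω}
    {ξ : ι → Ω → ℝ} (hξ : iIndepFun ξ P) (hlaw : ∀ i, HasGaussianLaw (ξ i) P) :
    IsGaussianProcess ξ P where
  hasGaussianLaw I :=
    iIndepFun.hasGaussianLaw (X := fun (i : I) ω ↦ ξ i ω) (fun i ↦ hlaw i)
      (hξ.precomp Subtype.val_injective)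

lemma isGaussianProcess_sum_mul {Ω ι T : Type*} {mΩ : MeasurableSpace Ω} {P : Measure Ω}
    {ξ : ι → Ω → ℝ} (hξ : IsGaussianProcess ξ P) (I : Finset ι) (w : T → ι → ℝ) :
    IsGaussianProcess (fun t ω ↦ ∑ a ∈ I, w t a * ξ a ω) P := by
  refine hξ.of_isGaussianProcess fun t ↦ ⟨I,
    ∑ a : I, w t a • ContinuousLinearMap.proj (R := ℝ) (φ := fun _ : I ↦ ℝ) a, fun ω ↦ ?_⟩
  simp only [_root_.sum_apply, _root_.smul_apply,
    ContinuousLinearMap.proj_apply, smul_eq_mul, Finset.restrict]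
  exact (Finset.sum_coe_sort I (fun a ↦ w t a * ξ a ω)).symm

lemma covariance_sum_mul_sum_mul {Ω ι : Type*} {mΩ : MeasurableSpace Ω} {P : Measure Ω}
    {ξ : ι → Ω → ℝ} (hξ : iIndepFun ξ P)
    (hlaw : ∀ i, HasLaw (ξ i) (gaussianReal 0 1) P) (I : Finset ι) (v w : ι → ℝ) :
    cov[fun ω ↦ ∑ a ∈ I, v a * ξ a ω, fun ω ↦ ∑ a ∈ I, w a * ξ a ω; P] =
      ∑ a ∈ I, v a * w a := by
  classical
  have := hξ.isProbabilityMeasure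
  have hm a : MemLp (ξ a) 2 P := HasGaussianLaw.memLp_two (HasLaw.hasGaussianLaw (hlaw a))
  rw [covariance_fun_sum_fun_sum' (fun a _ ↦ (hm a).const_mul (v a))
    (fun a _ ↦ (hm a).const_mul (w a))]
  refine Finset.sum_congr rfl fun a ha ↦ ?_
  simp_rw [covariance_const_mul_left, covariance_const_mul_right]
  rw [Finset.sum_eq_single_of_mem a ha]
  · rw [covariance_self (hm a).aemeasurable, (hlaw a).variance_eq, variance_id_gaussianReal]
    simp
  · intro b _ hb
    rw [(hξ.indepFun hb.symm).covariance_eq_zero (hm a) (hm b)]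
    simp

lemma ae_exists_forall_pow_four_le {Ω : Type*} {mΩ : MeasurableSpace Ω} {P : Measure Ω}
    [IsProbabilityMeasure P] {ξ : ((_ : ℕ) × ℕ) → Ω → ℝ} (hmeas : ∀ i, Measurable (ξ i))
    (hlaw : ∀ i, HasLaw (ξ i) (gaussianReal 0 1) P) :
    ∃ G : Set Ω, MeasurableSet G ∧ P Gᶜ = 0 ∧ ∀ ω ∈ G, ∃ K : ℝ, 0 ≤ K ∧
      ∀ n, ∀ k < 2 ^ n, (ξ ⟨n, k⟩ ω) ^ 4 ≤ K * 3 ^ n := by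
  set S : Ω → ENNReal := fun ω ↦ ∑' n : ℕ, ∑ k ∈ Finset.range (2 ^ n),
    ENNReal.ofReal ((1 / 3) ^ n * (ξ ⟨n, k⟩ ω) ^ 4) with hS
  have hSm : Measurable S := by fun_prop
  set m := ∫⁻ x, ENNReal.ofReal (x ^ 4) ∂(gaussianReal 0 1) with hm
  have hmfin : m ≠ ⊤ := by
    have h1 : Integrable (fun x : ℝ ↦ ‖id x‖ ^ 4) (gaussianReal 0 1) :=
      (memLp_id_gaussianReal' (μ := 0) (v := 1) (4 : ℕ) (by simp)).integrable_norm_pow (by simp)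
    have h2 := h1.lintegral_lt_top
    refine ne_of_lt (lt_of_le_of_lt (lintegral_mono fun x ↦ ?_) h2)
    refine ENNReal.ofReal_le_ofReal (le_of_eq ?_)
    simp [Even.pow_abs (show Even 4 by decide)]
  have hinteg i : ∫⁻ ω, ENNReal.ofReal ((ξ i ω) ^ 4) ∂P = m := by
    rw [hm, ← (hlaw i).map_eq, lintegral_map (by fun_prop) (hmeas i)]
  have hfin : ∫⁻ ω, S ω ∂P ≠ ⊤ := by
    rw [hS, lintegral_tsum fun n ↦ by fun_prop]
    have : ∀ n : ℕ, ∫⁻ ω, ∑ k ∈ Finset.range (2 ^ n),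
        ENNReal.ofReal ((1 / 3) ^ n * (ξ ⟨n, k⟩ ω) ^ 4) ∂P =
        ENNReal.ofReal ((2 / 3) ^ n) * m := fun n ↦ by
      rw [lintegral_finsetSum _ fun k _ ↦ by fun_prop]
      simp_rw [ENNReal.ofReal_mul (p := (1 / 3 : ℝ) ^ n) (by positivity)]
      simp_rw [fun k ↦ lintegral_const_mul (μ := P) (ENNReal.ofReal ((1 / 3 : ℝ) ^ n))
        (f := fun ω ↦ ENNReal.ofReal (ξ ⟨n, k⟩ ω ^ 4)) (by fun_prop), hinteg]
      rw [Finset.sum_const, Finset.card_range, nsmul_eq_mul, ← mul_assoc]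
      congr 1
      rw [← ENNReal.ofReal_natCast, ← ENNReal.ofReal_mul (by positivity)]
      congr 1
      push_cast
      rw [← mul_pow]
      norm_num
    simp_rw [this]
    rw [ENNReal.tsum_mul_right]
    refine ENNReal.mul_ne_top ?_ hmfin
    rw [← ENNReal.ofReal_tsum_of_nonneg (fun n ↦ by positivity)
      (summable_geometric_of_lt_one (by norm_num) (by norm_num))]
    exact ENNReal.ofReal_ne_top
  refine ⟨{ω | S ω < ⊤}, measurableSet_lt hSm measurable_const,
    ae_lt_top hSm hfin, fun ω hω ↦ ⟨(S ω).toReal, ENNReal.toReal_nonneg, fun n k hk ↦ ?_⟩⟩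
  have h1 : ENNReal.ofReal ((1 / 3) ^ n * (ξ ⟨n, k⟩ ω) ^ 4) ≤ S ω :=
    (Finset.single_le_sum (f := fun k ↦ ENNReal.ofReal ((1 / 3) ^ n * (ξ ⟨n, k⟩ ω) ^ 4))
      (fun _ _ ↦ zero_le) (Finset.mem_range.2 hk)).trans (ENNReal.le_tsum n)
  have h2 := (ENNReal.ofReal_le_iff_le_toReal hω.ne).1 h1
  have h3 : (1 / 3 : ℝ) ^ n * 3 ^ n = 1 := by rw [← mul_pow]; norm_num
  calc (ξ ⟨n, k⟩ ω) ^ 4 = ((1 / 3) ^ n * (ξ ⟨n, k⟩ ω) ^ 4) * 3 ^ n := by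
        rw [mul_right_comm, h3, one_mul]
    _ ≤ _ := by gcongr

/-- The level-`n` Schauder coefficient of the Brownian bridge. -/
noncomputable def schauderCoef (n : ℕ) : ℝ := 1 / 2 * √(1 / 2) ^ n

lemma schauderCoef_sq (n : ℕ) : schauderCoef n ^ 2 = 1 / 4 * (1 / 2) ^ n := by
  rw [schauderCoef, mul_pow, ← pow_mul, mul_comm n 2, pow_mul, Real.sq_sqrt (by norm_num)]
  norm_num

lemma schauderCoef_nonneg (n : ℕ) : 0 ≤ schauderCoef n := by unfold schauderCoef; positivity

/-- The level-`n` term of the Schauder expansion of the Brownian bridge. -/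
noncomputable def schauderTerm {Ω : Type*} (ξ : ((_ : ℕ) × ℕ) → Ω → ℝ) (n : ℕ) (s : ℝ) (ω : Ω) :
    ℝ :=
  schauderCoef n * ∑ k ∈ Finset.range (2 ^ n), ξ ⟨n, k⟩ ω * hat (2 ^ n * s - k)

lemma continuous_schauderTerm {Ω : Type*} (ξ : ((_ : ℕ) × ℕ) → Ω → ℝ) (n : ℕ) (ω : Ω) :
    Continuous fun s ↦ schauderTerm ξ n s ω := by
  unfold schauderTerm
  have := continuous_hat
  fun_prop

lemma measurable_schauderTerm {Ω : Type*} {mΩ : MeasurableSpace Ω}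
    {ξ : ((_ : ℕ) × ℕ) → Ω → ℝ} (hmeas : ∀ i, Measurable (ξ i)) (n : ℕ) (s : ℝ) :
    Measurable (schauderTerm ξ n s) := by
  unfold schauderTerm
  fun_prop

lemma exists_summable_bound_schauderTerm {Ω : Type*} (ξ : ((_ : ℕ) × ℕ) → Ω → ℝ) (ω : Ω) {K : ℝ}
    (hK0 : 0 ≤ K) (hK : ∀ n, ∀ k < 2 ^ n, (ξ ⟨n, k⟩ ω) ^ 4 ≤ K * 3 ^ n) :
    ∃ u : ℕ → ℝ, Summable u ∧ ∀ n s, ‖schauderTerm ξ n s ω‖ ≤ u n := by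
  refine ⟨fun n ↦ schauderCoef n * √√(K * 3 ^ n), ?_, fun n s ↦ ?_⟩
  · have h (n : ℕ) : schauderCoef n * √√(K * 3 ^ n) = 1 / 2 * √√K * (√(1 / 2) * √√3) ^ n := by
      have h3 : (√√3) ^ n = √√(3 ^ n) := by
        have hp {x : ℝ} (hx : 0 ≤ x) : √(x ^ n) = √x ^ n := by
          rw [← Real.sqrt_sq (pow_nonneg (Real.sqrt_nonneg x) n), ← pow_mul, mul_comm, pow_mul,
            Real.sq_sqrt hx]
        rw [hp (by norm_num), hp (Real.sqrt_nonneg 3)]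
      rw [schauderCoef, Real.sqrt_mul hK0, Real.sqrt_mul (by positivity), mul_pow, h3]
      ring
    simp_rw [h]
    refine (summable_geometric_of_lt_one (by positivity) ?_).mul_left _
    rw [← Real.sqrt_mul (by norm_num), Real.sqrt_lt' one_pos]
    have : √3 < 2 := by
      rw [Real.sqrt_lt' (by norm_num)]
      norm_num
    linarith
  · rw [schauderTerm, norm_mul, Real.norm_eq_abs, Real.norm_eq_abs,
      abs_of_nonneg (schauderCoef_nonneg n)]
    refine mul_le_mul_of_nonneg_left ?_ (schauderCoef_nonneg n)
    refine abs_sum_mul_hat_le _ (fun k ↦ ξ ⟨n, k⟩ ω) _ (fun k hk ↦ ?_) (by positivity)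
    refine Real.le_sqrt_of_sq_le (Real.le_sqrt_of_sq_le ?_)
    rw [sq_abs, ← pow_mul]
    exact hK n k hk

/-- The partial sums of the Schauder expansion of Brownian motion. -/
noncomputable def brownianApprox {Ω : Type*} (ξ : ((_ : ℕ) × ℕ) → Ω → ℝ) (n : ℕ) (t : ℝ≥0)
    (ω : Ω) : ℝ :=
  (1 + t) * ∑ i ∈ Finset.range n, schauderTerm ξ i (t / (1 + t)) ω

lemma brownianApprox_eq {Ω : Type*} (ξ : ((_ : ℕ) × ℕ) → Ω → ℝ) (n : ℕ) :
    brownianApprox ξ n = fun (t : ℝ≥0) ω ↦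
      ∑ a ∈ (Finset.range n).sigma fun i ↦ Finset.range (2 ^ i),
      ((1 + t) * (schauderCoef a.1 * hat (2 ^ a.1 * (t / (1 + t)) - a.2))) * ξ a ω := by
  ext t ω
  rw [Finset.sum_sigma, brownianApprox, Finset.mul_sum]
  refine Finset.sum_congr rfl fun i _ ↦ ?_
  rw [schauderTerm, Finset.mul_sum, Finset.mul_sum]
  refine Finset.sum_congr rfl fun k _ ↦ ?_
  ring

lemma bridgeCov_time_change {s t : ℝ} (hs : 0 ≤ s) (hst : s ≤ t) :
    (1 + s) * (1 + t) * bridgeCov (s / (1 + s)) (t / (1 + t)) = s := by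
  have h1 : (0 : ℝ) < 1 + s := by linarith
  have h2 : (0 : ℝ) < 1 + t := by linarith
  rcases hs.eq_or_lt with rfl | hs
  · simp [bridgeCov]
  have hle : s / (1 + s) ≤ t / (1 + t) := by
    rw [div_le_div_iff₀ h1 h2]
    linarith
  rw [bridgeCov, if_pos, min_eq_left hle]
  · field_simp
    ring
  · refine ⟨⟨by positivity, ?_⟩, div_pos (by linarith) h2, ?_⟩
    · rw [div_lt_one h1]; linarith
    · rw [div_lt_one h2]; linarith

lemma tendsto_covariance_brownianApprox {Ω : Type*} {mΩ : MeasurableSpace Ω} {P : Measure Ω}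
    {ξ : ((_ : ℕ) × ℕ) → Ω → ℝ} (hξ : iIndepFun ξ P)
    (hlaw : ∀ i, HasLaw (ξ i) (gaussianReal 0 1) P) (s t : ℝ≥0) :
    Tendsto (fun n ↦ cov[brownianApprox ξ n s, brownianApprox ξ n t; P]) atTop
      (𝓝 ((1 + s) * (1 + t) * bridgeCov (s / (1 + s)) (t / (1 + t)))) := by
  simp_rw [fun n ↦ congrFun (brownianApprox_eq ξ n) s, fun n ↦ congrFun (brownianApprox_eq ξ n) t]
  simp_rw [covariance_sum_mul_sum_mul hξ hlaw]
  convert (tendsto_sum_schauderLevel (s / (1 + s)) (t / (1 + t))).const_mul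
    ((1 + s : ℝ) * (1 + t)) using 2 with n
  rw [Finset.sum_sigma, Finset.mul_sum]
  refine Finset.sum_congr rfl fun i _ ↦ ?_
  rw [← schauderCoef_sq, schauderLevel, Finset.mul_sum, Finset.mul_sum]
  refine Finset.sum_congr rfl fun k _ ↦ ?_
  ring

/-- Existence of a Brownian motion with continuous paths. -/
theorem exists_isPreBrownianReal_continuous :
    ∃ (Ω : Type) (_ : MeasurableSpace Ω) (P : Measure Ω) (B : ℝ≥0 → Ω → ℝ),
      (∀ t, Measurable (B t)) ∧ IsPreBrownianReal B P ∧ ∀ ω, Continuous fun t ↦ B t ω := by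
  let P : Measure (((_ : ℕ) × ℕ) → ℝ) := Measure.infinitePi fun _ ↦ gaussianReal 0 1
  let ξ : ((_ : ℕ) × ℕ) → (((_ : ℕ) × ℕ) → ℝ) → ℝ := fun i ω ↦ ω i
  have hmeas i : Measurable (ξ i) := measurable_pi_apply i
  have hξ : iIndepFun ξ P := iIndepFun_infinitePi (X := fun _ x ↦ x) fun _ ↦ measurable_id
  have hlaw i : HasLaw (ξ i) (gaussianReal 0 1) P :=
    ⟨(hmeas i).aemeasurable, Measure.infinitePi_map_eval _ i⟩
  obtain ⟨G, hG, hPG, hbound⟩ := ae_exists_forall_pow_four_le hmeas hlaw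
  let B : ℝ≥0 → (((_ : ℕ) × ℕ) → ℝ) → ℝ := fun t ↦
    G.indicator fun ω ↦ (1 + t) * ∑' n, schauderTerm ξ n (t / (1 + t)) ω
  have hlim t ω : Tendsto (fun n ↦ G.indicator (brownianApprox ξ n t) ω) atTop (𝓝 (B t ω)) := by
    by_cases hω : ω ∈ G
    · simp only [B, indicator_of_mem hω]
      obtain ⟨K, hK0, hK⟩ := hbound ω hω
      obtain ⟨u, hu, hle⟩ := exists_summable_bound_schauderTerm ξ ω hK0 hK
      exact ((hu.of_norm_bounded fun n ↦ hle n _).hasSum.tendsto_sum_nat).const_mul _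
    · simp only [B, indicator_of_notMem hω]
      exact tendsto_const_nhds
  have hBm t : Measurable (B t) := by
    refine measurable_of_tendsto_metrizable (fun n ↦ ?_) (tendsto_pi_nhds.2 fun ω ↦ hlim t ω)
    refine Measurable.indicator ?_ hG
    unfold brownianApprox
    have := measurable_schauderTerm hmeas
    fun_prop
  have hae t : ∀ᵐ ω ∂P, Tendsto (fun n ↦ brownianApprox ξ n t ω) atTop (𝓝 (B t ω)) := by
    filter_upwards [show ∀ᵐ ω ∂P, ω ∈ G from hPG] with ω hω
    simpa [indicator_of_mem hω] using hlim t ω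
  have hgauss n : IsGaussianProcess (brownianApprox ξ n) P := by
    rw [brownianApprox_eq]
    exact isGaussianProcess_sum_mul
      (isGaussianProcess_of_iIndepFun hξ fun i ↦ HasLaw.hasGaussianLaw (hlaw i)) _
      (fun (t : ℝ≥0) a ↦ (1 + t) * (schauderCoef a.1 * hat (2 ^ a.1 * (t / (1 + t)) - a.2)))
  have hmean n t : P[brownianApprox ξ n t] = 0 := by
    rw [brownianApprox_eq, integral_finsetSum _ fun a _ ↦
      (HasGaussianLaw.integrable (HasLaw.hasGaussianLaw (hlaw a))).const_mul _]
    refine Finset.sum_eq_zero fun a _ ↦ ?_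
    rw [integral_const_mul, (hlaw a).integral_eq, integral_id_gaussianReal, mul_zero]
  have hcov := tendsto_covariance_brownianApprox hξ hlaw
  have hBae t : AEMeasurable (B t) P := (hBm t).aemeasurable
  refine ⟨_, _, P, B, hBm, ?_, fun ω ↦ ?_⟩
  · refine (isGaussianProcess_of_tendsto hgauss hmean hcov hBae hae).isPreBrownianReal_of_covariance
      (integral_eq_zero_of_tendsto_gaussian hgauss hmean hcov hBae hae) fun s t hst ↦ ?_
    rw [covariance_eq_of_tendsto_gaussian hgauss hmean hcov hBae hae]
    exact bridgeCov_time_change s.2 (by exact_mod_cast hst)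
  · by_cases hω : ω ∈ G
    · simp only [B, indicator_of_mem hω]
      obtain ⟨K, hK0, hK⟩ := hbound ω hω
      obtain ⟨u, hu, hle⟩ := exists_summable_bound_schauderTerm ξ ω hK0 hK
      have hc : Continuous fun s ↦ ∑' n, schauderTerm ξ n s ω :=
        continuous_tsum (fun n ↦ continuous_schauderTerm ξ n ω) hu hle
      have hd : Continuous fun t : ℝ≥0 ↦ (t : ℝ) / (1 + t) :=
        Continuous.div (by fun_prop) (by fun_prop) fun t ↦ by positivity
      exact (by fun_prop : Continuous fun t : ℝ≥0 ↦ (1 + t : ℝ)).mul (hc.comp hd)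
    · simp only [B, indicator_of_notMem hω]
      exact continuous_const

lemma measurePreserving_id_completion {Ω : Type*} {mΩ : MeasurableSpace Ω} (P : Measure Ω) :
    MeasurePreserving (α := NullMeasurableSpace Ω P) (β := Ω) id P.completion P := by
  have hm : Measurable[NullMeasurableSpace.instMeasurableSpace (α := Ω) (μ := P), mΩ]
      (id : Ω → Ω) := fun s (hs : MeasurableSet[mΩ] s) ↦
    (hs.nullMeasurableSet : NullMeasurableSet s P)
  refine ⟨hm, @Measure.ext _ mΩ _ _ fun s hs ↦ ?_⟩
  exact Measure.map_apply hm hs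

lemma isPreBrownianReal_comp_measurePreserving {Ω Ω' : Type*} {mΩ : MeasurableSpace Ω}
    {mΩ' : MeasurableSpace Ω'} {P : Measure Ω} {P' : Measure Ω'} {B : ℝ≥0 → Ω → ℝ}
    (hB : IsPreBrownianReal B P) {f : Ω' → Ω} (hf : MeasurePreserving f P' P) :
    IsPreBrownianReal (fun t ω ↦ B t (f ω)) P' where
  hasLaw I := (hB.hasLaw I).comp hf.hasLaw

/-- On a suitable complete probability space there is a Brownian motion, all of whose paths are
continuous and none of whose unit increments takes a prescribed value. -/
theorem exists_isPreBrownianReal_complete (q : ℕ → ℝ) :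
    ∃ (Ω : Type) (_ : MeasurableSpace Ω) (P : Measure Ω) (B : ℝ≥0 → Ω → ℝ),
      P.IsComplete ∧ (∀ t, Measurable (B t)) ∧ IsPreBrownianReal B P ∧
      (∀ ω, Continuous fun t ↦ B t ω) ∧ ∀ ω (j : ℕ), B (j + 1) ω - B j ω ≠ q j := by
  obtain ⟨Ω, mΩ, P, B, hm, hB, hc⟩ := exists_isPreBrownianReal_continuous
  obtain ⟨κ, hκ⟩ : ∃ κ : ℝ, κ ∉ range q := by
    by_contra! h
    exact Cardinal.not_countable_real ((countable_range q).mono fun x _ ↦ h x)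
  let G : Set Ω := {ω | ∀ j : ℕ, B (j + 1) ω - B j ω ≠ q j}
  have hGm : MeasurableSet G := by
    have : G = ⋂ j : ℕ, {ω | B (j + 1) ω - B j ω = q j}ᶜ := by ext; simp [G]
    rw [this]
    exact MeasurableSet.iInter fun j ↦
      (measurableSet_eq_fun ((hm _).sub (hm _)) measurable_const).compl
  have hG : ∀ᵐ ω ∂P, ω ∈ G := by
    refine ae_all_iff.2 fun j ↦ ?_
    have hl := hB.hasLaw_sub (j + 1) j
    have key {v : ℝ≥0} (hv : v ≠ 0) (h : HasLaw (B (j + 1) - B j) (gaussianReal 0 v) P) :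
        ∀ᵐ ω ∂P, B (j + 1) ω - B j ω ≠ q j := by
      have := nullSingletonClass_gaussianReal (μ := 0) hv
      have h0 : gaussianReal 0 v {q j} = 0 := measure_singleton _
      rw [← h.map_eq, Measure.map_apply ((hm _).sub (hm _)) (measurableSet_singleton _)] at h0
      exact measure_eq_zero_iff_ae_notMem.1 h0
    exact key (by simp [nndist_eq_zero]) hl
  classical
  let B' : ℝ≥0 → Ω → ℝ := fun t ω ↦ if ω ∈ G then B t ω else κ * t
  have hm' t : Measurable (B' t) := (hm t).ite hGm measurable_const
  have hB' : IsPreBrownianReal B' P := hB.congr fun t ↦ by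
    filter_upwards [hG] with ω hω
    simp [B', hω]
  have hc' ω : Continuous fun t ↦ B' t ω := by
    by_cases hω : ω ∈ G
    · simpa only [B', if_pos hω] using hc ω
    · simp only [B', if_neg hω]
      fun_prop
  have hne ω (j : ℕ) : B' (j + 1) ω - B' j ω ≠ q j := by
    by_cases hω : ω ∈ G
    · simpa only [B', if_pos hω] using hω j
    · simp only [B', if_neg hω]
      push_cast
      intro h
      exact hκ ⟨j, by linarith⟩
  have hf := measurePreserving_id_completion P
  exact ⟨NullMeasurableSpace Ω P, inferInstance, P.completion, fun t ω ↦ B' t (id ω),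
    inferInstance, fun t ↦ (hm' t).comp hf.measurable,
    isPreBrownianReal_comp_measurePreserving hB' hf, fun ω ↦ hc' ω, fun ω ↦ hne ω⟩

lemma measurable_measure_add_lt (ν : Measure ℝ) [IsProbabilityMeasure ν] (q : ℝ) :
    Measurable fun u ↦ ν {v | u + v < q} :=
  measurable_measure_prodMk_left (ν := ν) (s := {x : ℝ × ℝ | x.1 + x.2 < q})
    (measurableSet_lt (by fun_prop) measurable_const)

lemma condExp_indicator_add_lt {Ω : Type*} {m mΩ : MeasurableSpace Ω} (hm : m ≤ mΩ)
    {P : Measure Ω} [IsProbabilityMeasure P] {U V : Ω → ℝ} (hU : Measurable[m] U)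
    (hV : Measurable V) (hind : Indep m (MeasurableSpace.comap V inferInstance) P)
    {ν : Measure ℝ} [IsProbabilityMeasure ν] (hν : P.map V = ν) (q : ℝ) :
    (fun ω ↦ ν.real {v | U ω + v < q}) =ᵐ[P]
      P[{ω | U ω + V ω < q}.indicator (fun _ ↦ (1 : ℝ)) | m] := by
  have hU' : Measurable U := hU.mono hm le_rfl
  have hS : MeasurableSet {ω | U ω + V ω < q} :=
    measurableSet_lt (hU'.add hV) measurable_const
  have hF : Measurable fun u ↦ ν.real {v | u + v < q} :=
    (measurable_measure_add_lt ν q).ennreal_toReal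
  have hFi : Integrable (fun ω ↦ ν.real {v | U ω + v < q}) P :=
    Integrable.of_bound (hF.comp hU').aestronglyMeasurable 1
      (Eventually.of_forall fun ω ↦ by simp [abs_of_nonneg])
  refine ae_eq_condExp_of_forall_setIntegral_eq hm ((integrable_const _).indicator hS)
    (fun s _ _ ↦ hFi.integrableOn) (fun A hA _ ↦ ?_) (hF.comp hU).aestronglyMeasurable
  have hA' := hm A hA
  let Y : Ω → ℝ × ℝ := fun ω ↦ (A.indicator (fun _ ↦ 1) ω, U ω)
  have hYm : Measurable[m] Y := (measurable_const.indicator hA).prodMk hU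
  have hY : Measurable Y := hYm.mono hm le_rfl
  have hYV : IndepFun Y V P := (IndepFun_iff_Indep _ _ _).2 (indep_of_indep_of_le_left hind
    hYm.comap_le)
  have hprod := (indepFun_iff_map_prod_eq_prod_map_map hY.aemeasurable hV.aemeasurable).1 hYV
  let T : Set ((ℝ × ℝ) × ℝ) := {x | x.1.1 = 1 ∧ x.1.2 + x.2 < q}
  have hT1 : MeasurableSet {x : (ℝ × ℝ) × ℝ | x.1.1 = 1} :=
    measurableSet_eq_fun (by fun_prop) measurable_const
  have hT2 : MeasurableSet {x : (ℝ × ℝ) × ℝ | x.1.2 + x.2 < q} :=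
    measurableSet_lt (by fun_prop) measurable_const
  have hT : MeasurableSet T := hT1.inter hT2
  have h1 : P (A ∩ {ω | U ω + V ω < q}) = ∫⁻ ω in A, ν {v | U ω + v < q} ∂P := by
    have : A ∩ {ω | U ω + V ω < q} = (fun ω ↦ (Y ω, V ω)) ⁻¹' T := by
      ext ω
      by_cases hω : ω ∈ A <;> simp [T, Y, hω]
    rw [this, ← Measure.map_apply (hY.prodMk hV) hT, hprod, hν, Measure.prod_apply hT,
      lintegral_map (measurable_measure_prodMk_left hT) hY, ← lintegral_indicator hA']
    refine lintegral_congr fun ω ↦ ?_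
    by_cases hω : ω ∈ A <;> simp [T, Y, hω]
  rw [integral_indicator hS, setIntegral_const, smul_eq_mul, mul_one, measureReal_restrict_apply hS,
    inter_comm, measureReal_def, h1, integral_eq_lintegral_of_nonneg_ae
      (Eventually.of_forall fun _ ↦ measureReal_nonneg) hFi.1.restrict]
  congr 1
  refine lintegral_congr fun ω ↦ ?_
  simp [measureReal_def, ENNReal.ofReal_toReal]

/-- The probability that a centred Gaussian variable with standard deviation `σ` is below `x`. -/
noncomputable def gaussBelow (x σ : ℝ) : ℝ := (gaussianReal 0 1).real {z | σ * z < x}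

lemma gaussBelow_nonneg (x σ : ℝ) : 0 ≤ gaussBelow x σ := measureReal_nonneg

lemma gaussBelow_le_one (x σ : ℝ) : gaussBelow x σ ≤ 1 := measureReal_le_one

lemma gaussBelow_zero (x : ℝ) : gaussBelow x 0 = if 0 < x then 1 else 0 := by
  unfold gaussBelow
  split_ifs with h <;> simp [h]

lemma gaussianReal_real_add_lt (σ : ℝ) (u q : ℝ) :
    (gaussianReal 0 (σ ^ 2).toNNReal).real {v | u + v < q} = gaussBelow (q - u) σ := by
  have : gaussianReal 0 (σ ^ 2).toNNReal = (gaussianReal 0 1).map (σ * ·) := by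
    rw [gaussianReal_map_const_mul, mul_zero, mul_one]
    congr 1
    ext
    simp [sq_nonneg]
  rw [this, gaussBelow, map_measureReal_apply (by fun_prop)
    (measurableSet_lt (by fun_prop) measurable_const)]
  congr 1
  ext z
  simp [lt_sub_iff_add_lt']

lemma continuousAt_gaussBelow {x₀ σ₀ : ℝ} (h : x₀ ≠ 0 ∨ σ₀ ≠ 0) :
    ContinuousAt (fun y : ℝ × ℝ ↦ gaussBelow y.1 y.2) (x₀, σ₀) := by
  have hI (y : ℝ × ℝ) : gaussBelow y.1 y.2 =
      ∫ z, {z | y.2 * z < y.1}.indicator (fun _ ↦ (1 : ℝ)) z ∂(gaussianReal 0 1) := by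
    rw [integral_indicator_const _ (measurableSet_lt (by fun_prop) measurable_const)]
    simp [gaussBelow]
  rw [funext hI]
  unfold ContinuousAt
  refine tendsto_integral_filter_of_dominated_convergence (fun _ ↦ 1) ?_ ?_
    (integrable_const (μ := gaussianReal 0 1) (1 : ℝ)) ?_
  · exact Eventually.of_forall fun y ↦ (measurable_const.indicator
      (measurableSet_lt (by fun_prop) measurable_const)).aestronglyMeasurable
  · refine Eventually.of_forall fun y ↦ Eventually.of_forall fun z ↦ ?_
    exact (norm_indicator_le_norm_self _ _).trans (by simp)
  · have hne : ∀ᵐ z ∂(gaussianReal 0 1), σ₀ * z ≠ x₀ := by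
      by_cases hσ : σ₀ = 0
      · refine Eventually.of_forall fun z ↦ ?_
        simpa [hσ, eq_comm] using h
      · have := nullSingletonClass_gaussianReal (μ := 0) (v := 1) one_ne_zero
        have h0 : gaussianReal 0 1 {x₀ / σ₀} = 0 := measure_singleton _
        filter_upwards [measure_eq_zero_iff_ae_notMem.1 h0] with z hz hz'
        exact hz (by rw [mem_singleton_iff, ← hz']; field_simp)
    filter_upwards [hne] with z hz
    refine tendsto_const_nhds.congr' ?_
    have hc1 : ContinuousAt (fun y : ℝ × ℝ ↦ y.2 * z) (x₀, σ₀) := by fun_prop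
    have hc2 : ContinuousAt (fun y : ℝ × ℝ ↦ y.1) (x₀, σ₀) := by fun_prop
    rcases lt_or_gt_of_ne hz with hlt | hlt
    · filter_upwards [hc1.eventually_lt hc2 hlt] with y hy
      simp [hy, hlt]
    · filter_upwards [hc2.eventually_lt hc1 hlt] with y hy
      simp [hy.le, hlt.le]

lemma exists_gaussBelow_eq {a : ℝ} (h0 : 0 < a) (h1 : a < 1) : ∃ q, gaussBelow q 1 = a := by
  have heq : (fun q ↦ gaussBelow q 1) = cdf (gaussianReal 0 1) := by
    ext q
    have := nullSingletonClass_gaussianReal (μ := 0) (v := 1) one_ne_zero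
    rw [cdf_eq_real, gaussBelow]
    simp only [one_mul]
    exact measureReal_congr Iio_ae_eq_Iic
  have hc : Continuous fun q ↦ gaussBelow q 1 := by
    refine continuous_iff_continuousAt.2 fun q ↦ ?_
    exact (continuousAt_gaussBelow (x₀ := q) (σ₀ := 1) (Or.inr one_ne_zero)).comp
      (f := fun q : ℝ ↦ (q, (1 : ℝ))) (by fun_prop)
  exact mem_range_of_exists_le_of_exists_ge hc
    (((heq ▸ tendsto_cdf_atBot _ : Tendsto (fun q ↦ gaussBelow q 1) _ _).eventually_lt_const
      h0).exists.imp fun _ h ↦ h.le)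
    (((heq ▸ tendsto_cdf_atTop _ : Tendsto (fun q ↦ gaussBelow q 1) _ _).eventually_const_lt
      h1).exists.imp fun _ h ↦ h.le)

/-- The filtration generated by the paths of a measurable process. -/
def pathFiltration {Ω : Type*} {mΩ : MeasurableSpace Ω} (B : ℝ≥0 → Ω → ℝ)
    (hm : ∀ t, Measurable (B t)) : Filtration ℝ≥0 mΩ where
  seq t := MeasurableSpace.comap (fun ω (s : Set.Iic t) ↦ B s ω) inferInstance
  mono' s t hst := by
    have hR : Measurable fun (f : Set.Iic t → ℝ) (u : Set.Iic s) ↦ f ⟨u, u.2.trans hst⟩ := by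
      fun_prop
    have h := MeasurableSpace.comap_mono (g := fun ω (s : Set.Iic t) ↦ B s ω) hR.comap_le
    rwa [MeasurableSpace.comap_comp] at h
  le' t := (measurable_pi_lambda (fun ω (s : Set.Iic t) ↦ B s ω) fun u ↦ hm u).comap_le

lemma measurable_pathFiltration {Ω : Type*} {_ : MeasurableSpace Ω} {B : ℝ≥0 → Ω → ℝ}
    (hm : ∀ t, Measurable (B t)) {s t : ℝ≥0} (hst : s ≤ t) :
    Measurable[pathFiltration B hm t] (B s) :=
  Measurable.comp (g := fun f : Set.Iic t → ℝ ↦ f ⟨s, hst⟩) (measurable_pi_apply _)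
    (comap_measurable fun ω (s : Set.Iic t) ↦ B s ω)

/-- The conditional probability, at time `t`, that the increment of `B` over `[j, j + 1]` is
below `q`. -/
noncomputable def stageProb {Ω : Type*} (B : ℝ≥0 → Ω → ℝ) (q : ℝ) (j : ℕ) (t : ℝ≥0) (ω : Ω) : ℝ :=
  gaussBelow (q - (B (min t (j + 1)) ω - B (min t j) ω)) √(max 0 (min 1 (j + 1 - t)))

lemma stageProb_of_le {Ω : Type*} (B : ℝ≥0 → Ω → ℝ) (q : ℝ) {j : ℕ} {t : ℝ≥0} (h : t ≤ j)
    (ω : Ω) : stageProb B q j t ω = gaussBelow q 1 := by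
  have h' : (t : ℝ) ≤ j := by exact_mod_cast h
  rw [stageProb, min_eq_left h, min_eq_left (h.trans (by simp)), min_eq_left (by linarith),
    max_eq_right zero_le_one, Real.sqrt_one, sub_self, sub_zero]

lemma stageProb_of_ge {Ω : Type*} (B : ℝ≥0 → Ω → ℝ) (q : ℝ) {j : ℕ} {t : ℝ≥0} (h : j + 1 ≤ t)
    (ω : Ω) : stageProb B q j t ω = if B (j + 1) ω - B j ω < q then 1 else 0 := by
  have h' : (j + 1 : ℝ) ≤ t := by exact_mod_cast h
  rw [stageProb, min_eq_right h, min_eq_right (le_trans (by simp) h),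
    max_eq_left ((min_le_right _ _).trans (by linarith)), Real.sqrt_zero, gaussBelow_zero]
  simp only [sub_pos]

lemma continuous_stageProb {Ω : Type*} {B : ℝ≥0 → Ω → ℝ} {q : ℝ} {j : ℕ} {ω : Ω}
    (hc : Continuous fun t ↦ B t ω) (hne : B (j + 1) ω - B j ω ≠ q) :
    Continuous fun t ↦ stageProb B q j t ω := by
  refine continuous_iff_continuousAt.2 fun t ↦ ?_
  refine (continuousAt_gaussBelow ?_).comp (x := t) (f := fun t : ℝ≥0 ↦
    (q - (B (min t (j + 1)) ω - B (min t j) ω), √(max 0 (min 1 ((j : ℝ) + 1 - t))))) ?_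
  · rcases lt_or_ge t (j + 1) with h | h
    · right
      have h' : (t : ℝ) < j + 1 := by exact_mod_cast h
      refine (Real.sqrt_pos.2 ?_).ne'
      exact lt_max_of_lt_right (lt_min one_pos (by linarith))
    · left
      rw [min_eq_right h, min_eq_right (le_trans (by simp) h)]
      exact sub_ne_zero.2 hne.symm
  · have h1 : Continuous fun t : ℝ≥0 ↦ B (min t (j + 1)) ω := hc.comp (by fun_prop)
    have h2 : Continuous fun t : ℝ≥0 ↦ B (min t j) ω := hc.comp (by fun_prop)
    fun_prop

lemma measurable_gaussBelow (σ : ℝ) : Measurable fun x ↦ gaussBelow x σ := by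
  refine Monotone.measurable fun x y hxy ↦ ?_
  exact measureReal_mono fun z (hz : _ < _) ↦ hz.trans_le hxy

lemma measurable_stageProb {Ω : Type*} {mΩ : MeasurableSpace Ω} {B : ℝ≥0 → Ω → ℝ}
    (hm : ∀ t, Measurable (B t)) (q : ℝ) (j : ℕ) (t : ℝ≥0) :
    Measurable[pathFiltration B hm t] (stageProb B q j t) :=
  (measurable_gaussBelow _).comp (measurable_const.sub
    ((measurable_pathFiltration hm (min_le_left _ _)).sub
      (measurable_pathFiltration hm (min_le_left _ _))))

lemma stageProb_mem_Icc {Ω : Type*} (B : ℝ≥0 → Ω → ℝ) (q : ℝ) (j : ℕ) (t : ℝ≥0) (ω : Ω) :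
    stageProb B q j t ω ∈ Icc (0 : ℝ) 1 := ⟨gaussBelow_nonneg _ _, gaussBelow_le_one _ _⟩

lemma stageProb_ae_eq_condExp {Ω : Type*} {mΩ : MeasurableSpace Ω} {P : Measure Ω}
    {B : ℝ≥0 → Ω → ℝ} (hm : ∀ t, Measurable (B t)) (hB : IsPreBrownianReal B P) (q : ℝ) {j : ℕ}
    {t : ℝ≥0} (h1 : j ≤ t) (h2 : t ≤ j + 1) :
    stageProb B q j t =ᵐ[P]
      P[{ω | B (j + 1) ω - B j ω < q}.indicator (fun _ ↦ (1 : ℝ)) | pathFiltration B hm t] := by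
  have := hB.isGaussianProcess.isProbabilityMeasure
  set u : ℝ≥0 := j + 1 - t with hu
  have htu : t + u = j + 1 := add_tsub_cancel_of_le h2
  have hV : Measurable fun ω ↦ B (t + u) ω - B t ω := (hm _).sub (hm _)
  have hind : Indep (pathFiltration B hm t)
      (MeasurableSpace.comap (fun ω ↦ B (t + u) ω - B t ω) inferInstance) P := by
    have h := (hB.indepFun_shift t).symm
    exact ((IndepFun_iff_Indep _ _ _).1 (h.comp measurable_id (measurable_pi_apply u)))
  have hlaw : P.map (fun ω ↦ B (t + u) ω - B t ω) =
      gaussianReal 0 (√(max 0 (min 1 ((j : ℝ) + 1 - t))) ^ 2).toNNReal := by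
    rw [((hB.shift t).hasLaw_eval u).map_eq]
    congr 1
    have e : (u : ℝ) = j + 1 - t := by
      have : (t : ℝ) + u = j + 1 := by exact_mod_cast htu
      linarith
    have h1' : (j : ℝ) ≤ t := by exact_mod_cast h1
    rw [Real.sq_sqrt (le_max_left _ _), ← e, min_eq_right (by linarith), max_eq_right u.coe_nonneg,
      Real.toNNReal_coe]
  have key := condExp_indicator_add_lt ((pathFiltration B hm).le t)
    (U := fun ω ↦ B t ω - B j ω)
    ((measurable_pathFiltration hm le_rfl).sub (measurable_pathFiltration hm h1)) hV hind hlaw q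
  simp_rw [gaussianReal_real_add_lt, htu] at key
  convert key using 1
  · ext ω
    rw [stageProb, min_eq_left h2, min_eq_right h1]
  · congr 2
    ext ω
    simp only [mem_ofPred_eq]
    constructor <;> intro h <;> linarith

/-- The event that the first `j` unit increments of `B` are below the levels `q`. -/
def stageEvent {Ω : Type*} (B : ℝ≥0 → Ω → ℝ) (q : ℕ → ℝ) (j : ℕ) : Set Ω :=
  {ω | ∀ i < j, B (i + 1) ω - B i ω < q i}

lemma stageEvent_succ {Ω : Type*} (B : ℝ≥0 → Ω → ℝ) (q : ℕ → ℝ) (j : ℕ) :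
    stageEvent B q (j + 1) = stageEvent B q j ∩ {ω | B (j + 1) ω - B j ω < q j} := by
  ext ω
  simp only [stageEvent, mem_inter_iff, mem_ofPred_eq]
  exact Nat.forall_lt_succ_right

lemma stageEvent_antitone {Ω : Type*} (B : ℝ≥0 → Ω → ℝ) (q : ℕ → ℝ) :
    Antitone (stageEvent B q) := fun _ _ h _ hω i hi ↦ hω i (hi.trans_le h)

lemma measurableSet_stageEvent {Ω : Type*} {mΩ : MeasurableSpace Ω} {B : ℝ≥0 → Ω → ℝ}
    (hm : ∀ t, Measurable (B t)) (q : ℕ → ℝ) (j : ℕ) :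
    MeasurableSet[pathFiltration B hm j] (stageEvent B q j) := by
  induction j with
  | zero => simp [stageEvent]
  | succ j ih =>
    rw [stageEvent_succ]
    refine MeasurableSet.inter ((pathFiltration B hm).mono (by simp) _ ih) ?_
    refine measurableSet_lt (Measurable.sub ?_ ?_) measurable_const
    · exact measurable_pathFiltration hm (by push_cast; exact le_rfl)
    · exact measurable_pathFiltration hm (by simp)

/-- The martingale which, on `stageEvent B q j` and during the time interval `[j, j + 1]`, moves
from `0` to `-down` or `up` according to whether the increment of `B` is below `q j` or not. -/
noncomputable def stageTerm {Ω : Type*} (B : ℝ≥0 → Ω → ℝ) (q : ℕ → ℝ) (up down : ℝ) (j : ℕ)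
    (t : ℝ≥0) : Ω → ℝ :=
  (stageEvent B q j).indicator fun ω ↦ up - (up + down) * stageProb B (q j) j t ω

lemma stageTerm_of_le {Ω : Type*} {B : ℝ≥0 → Ω → ℝ} {q : ℕ → ℝ} {up down : ℝ} {j : ℕ}
    (hq : (up + down) * gaussBelow (q j) 1 = up) {t : ℝ≥0} (ht : t ≤ j) (ω : Ω) :
    stageTerm B q up down j t ω = 0 := by
  simp [stageTerm, indicator, stageProb_of_le B _ ht, hq]

lemma neg_down_le_stageTerm {Ω : Type*} {B : ℝ≥0 → Ω → ℝ} {q : ℕ → ℝ} {up down : ℝ} {j : ℕ}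
    (h : 0 ≤ up + down) (t : ℝ≥0) (ω : Ω) :
    -(stageEvent B q j).indicator (fun _ ↦ down) ω ≤ stageTerm B q up down j t ω := by
  unfold stageTerm indicator
  split_ifs
  · nlinarith [(stageProb_mem_Icc B (q j) j t ω).2]
  · simp

lemma abs_stageTerm_le {Ω : Type*} {B : ℝ≥0 → Ω → ℝ} {q : ℕ → ℝ} {up down : ℝ} {j : ℕ}
    (hup : 0 ≤ up) (hdown : 0 ≤ down) (t : ℝ≥0) (ω : Ω) :
    |stageTerm B q up down j t ω| ≤ up + down := by
  unfold stageTerm indicator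
  split_ifs
  · obtain ⟨h1, h2⟩ := stageProb_mem_Icc B (q j) j t ω
    rw [abs_le]
    constructor <;> nlinarith
  · simp only [abs_zero]
    positivity

lemma continuous_stageTerm {Ω : Type*} {B : ℝ≥0 → Ω → ℝ} {q : ℕ → ℝ} {j : ℕ} {ω : Ω}
    (hc : Continuous fun t ↦ B t ω) (hne : B (j + 1) ω - B j ω ≠ q j) (up down : ℝ) :
    Continuous fun t ↦ stageTerm B q up down j t ω := by
  have := continuous_stageProb hc hne
  unfold stageTerm indicator
  split_ifs <;> fun_prop

lemma measurable_stageTerm {Ω : Type*} {mΩ : MeasurableSpace Ω} {B : ℝ≥0 → Ω → ℝ}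
    (hm : ∀ t, Measurable (B t)) {q : ℕ → ℝ} {up down : ℝ} {j : ℕ}
    (hq : (up + down) * gaussBelow (q j) 1 = up) (t : ℝ≥0) :
    Measurable[pathFiltration B hm t] (stageTerm B q up down j t) := by
  rcases le_total t j with h | h
  · rw [funext (stageTerm_of_le hq h)]
    exact measurable_const
  · refine Measurable.indicator ?_
      ((pathFiltration B hm).mono h _ (measurableSet_stageEvent hm q j))
    exact measurable_const.sub ((measurable_stageProb hm (q j) j t).const_mul _)

lemma stageTerm_ae_eq_condExp {Ω : Type*} {mΩ : MeasurableSpace Ω} {P : Measure Ω}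
    {B : ℝ≥0 → Ω → ℝ} (hm : ∀ t, Measurable (B t)) (hB : IsPreBrownianReal B P) {q : ℕ → ℝ}
    {up down : ℝ} {j : ℕ} (hq : (up + down) * gaussBelow (q j) 1 = up) (hup : 0 ≤ up)
    (hdown : 0 ≤ down) (t : ℝ≥0) :
    stageTerm B q up down j t =ᵐ[P]
      P[stageTerm B q up down j (j + 1) | pathFiltration B hm t] := by
  have := hB.isGaussianProcess.isProbabilityMeasure
  have hinteg s : Integrable (stageTerm B q up down j s) P :=
    Integrable.of_bound ((measurable_stageTerm hm hq s).mono
      ((pathFiltration B hm).le s) le_rfl).aestronglyMeasurable (up + down)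
      (Eventually.of_forall fun ω ↦ abs_stageTerm_le hup hdown s ω)
  have hmid {s : ℝ≥0} (h1 : j ≤ s) (h2 : s ≤ j + 1) : stageTerm B q up down j s =ᵐ[P]
      P[stageTerm B q up down j (j + 1) | pathFiltration B hm s] := by
    have hS : MeasurableSet {ω | B (j + 1) ω - B j ω < q j} :=
      measurableSet_lt ((hm _).sub (hm _)) measurable_const
    set D : Ω → ℝ := {ω | B (j + 1) ω - B j ω < q j}.indicator fun _ ↦ (1 : ℝ)
    have hD : Integrable D P := (integrable_const _).indicator hS
    have e : stageTerm B q up down j (j + 1) =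
        (stageEvent B q j).indicator ((fun _ ↦ up) - (up + down) • D) := by
      unfold stageTerm
      congr 1
      ext ω
      simp only [Pi.sub_apply, Pi.smul_apply, smul_eq_mul, stageProb_of_ge B _ le_rfl]
      rfl
    rw [e]
    have hle := (pathFiltration B hm).le s
    have h3 := condExp_indicator (m := pathFiltration B hm s)
      ((integrable_const up).sub (hD.smul (up + down)))
      ((pathFiltration B hm).mono h1 _ (measurableSet_stageEvent hm q j))
    have h4 := condExp_sub (m := pathFiltration B hm s) (integrable_const (μ := P) up)
      (hD.smul (up + down))
    have h5 := condExp_smul (μ := P) (up + down) D (pathFiltration B hm s)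
    have h6 := stageProb_ae_eq_condExp hm hB (q j) h1 h2
    filter_upwards [h3, h4, h5, h6] with ω h3 h4 h5 h6
    rw [h3]
    unfold stageTerm indicator
    split_ifs
    · rw [h4, Pi.sub_apply, h5, condExp_const hle, Pi.smul_apply, smul_eq_mul, ← h6]
    · rfl
  rcases le_total t j with h | h
  · have h0 := hmid le_rfl (by simp : (j : ℝ≥0) ≤ j + 1)
    have e : stageTerm B q up down j j = 0 := funext (stageTerm_of_le hq le_rfl)
    have e' : stageTerm B q up down j t = 0 := funext (stageTerm_of_le hq h)
    rw [e] at h0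
    have h1 := condExp_condExp_of_le (f := stageTerm B q up down j (j + 1)) (μ := P)
      ((pathFiltration B hm).mono h) ((pathFiltration B hm).le j)
    rw [e']
    refine EventuallyEq.trans ?_ h1
    refine EventuallyEq.trans ?_ (condExp_congr_ae h0)
    rw [condExp_zero]
  rcases le_total t (j + 1) with h' | h'
  · exact hmid h h'
  · have e : stageTerm B q up down j t = stageTerm B q up down j (j + 1) := by
      unfold stageTerm
      simp_rw [stageProb_of_ge B _ h', stageProb_of_ge B _ le_rfl]
    rw [e, condExp_of_stronglyMeasurable ((pathFiltration B hm).le t) _ (hinteg _)]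
    rw [← e]
    exact (measurable_stageTerm hm hq t).stronglyMeasurable

/-- The sum of the first `n` stage martingales. -/
noncomputable def stageSum {Ω : Type*} (B : ℝ≥0 → Ω → ℝ) (q up down : ℕ → ℝ) (n : ℕ) (t : ℝ≥0)
    (ω : Ω) : ℝ :=
  ∑ j ∈ Finset.range n, stageTerm B q (up j) (down j) j t ω

lemma martingale_stageSum {Ω : Type*} {mΩ : MeasurableSpace Ω} {P : Measure Ω}
    {B : ℝ≥0 → Ω → ℝ} (hm : ∀ t, Measurable (B t)) (hB : IsPreBrownianReal B P)
    {q up down : ℕ → ℝ} (hq : ∀ j, (up j + down j) * gaussBelow (q j) 1 = up j)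
    (hup : ∀ j, 0 ≤ up j) (hdown : ∀ j, 0 ≤ down j) (n : ℕ) :
    Martingale (stageSum B q up down n) (pathFiltration B hm) P := by
  have := hB.isGaussianProcess.isProbabilityMeasure
  have hterm j : Martingale (stageTerm B q (up j) (down j) j) (pathFiltration B hm) P := by
    refine ⟨fun t ↦ (measurable_stageTerm hm (hq j) t).stronglyMeasurable, fun s t hst ↦ ?_⟩
    have hs := stageTerm_ae_eq_condExp hm hB (hq j) (hup j) (hdown j) s
    have ht := stageTerm_ae_eq_condExp hm hB (hq j) (hup j) (hdown j) t
    exact ((condExp_congr_ae ht).trans (condExp_condExp_of_le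
      ((pathFiltration B hm).mono hst) ((pathFiltration B hm).le t))).trans hs.symm
  induction n with
  | zero =>
    convert martingale_zero ℝ (pathFiltration B hm) P using 1
    ext t ω
    simp [stageSum]
  | succ n ih =>
    convert ih.add (hterm n) using 1
    ext t ω
    simp [stageSum, Finset.sum_range_succ]

lemma stageTerm_of_ge {Ω : Type*} (B : ℝ≥0 → Ω → ℝ) (q : ℕ → ℝ) (up down : ℝ) {j : ℕ} {t : ℝ≥0}
    (ht : j + 1 ≤ t) (ω : Ω) :
    stageTerm B q up down j t ω = (stageEvent B q j).indicator 1 ω * up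
      - (stageEvent B q (j + 1)).indicator 1 ω * (up + down) := by
  by_cases h : ω ∈ stageEvent B q j <;> by_cases h' : B (j + 1) ω - B j ω < q j <;>
    simp [stageTerm, stageEvent_succ, stageProb_of_ge B _ ht, indicator, h, h']

/-- A nonincreasing sequence of indicators starting from `1` either stays equal to `1` up to
time `n` or jumps to `0` at a single time. -/
lemma sum_indicator_sub_eq {Ω : Type*} {A : ℕ → Set Ω} (hA : Antitone A) {ω : Ω} (h0 : ω ∈ A 0)
    (n : ℕ) :
    (ω ∈ A n ∧ ∀ G : ℕ → ℝ, ∑ j ∈ Finset.range n,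
      ((A j).indicator (1 : Ω → ℝ) ω - (A (j + 1)).indicator 1 ω) * G j = 0) ∨
    (ω ∉ A n ∧ ∃ i, ∀ G : ℕ → ℝ, ∑ j ∈ Finset.range n,
      ((A j).indicator (1 : Ω → ℝ) ω - (A (j + 1)).indicator 1 ω) * G j = G i) := by
  induction n with
  | zero => simp [h0]
  | succ n ih =>
    rcases ih with ⟨h, hG⟩ | ⟨h, i, hG⟩
    · by_cases h' : ω ∈ A (n + 1)
      · exact .inl ⟨h', fun G ↦ by simp [Finset.sum_range_succ, hG, h, h']⟩
      · exact .inr ⟨h', n, fun G ↦ by simp [Finset.sum_range_succ, hG, h, h']⟩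
    · have h' : ω ∉ A (n + 1) := fun h' ↦ h (hA n.le_succ h')
      exact .inr ⟨h', i, fun G ↦ by simp [Finset.sum_range_succ, hG, h, h']⟩

lemma sum_mul_sub_eq (a G : ℕ → ℝ) (hG : G 0 = 0) (n : ℕ) :
    ∑ j ∈ Finset.range n, a j * (G (j + 1) - G j) =
      ∑ j ∈ Finset.range n, (a j - a (j + 1)) * G (j + 1) + a n * G n := by
  induction n with
  | zero => simp [hG]
  | succ n ih =>
    rw [Finset.sum_range_succ, Finset.sum_range_succ, ih]
    ring

lemma comp_sum_indicator_mul_sub {Ω : Type*} {A : ℕ → Set Ω} (hA : Antitone A) {ω : Ω}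
    (h0 : ω ∈ A 0) (n : ℕ) {y : ℕ → ℝ} (hy : y 0 = 0) {F : ℝ → ℝ} (hF : F 0 = 0) :
    F (∑ j ∈ Finset.range n, (A j).indicator 1 ω * (y (j + 1) - y j)) =
      ∑ j ∈ Finset.range n, (A j).indicator 1 ω * (F (y (j + 1)) - F (y j)) := by
  rw [sum_mul_sub_eq _ _ hy, sum_mul_sub_eq _ (fun j ↦ F (y j)) (by rw [hy, hF])]
  rcases sum_indicator_sub_eq hA h0 n with ⟨h, hG⟩ | ⟨h, i, hG⟩
  · rw [hG fun j ↦ y (j + 1), hG fun j ↦ F (y (j + 1))]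
    simp [h]
  · rw [hG fun j ↦ y (j + 1), hG fun j ↦ F (y (j + 1))]
    simp [h]

lemma stageSum_natCast {Ω : Type*} (B : ℝ≥0 → Ω → ℝ) (q : ℕ → ℝ) {y : ℕ → ℝ} (hy : y 0 = 0)
    (h : ℕ → ℝ) (n : ℕ) (ω : Ω) :
    stageSum B q (fun j ↦ h j + y j) (fun j ↦ y (j + 1) - y j) n n ω =
      ∑ j ∈ Finset.range n, ((stageEvent B q j).indicator (1 : Ω → ℝ) ω
        - (stageEvent B q (j + 1)).indicator 1 ω) * h j
      - (stageEvent B q n).indicator 1 ω * y n := by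
  have e : stageSum B q (fun j ↦ h j + y j) (fun j ↦ y (j + 1) - y j) n n ω =
      ∑ j ∈ Finset.range n, ((stageEvent B q j).indicator (1 : Ω → ℝ) ω * (h j + y j)
        - (stageEvent B q (j + 1)).indicator 1 ω * (h j + y (j + 1))) := by
    refine Finset.sum_congr rfl fun j hj ↦ ?_
    rw [stageTerm_of_ge B q _ _ (by exact_mod_cast Finset.mem_range.1 hj)]
    ring
  rw [e]
  clear e
  induction n with
  | zero => simp [hy]
  | succ n ih =>
    rw [Finset.sum_range_succ, Finset.sum_range_succ, ih]
    ring

lemma comp_stageSum_natCast {Ω : Type*} (B : ℝ≥0 → Ω → ℝ) (q : ℕ → ℝ) {y : ℕ → ℝ} (hy : y 0 = 0)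
    (h : ℕ → ℝ) (F : ℝ → ℝ) (n : ℕ) (ω : Ω) :
    F (stageSum B q (fun j ↦ h j + y j) (fun j ↦ y (j + 1) - y j) n n ω) =
      ∑ j ∈ Finset.range n, ((stageEvent B q j).indicator (1 : Ω → ℝ) ω
        - (stageEvent B q (j + 1)).indicator 1 ω) * F (h j)
      + (stageEvent B q n).indicator 1 ω * F (-y n) := by
  rw [stageSum_natCast B q hy]
  rcases sum_indicator_sub_eq (stageEvent_antitone B q) (ω := ω) (by simp [stageEvent]) n with
    ⟨hn, hG⟩ | ⟨hn, i, hG⟩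
  · rw [hG h, hG fun j ↦ F (h j)]
    simp [hn]
  · rw [hG h, hG fun j ↦ F (h j)]
    simp [hn]

/-- The running minimum of `min f 0` lies between `-b` and `0` if `f` is at least `-b`. -/
lemma iInf_min_zero_mem_Icc {f : ℝ≥0 → ℝ} {b : ℝ} (hb : 0 ≤ b) (hf : ∀ s, -b ≤ f s) (t : ℝ≥0) :
    (⨅ s : Set.Icc (0 : ℝ≥0) t, min (f s.1) 0) ∈ Icc (-b) 0 := by
  have : Nonempty (Set.Icc (0 : ℝ≥0) t) := ⟨0, by simp⟩
  have hbdd : ∀ s : Set.Icc (0 : ℝ≥0) t, -b ≤ min (f s.1) 0 := fun s ↦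
    le_min (hf _) (by linarith)
  exact ⟨le_ciInf hbdd, (ciInf_le ⟨-b, by rintro _ ⟨s, rfl⟩; exact hbdd s⟩
    ⟨0, by simp⟩).trans (min_le_right _ _)⟩

lemma iInf_min_zero_le {f : ℝ≥0 → ℝ} {b : ℝ} (hb : 0 ≤ b) (hf : ∀ s, -b ≤ f s) {s t : ℝ≥0}
    (hst : s ≤ t) : (⨅ s : Set.Icc (0 : ℝ≥0) t, min (f s.1) 0) ≤ f s :=
  (ciInf_le ⟨-b, by rintro _ ⟨s, rfl⟩; exact le_min (hf _) (by linarith)⟩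
    (⟨s, by simp [hst]⟩ : Set.Icc (0 : ℝ≥0) t)).trans (min_le_left _ _)

lemma measurable_iInf_min_zero {Ω : Type*} {mΩ : MeasurableSpace Ω} {X : ℝ≥0 → Ω → ℝ}
    (hX : ∀ t, Measurable (X t)) (hc : ∀ ω, Continuous fun t ↦ X t ω) (t : ℝ≥0) :
    Measurable fun ω ↦ ⨅ s : Set.Icc (0 : ℝ≥0) t, min (X s.1 ω) 0 := by
  obtain ⟨S, hS, hd⟩ := TopologicalSpace.exists_countable_dense (Set.Icc (0 : ℝ≥0) t)
  have := hS.to_subtype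
  have e ω : ⨅ s : Set.Icc (0 : ℝ≥0) t, min (X s.1 ω) 0 = ⨅ s : S, min (X s.1.1 ω) 0 := by
    refine (hd.ciInf' (f := fun s : Set.Icc (0 : ℝ≥0) t ↦ min (X s.1 ω) 0) ?_).symm
    have := hc ω
    fun_prop
  simp_rw [e]
  exact Measurable.iInf fun s ↦ (hX _).min measurable_const

lemma measureReal_stageEvent_succ {Ω : Type*} {mΩ : MeasurableSpace Ω} {P : Measure Ω}
    {B : ℝ≥0 → Ω → ℝ} (hm : ∀ t, Measurable (B t)) (hB : IsPreBrownianReal B P) {q : ℕ → ℝ}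
    {up down : ℝ} {j : ℕ} (hq : (up + down) * gaussBelow (q j) 1 = up) (hup : 0 ≤ up)
    (hdown : 0 ≤ down) :
    P.real (stageEvent B q (j + 1)) * (up + down) = P.real (stageEvent B q j) * up := by
  have := hB.isGaussianProcess.isProbabilityMeasure
  have hA i : MeasurableSet (stageEvent B q i) :=
    (pathFiltration B hm).le _ _ (measurableSet_stageEvent hm q i)
  have h0 := integral_congr_ae (stageTerm_ae_eq_condExp hm hB hq hup hdown 0)
  rw [integral_condExp ((pathFiltration B hm).le 0)] at h0
  simp_rw [stageTerm_of_le hq (zero_le : (0 : ℝ≥0) ≤ j),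
    stageTerm_of_ge B q up down (le_refl ((j : ℝ≥0) + 1))] at h0
  have hinteg i (a : ℝ) : Integrable (fun ω ↦ (stageEvent B q i).indicator 1 ω * a) P :=
    (((integrable_const (1 : ℝ)).indicator (hA i)).mul_const a)
  rw [integral_sub (hinteg _ _) (hinteg _ _), integral_mul_const, integral_mul_const,
    integral_indicator_one (hA _), integral_indicator_one (hA _)] at h0
  simp only [integral_zero] at h0
  linarith

lemma exists_martingale_of_stages {p : ℝ} (hp : 0 < p) {n : ℕ} {y h π : ℕ → ℝ} (hy0 : y 0 = 0)
    (hy : StrictMono y) (hh : ∀ j, 0 < h j) (hπ0 : π 0 = 1)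
    (hπ : ∀ j, π (j + 1) * (h j + y (j + 1)) = π j * (h j + y j)) {c : ℝ} (hc : 0 ≤ c)
    (hlt : c ^ p * ∑ j ∈ Finset.range n, π j * (y (j + 1) ^ p - y j ^ p) <
      ∑ j ∈ Finset.range n, (π j - π (j + 1)) * h j ^ p + π n * y n ^ p) :
    ∃ (Ω : Type) (m0 : MeasurableSpace Ω) (P : Measure Ω),
      IsProbabilityMeasure P ∧ P.IsComplete ∧
      ∃ (ℱ : Filtration ℝ≥0 m0) (X : ℝ≥0 → Ω → ℝ),
        Martingale X ℱ P ∧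
        (∀ ω, Continuous fun t => X t ω) ∧
        (∀ᵐ ω ∂P, X 0 ω = 0) ∧
        (0 < ⨆ t : ℝ≥0,
          (∫ ω, (-(⨅ s : Set.Icc (0 : ℝ≥0) t, min (X s.1 ω) 0)) ^ p ∂P) ^ (1 / p)) ∧
        BddAbove (Set.range fun t : ℝ≥0 =>
          (∫ ω, (-(⨅ s : Set.Icc (0 : ℝ≥0) t, min (X s.1 ω) 0)) ^ p ∂P) ^ (1 / p)) ∧
        (⨆ t : ℝ≥0, (∫ ω, |X t ω| ^ p ∂P) ^ (1 / p))
          > c * ⨆ t : ℝ≥0,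
              (∫ ω, (-(⨅ s : Set.Icc (0 : ℝ≥0) t, min (X s.1 ω) 0)) ^ p ∂P) ^ (1 / p) := by
  have hn : n ≠ 0 := by
    rintro rfl
    simp [hy0, Real.zero_rpow hp.ne'] at hlt
  have hy_nonneg j : 0 ≤ y j := hy0 ▸ hy.monotone (Nat.zero_le j)
  have hup j : 0 < h j + y j := by linarith [hh j, hy_nonneg j]
  have hdown j : 0 < y (j + 1) - y j := sub_pos.2 (hy j.lt_succ_self)
  set up : ℕ → ℝ := fun j ↦ h j + y j
  set down : ℕ → ℝ := fun j ↦ y (j + 1) - y j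
  have hq' j : ∃ q, (up j + down j) * gaussBelow q 1 = up j := by
    have h1 : 0 < up j + down j := add_pos (hup j) (hdown j)
    obtain ⟨q, hq⟩ := exists_gaussBelow_eq (div_pos (hup j) h1)
      ((div_lt_one h1).2 (lt_add_of_pos_right _ (hdown j)))
    exact ⟨q, by rw [hq, mul_div_cancel₀ _ h1.ne']⟩
  choose q hq using hq'
  obtain ⟨Ω, m0, P, B, hP, hm, hB, hBc, hBq⟩ := exists_isPreBrownianReal_complete q
  have hprob := hB.isGaussianProcess.isProbabilityMeasure
  refine ⟨Ω, m0, P, hprob, hP, pathFiltration B hm, stageSum B q up down n,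
    martingale_stageSum hm hB hq (fun j ↦ (hup j).le) (fun j ↦ (hdown j).le) n, ?_⟩
  have hXm t : Measurable (stageSum B q up down n t) :=
    Finset.measurable_fun_sum _ fun j _ ↦
      (measurable_stageTerm hm (hq j) t).mono ((pathFiltration B hm).le t) le_rfl
  have hXc ω : Continuous fun t ↦ stageSum B q up down n t ω :=
    continuous_finsetSum _ fun j _ ↦ continuous_stageTerm (hBc ω) (hBq ω j) _ _
  set X := stageSum B q up down n with hX
  refine ⟨hXc, .of_forall fun ω ↦ Finset.sum_eq_zero fun j _ ↦ stageTerm_of_le (hq j) (by simp) ω,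
    ?_⟩
  have hA i : MeasurableSet (stageEvent B q i) :=
    (pathFiltration B hm).le _ _ (measurableSet_stageEvent hm q i)
  have hPA i : P.real (stageEvent B q i) = π i := by
    induction i with
    | zero => simp [stageEvent, hπ0]
    | succ i ih =>
      have e := measureReal_stageEvent_succ hm hB (hq i) (hup i).le (hdown i).le
      have e' := hπ i
      have hne : up i + down i ≠ 0 := (add_pos (hup i) (hdown i)).ne'
      refine mul_right_cancel₀ hne ?_
      rw [e, ih, ← e']
      simp [up, down]
  have hπpos i : 0 < π i := by
    induction i with
    | zero => simp [hπ0]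
    | succ i ih =>
      refine pos_of_mul_pos_left (b := h i + y (i + 1)) ?_ (by linarith [hh i, hy_nonneg (i + 1)])
      rw [hπ i]
      exact mul_pos ih (hup i)
  have hinteg i (a : ℝ) : Integrable (fun ω ↦ (stageEvent B q i).indicator 1 ω * a) P :=
    (((integrable_const (1 : ℝ)).indicator (hA i)).mul_const a)
  have hE i (a : ℝ) : ∫ ω, (stageEvent B q i).indicator 1 ω * a ∂P = π i * a := by
    rw [integral_mul_const, integral_indicator_one (hA _), hPA]
  set Y : Ω → ℝ := fun ω ↦
    ∑ j ∈ Finset.range n, (stageEvent B q j).indicator 1 ω * (y (j + 1) - y j)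
  have hY_nonneg ω : 0 ≤ Y ω := Finset.sum_nonneg fun j _ ↦
    mul_nonneg (indicator_nonneg (by simp) _) (hdown j).le
  have hXY ω t : -Y ω ≤ X t ω := by
    rw [← Finset.sum_neg_distrib]
    refine Finset.sum_le_sum fun j _ ↦ le_trans (le_of_eq ?_)
      (neg_down_le_stageTerm (add_pos (hup j) (hdown j)).le t ω)
    simp [indicator]
  have hYp ω : Y ω ^ p = ∑ j ∈ Finset.range n,
      (stageEvent B q j).indicator 1 ω * (y (j + 1) ^ p - y j ^ p) :=
    comp_sum_indicator_mul_sub (stageEvent_antitone B q) (by simp [stageEvent]) n hy0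
      (F := fun x ↦ x ^ p) (Real.zero_rpow hp.ne')
  have hYint : Integrable (fun ω ↦ Y ω ^ p) P := by
    simp_rw [hYp]
    exact integrable_finsetSum _ fun j _ ↦ hinteg _ _
  have hEY : ∫ ω, Y ω ^ p ∂P = ∑ j ∈ Finset.range n, π j * (y (j + 1) ^ p - y j ^ p) := by
    simp_rw [hYp]
    rw [integral_finsetSum _ fun j _ ↦ hinteg _ _]
    simp_rw [hE]
  have hEX : ∫ ω, |X n ω| ^ p ∂P =
      ∑ j ∈ Finset.range n, (π j - π (j + 1)) * h j ^ p + π n * y n ^ p := by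
    have e ω : |X n ω| ^ p = ∑ j ∈ Finset.range n,
        ((stageEvent B q j).indicator 1 ω * h j ^ p
          - (stageEvent B q (j + 1)).indicator 1 ω * h j ^ p)
        + (stageEvent B q n).indicator 1 ω * y n ^ p := by
      have := comp_stageSum_natCast B q hy0 h (fun x ↦ |x| ^ p) n ω
      simpa only [abs_neg, abs_of_nonneg (hy_nonneg _), abs_of_pos (hh _), sub_mul] using this
    simp_rw [e]
    have hsub j : Integrable (fun ω ↦ (stageEvent B q j).indicator 1 ω * h j ^ p
        - (stageEvent B q (j + 1)).indicator 1 ω * h j ^ p) P := (hinteg _ _).sub (hinteg _ _)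
    rw [integral_add (integrable_finsetSum _ fun j _ ↦ hsub j) (hinteg _ _),
      integral_finsetSum _ fun j _ ↦ hsub j, hE]
    congr 1
    refine Finset.sum_congr rfl fun j _ ↦ ?_
    rw [integral_sub (hinteg _ _) (hinteg _ _), hE, hE, sub_mul]
  set I : ℝ≥0 → Ω → ℝ := fun t ω ↦ ⨅ s : Set.Icc (0 : ℝ≥0) t, min (X s.1 ω) 0
  have hI t ω : I t ω ∈ Icc (-Y ω) 0 := iInf_min_zero_mem_Icc (hY_nonneg ω) (hXY ω) t
  have hIp t ω : (-I t ω) ^ p ≤ Y ω ^ p :=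
    Real.rpow_le_rpow (by linarith [(hI t ω).2]) (by linarith [(hI t ω).1]) hp.le
  have hIp_nonneg t ω : 0 ≤ (-I t ω) ^ p := Real.rpow_nonneg (by linarith [(hI t ω).2]) _
  have hImono t : ∫ ω, (-I t ω) ^ p ∂P ≤ ∫ ω, Y ω ^ p ∂P :=
    integral_mono_of_nonneg (.of_forall fun ω ↦ hIp_nonneg t ω) hYint (.of_forall fun ω ↦ hIp t ω)
  have hIle t : (∫ ω, (-I t ω) ^ p ∂P) ^ (1 / p) ≤ (∫ ω, Y ω ^ p ∂P) ^ (1 / p) :=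
    Real.rpow_le_rpow (integral_nonneg fun ω ↦ hIp_nonneg t ω) (hImono t) (by positivity)
  have hIbdd : BddAbove (Set.range fun t : ℝ≥0 ↦ (∫ ω, (-I t ω) ^ p ∂P) ^ (1 / p)) :=
    ⟨_, by rintro _ ⟨t, rfl⟩; exact hIle t⟩
  refine ⟨?_, hIbdd, ?_⟩
  · refine lt_of_lt_of_le ?_ (le_ciSup hIbdd n)
    have hyn : 0 < y n := hy0 ▸ hy (Nat.pos_of_ne_zero hn)
    refine Real.rpow_pos_of_pos (lt_of_lt_of_le
      (mul_pos (hπpos n) (Real.rpow_pos_of_pos hyn p)) ?_) _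
    rw [← hE]
    refine integral_mono (hinteg _ _) ?_ fun ω ↦ ?_
    · refine hYint.mono' ?_ (.of_forall fun ω ↦ ?_)
      · exact ((measurable_iInf_min_zero hXm hXc n).neg.pow_const p).aestronglyMeasurable
      · rw [Real.norm_of_nonneg (hIp_nonneg n ω)]
        exact hIp n ω
    · by_cases hω : ω ∈ stageEvent B q n
      · have e : X n ω = -y n := by
          rw [hX, stageSum_natCast B q hy0]
          rcases sum_indicator_sub_eq (stageEvent_antitone B q) (ω := ω) (by simp [stageEvent]) n
            with ⟨-, hG⟩ | ⟨hω', -⟩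
          · simp [hG, hω]
          · exact absurd hω hω'
        have hle := iInf_min_zero_le (hY_nonneg ω) (hXY ω) (le_refl (n : ℝ≥0))
        simp only [indicator_of_mem hω, Pi.one_apply, one_mul]
        exact Real.rpow_le_rpow hyn.le (by linarith) hp.le
      · simpa [hω] using hIp_nonneg n ω
  · have hXbdd : BddAbove (Set.range fun t : ℝ≥0 ↦ (∫ ω, |X t ω| ^ p ∂P) ^ (1 / p)) := by
      refine ⟨(∫ ω, (∑ j ∈ Finset.range n, (up j + down j)) ^ p ∂P) ^ (1 / p), ?_⟩
      rintro _ ⟨t, rfl⟩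
      refine Real.rpow_le_rpow (integral_nonneg fun ω ↦ by positivity) ?_ (by positivity)
      refine integral_mono_of_nonneg (.of_forall fun ω ↦ by positivity) (integrable_const _)
        (.of_forall fun ω ↦ Real.rpow_le_rpow (abs_nonneg _) ?_ hp.le)
      exact (Finset.abs_sum_le_sum_abs _ _).trans (Finset.sum_le_sum fun j _ ↦
        abs_stageTerm_le (hup j).le (hdown j).le t ω)
    refine lt_of_le_of_lt (mul_le_mul_of_nonneg_left (ciSup_le hIle) hc)
      (lt_of_lt_of_le ?_ (le_ciSup hXbdd n))
    have hEY_nonneg : 0 ≤ ∫ ω, Y ω ^ p ∂P :=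
      integral_nonneg fun ω ↦ Real.rpow_nonneg (hY_nonneg ω) p
    calc c * (∫ ω, Y ω ^ p ∂P) ^ (1 / p)
        = (c ^ p * ∫ ω, Y ω ^ p ∂P) ^ (1 / p) := by
          rw [Real.mul_rpow (Real.rpow_nonneg hc p) hEY_nonneg, ← Real.rpow_mul hc,
            mul_one_div_cancel hp.ne', Real.rpow_one]
      _ < (∫ ω, |X n ω| ^ p ∂P) ^ (1 / p) := by
          refine Real.rpow_lt_rpow (mul_nonneg (Real.rpow_nonneg hc p) hEY_nonneg) ?_
            (by positivity)
          rw [hEY, hEX]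
          exact hlt

lemma eventually_pos_of_hasDerivAt {f : ℝ → ℝ} {f' a : ℝ} (hf : HasDerivAt f f' a) (ha : f a = 0)
    (hf' : 0 < f') : ∀ᶠ x in 𝓝[>] a, 0 < f x := by
  have h := (hasDerivAt_iff_tendsto_slope.1 hf).eventually_const_lt hf'
  have hle : 𝓝[>] a ≤ 𝓝[≠] a := nhdsWithin_mono a fun x hx ↦ ne_of_gt hx
  filter_upwards [hle h, self_mem_nhdsWithin] with x hx hxa
  rw [slope_def_field, ha, sub_zero] at hx
  exact (div_pos_iff_of_pos_right (sub_pos.2 hxa)).1 hx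

lemma exists_ratio {p k c' : ℝ} (hk1 : 1 < p * (k + 1))
    (hc' : c' * (p * (k + 1)) < p * (k + 1) + k ^ p - 1) :
    ∃ r : ℝ, 1 < r ∧ k + r ≤ (k + 1) * r ^ p ∧
      c' * (r ^ p - 1) * (k + r) < (r - 1) * k ^ p + (k + 1) * r ^ p - (k + r) := by
  have hd : HasDerivAt (fun r : ℝ ↦ r ^ p) p 1 := by
    simpa using Real.hasDerivAt_rpow_const (x := 1) (p := p) (.inl one_ne_zero)
  have hd' : HasDerivAt (fun r : ℝ ↦ k + r) 1 1 := (hasDerivAt_id 1).const_add k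
  have h1 := eventually_pos_of_hasDerivAt ((hd.const_mul (k + 1)).sub hd') (by simp)
    (by linarith)
  have h2 := eventually_pos_of_hasDerivAt
    ((((((hasDerivAt_id (1 : ℝ)).sub_const 1).mul_const (k ^ p)).add (hd.const_mul (k + 1))).sub
      hd').sub (((hd.sub_const 1).const_mul c').mul hd')) (by simp) (by
        simp only [Real.one_rpow]
        linarith)
  obtain ⟨r, h1, h2, h3⟩ := (h1.and (h2.and self_mem_nhdsWithin)).exists
  refine ⟨r, h3, ?_, ?_⟩
  · simp only [Pi.sub_apply] at h1
    linarith
  · simp only [Pi.sub_apply, Pi.add_apply, Pi.mul_apply, id] at h2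
    linarith

lemma exists_stages {p k c : ℝ} (hp : 0 < p) (hk : 0 < k) (hk1 : 1 < p * (k + 1))
    (hck : c ^ p * (p * (k + 1)) < p * (k + 1) + k ^ p - 1) :
    ∃ (n : ℕ) (y h π : ℕ → ℝ), y 0 = 0 ∧ StrictMono y ∧ (∀ j, 0 < h j) ∧ π 0 = 1 ∧
      (∀ j, π (j + 1) * (h j + y (j + 1)) = π j * (h j + y j)) ∧
      c ^ p * ∑ j ∈ Finset.range n, π j * (y (j + 1) ^ p - y j ^ p) <
        ∑ j ∈ Finset.range n, (π j - π (j + 1)) * h j ^ p + π n * y n ^ p := by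
  obtain ⟨r, hr, hg, hr'⟩ := exists_ratio hk1 hck
  have hkr : 0 < k + r := by linarith
  have hr0 : 0 < r := by linarith
  set ρ : ℝ := (k + 1) / (k + r) with hρ
  have hρ' : ρ * (k + r) = k + 1 := div_mul_cancel₀ _ hkr.ne'
  set g : ℝ := ρ * r ^ p with hgdef
  have hg1 : 1 ≤ g := by
    rw [hgdef, hρ, div_mul_eq_mul_div, one_le_div hkr]
    exact hg
  set d : ℝ := (1 - ρ) * k ^ p + g - 1 - c ^ p * (r ^ p - 1) with hd
  have hd0 : 0 < d := by
    refine pos_of_mul_pos_left (b := k + r) ?_ hkr.le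
    have : d * (k + r) = (r - 1) * k ^ p + (k + 1) * r ^ p - (k + r)
        - c ^ p * (r ^ p - 1) * (k + r) := by
      linear_combination (r ^ p - k ^ p) * hρ'
    linarith
  obtain ⟨m, hm⟩ := exists_nat_gt (2 * c ^ p / d)
  rw [div_lt_iff₀ hd0] at hm
  set T : ℝ := ∑ j ∈ Finset.range m, g ^ j with hT
  have hmT : (m : ℝ) ≤ T := by
    simpa using Finset.card_nsmul_le_sum (Finset.range m) (fun j ↦ g ^ j) 1
      fun j _ ↦ one_le_pow₀ hg1
  have hgT : g ^ m = 1 + (g - 1) * T := by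
    linarith [mul_geom_sum g m]
  have hpow (j : ℕ) : ρ ^ j * (r ^ j) ^ p = g ^ j := by
    rw [hgdef, mul_pow, ← Real.rpow_natCast_mul hr0.le, ← Real.rpow_mul_natCast hr0.le, mul_comm p]
  refine ⟨m + 1, fun j ↦ j.casesOn 0 fun j ↦ r ^ j, fun j ↦ j.casesOn 1 fun j ↦ k * r ^ j,
    fun j ↦ j.casesOn 1 fun j ↦ 1 / 2 * ρ ^ j, rfl, strictMono_nat_of_lt_succ fun j ↦ ?_,
    fun j ↦ ?_, rfl, fun j ↦ ?_, ?_⟩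
  · cases j with
    | zero => simp
    | succ j => exact pow_lt_pow_right₀ hr j.lt_succ_self
  · cases j with
    | zero => simp
    | succ j => exact mul_pos hk (pow_pos hr0 j)
  · cases j with
    | zero => norm_num
    | succ j =>
      simp only [pow_succ]
      linear_combination 1 / 2 * ρ ^ j * r ^ j * hρ'
  · have e1 (j : ℕ) : 1 / 2 * ρ ^ j * ((r ^ (j + 1)) ^ p - (r ^ j) ^ p) =
        1 / 2 * (r ^ p - 1) * g ^ j := by
      rw [← hpow, pow_succ r, Real.mul_rpow (by positivity) hr0.le]
      ring
    have e2 (j : ℕ) : (1 / 2 * ρ ^ j - 1 / 2 * ρ ^ (j + 1)) * (k * r ^ j) ^ p =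
        1 / 2 * (1 - ρ) * k ^ p * g ^ j := by
      rw [← hpow, Real.mul_rpow hk.le (by positivity)]
      ring
    rw [Finset.sum_range_succ', Finset.sum_range_succ']
    simp only [e1, e2, ← Finset.mul_sum, ← hT, mul_assoc (1 / 2 : ℝ) (ρ ^ m), hpow, hgT]
    simp only [Nat.rec_zero, pow_zero, Real.one_rpow, Real.zero_rpow hp.ne']
    nlinarith [mul_le_mul_of_nonneg_right hmT hd0.le]

lemma strictMonoOn_mul_log_sub_one_sub_mul_log :
    StrictMonoOn (fun x : ℝ ↦ (x + 1) * Real.log (x - 1) - x * Real.log x) (Ioi 1) := by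
  have hd (x : ℝ) (hx : 1 < x) :
      HasDerivAt (fun x : ℝ ↦ (x + 1) * Real.log (x - 1) - x * Real.log x)
        (1 * Real.log (x - 1) + (x + 1) * (1 / (x - 1)) - (1 * Real.log x + x * (1 / x))) x :=
    (((hasDerivAt_id x).add_const 1).mul (((hasDerivAt_id x).sub_const 1).log
      (sub_pos.2 hx).ne')).sub ((hasDerivAt_id x).mul ((hasDerivAt_id x).log (by simp; linarith)))
  refine strictMonoOn_of_deriv_pos (convex_Ioi 1)
    (fun x hx ↦ (hd x hx).continuousAt.continuousWithinAt) fun x hx ↦ ?_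
  rw [interior_Ioi] at hx
  have hx1 : 0 < x - 1 := sub_pos.2 hx
  have hx0 : 0 < x := by linarith
  rw [(hd x hx).deriv]
  have h1 := Real.log_le_sub_one_of_pos (div_pos hx0 hx1)
  rw [Real.log_div hx0.ne' hx1.ne'] at h1
  have h2 : x / (x - 1) - 1 = 1 / (x - 1) := by field_simp; ring
  have h3 : (x + 1) * (1 / (x - 1)) = 1 + 2 * (1 / (x - 1)) := by field_simp; ring
  have h4 : x * (1 / x) = 1 := by field_simp
  have h5 : 0 < 1 / (x - 1) := by positivity
  rw [h3, h4]
  linarith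

lemma one_lt_mul_add_one {p p₀ k α : ℝ} (hp1 : p < 1) (hp₀ : p₀ ∈ Ioo (0 : ℝ) 1)
    (hp₀eq : 1 / p₀ - 1 = (1 / p₀ - 1) ^ (1 - p₀) + 1) (h : p₀ < p) (hα : 0 < α)
    (hk : 0 < k) (hkα : k ^ (1 - p) = α) (hα' : (1 - p) * (k + 1) = α + 1) :
    1 < p * (k + 1) := by
  obtain ⟨h0, h1⟩ := hp₀
  have hp : 0 < p := h0.trans h
  by_contra! hcon
  set β : ℝ := 1 / p - 1 with hβ
  set β₀ : ℝ := 1 / p₀ - 1 with hβ₀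
  have hpβ : p * (β + 1) = 1 := by rw [hβ]; field_simp; ring
  have hpβ₀ : p₀ * (β₀ + 1) = 1 := by rw [hβ₀]; field_simp; ring
  have hββ₀ : β < β₀ := sub_lt_sub_right (one_div_lt_one_div_of_lt h0 h) 1
  have hkβ : k ≤ β := by
    by_contra! hlt
    nlinarith
  have hβ0 : 0 < β := hk.trans_le hkβ
  have hle : β ^ (1 - p) ≤ β - 1 := by
    have hs : 1 ≤ β / k := (one_le_div hk).2 hkβ
    have e : β = β / k * k := (div_mul_cancel₀ _ hk.ne').symm
    calc β ^ (1 - p) = (β / k) ^ (1 - p) * α := by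
          conv_lhs => rw [e]
          rw [Real.mul_rpow (by positivity) hk.le, hkα]
      _ ≤ (β / k) ^ (1 : ℝ) * α := by
          gcongr
          linarith
      _ = (1 - p) * β - p * (β / k) := by
          rw [Real.rpow_one]
          linear_combination (-(β / k)) * hα' - (1 - p) * e
      _ ≤ β - 1 := by nlinarith
  have hβ1 : 1 < β := by linarith [Real.rpow_pos_of_pos hβ0 (1 - p)]
  have hβ₀1 : 1 < β₀ := hβ1.trans hββ₀
  have hF := strictMonoOn_mul_log_sub_one_sub_mul_log hβ1 hβ₀1 hββ₀
  have hF₀ : (β₀ + 1) * Real.log (β₀ - 1) - β₀ * Real.log β₀ = 0 := by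
    rw [show β₀ - 1 = β₀ ^ (1 - p₀) by linarith, Real.log_rpow (by linarith)]
    linear_combination -Real.log β₀ * hpβ₀
  have hlog := Real.log_le_log (Real.rpow_pos_of_pos hβ0 _) hle
  rw [Real.log_rpow hβ0] at hlog
  have hmul := mul_le_mul_of_nonneg_left hlog (by linarith : 0 ≤ β + 1)
  have e : (β + 1) * ((1 - p) * Real.log β) = β * Real.log β := by
    linear_combination -Real.log β * hpβ
  simp only at hF
  linarith

lemma exists_slope {p : ℝ} (hp : 0 < p) (hp1 : p < 1)
    {p₀ : ℝ} (hp₀ : p₀ ∈ Ioo (0 : ℝ) 1) (hp₀eq : 1 / p₀ - 1 = (1 / p₀ - 1) ^ (1 - p₀) + 1)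
    {C : ℝ} (hC₁ : p ≤ p₀ → C = (1 - p) / p)
    (hC₂ : p₀ < p → ∃ α : ℝ, 0 < α ∧ (1 - p) * (α ^ (1 / (1 - p)) + 1) = α + 1 ∧
      C = (1 + α⁻¹) ^ (1 / p)) {c : ℝ} (hc0 : 0 ≤ c) (hc : c < C) :
    ∃ k : ℝ, 0 < k ∧ 1 < p * (k + 1) ∧
      c ^ p * (p * (k + 1)) < p * (k + 1) + k ^ p - 1 := by
  have hcp : c ^ p < C ^ p := Real.rpow_lt_rpow hc0 hc hp
  rcases le_or_gt p p₀ with h | h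
  · rw [hC₁ h] at hcp
    set β := (1 - p) / p
    have hβ0 : 0 < β := div_pos (by linarith) hp
    have hpβ : p * (β + 1) = 1 := by
      linear_combination (mul_div_cancel₀ (1 - p) hp.ne' : p * ((1 - p) / p) = 1 - p)
    have hcont : ContinuousAt (fun k : ℝ ↦
        p * (k + 1) + k ^ p - 1 - c ^ p * (p * (k + 1))) β := by
      have := Real.continuousAt_rpow_const β p (.inl hβ0.ne')
      fun_prop
    have hev := hcont.eventually_const_lt (u := 0) (by simp only [hpβ]; linarith)
    obtain ⟨k, hk, hkβ⟩ :=
      ((hev.filter_mono nhdsWithin_le_nhds).and (self_mem_nhdsWithin (s := Ioi β))).exists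
    have hkβ' : β < k := hkβ
    exact ⟨k, hβ0.trans hkβ, by nlinarith, by linarith⟩
  · obtain ⟨α, hα, hα', hCα⟩ := hC₂ h
    have hp1' : 0 < 1 - p := by linarith
    set k := α ^ (1 / (1 - p))
    have hk : 0 < k := Real.rpow_pos_of_pos hα _
    have hkα : k ^ (1 - p) = α := by
      rw [← Real.rpow_mul hα.le, one_div_mul_cancel hp1'.ne', Real.rpow_one]
    have hk1 := one_lt_mul_add_one hp1 hp₀ hp₀eq h hα hk hkα hα'
    refine ⟨k, hk, hk1, ?_⟩
    rw [hCα, ← Real.rpow_mul (by positivity), one_div_mul_cancel hp.ne', Real.rpow_one] at hcp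
    have hkp : k ^ p * α = k := by
      rw [← hkα, ← Real.rpow_add hk, add_sub_cancel, Real.rpow_one]
    have e : (1 + α⁻¹) * (p * (k + 1)) = p * (k + 1) + k ^ p - 1 := by
      field_simp
      linear_combination (-1) * hα' - hkp
    rw [← e]
    exact mul_lt_mul_of_pos_right hcp (by linarith)

end AuxiliaryLemmas

/-- Sharpness of the constant `C_p` in `sup_t ‖X_t‖_p ≤ C_p · sup_t ‖M⁻_t‖_p`: for each
`0 < p < 1` and each `c < C_p` there is a continuous martingale starting from `0` with
`0 < sup_t ‖M⁻_t‖_p < ∞` and `sup_t ‖X_t‖_p > c · sup_t ‖M⁻_t‖_p`. -/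
theorem sharpness_Cp (p : ℝ) (hp : 0 < p) (hp1 : p < 1)
    (p₀ : ℝ) (hp₀ : p₀ ∈ Set.Ioo (0 : ℝ) 1)
    (hp₀eq : 1 / p₀ - 1 = (1 / p₀ - 1) ^ (1 - p₀) + 1)
    (C : ℝ)
    (hC₁ : p ≤ p₀ → C = (1 - p) / p)
    (hC₂ : p₀ < p → ∃ α : ℝ, 0 < α ∧ (1 - p) * (α ^ (1 / (1 - p)) + 1) = α + 1 ∧
      C = (1 + α⁻¹) ^ (1 / p))
    (c : ℝ) (hc : c < C) :
    ∃ (Ω : Type) (m0 : MeasurableSpace Ω) (P : Measure Ω),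
      IsProbabilityMeasure P ∧ P.IsComplete ∧
      ∃ (ℱ : Filtration ℝ≥0 m0) (X : ℝ≥0 → Ω → ℝ),
        Martingale X ℱ P ∧
        (∀ ω, Continuous fun t => X t ω) ∧
        (∀ᵐ ω ∂P, X 0 ω = 0) ∧
        (0 < ⨆ t : ℝ≥0,
          (∫ ω, (-(⨅ s : Set.Icc (0 : ℝ≥0) t, min (X s.1 ω) 0)) ^ p ∂P) ^ (1 / p)) ∧
        BddAbove (Set.range fun t : ℝ≥0 =>
          (∫ ω, (-(⨅ s : Set.Icc (0 : ℝ≥0) t, min (X s.1 ω) 0)) ^ p ∂P) ^ (1 / p)) ∧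
        (⨆ t : ℝ≥0, (∫ ω, |X t ω| ^ p ∂P) ^ (1 / p))
          > c * ⨆ t : ℝ≥0,
              (∫ ω, (-(⨅ s : Set.Icc (0 : ℝ≥0) t, min (X s.1 ω) 0)) ^ p ∂P) ^ (1 / p) := by
  have hC : 0 < C := by
    rcases le_or_gt p p₀ with h | h
    · rw [hC₁ h]
      exact div_pos (sub_pos.2 hp1) hp
    · obtain ⟨α, hα, -, hCα⟩ := hC₂ h
      rw [hCα]
      positivity
  obtain ⟨k, hk, hk1, hck⟩ :=
    exists_slope hp hp1 hp₀ hp₀eq hC₁ hC₂ (le_max_right c 0) (max_lt hc hC)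
  obtain ⟨n, y, h, π, hy0, hy, hh, hπ0, hπ, hlt⟩ := exists_stages hp hk hk1 hck
  obtain ⟨Ω, m0, P, hP, hPc, ℱ, X, hX, hXc, hX0, hpos, hbdd, hgt⟩ :=
    exists_martingale_of_stages hp hy0 hy hh hπ0 hπ (le_max_right c 0) hlt
  exact ⟨Ω, m0, P, hP, hPc, ℱ, X, hX, hXc, hX0, hpos, hbdd,
    (mul_le_mul_of_nonneg_right (le_max_left c 0) hpos.le).trans_lt hgt⟩
end

section
/- For every 0 < p < 1 and every c < c_p there exist a complete filtered probability space and a martingale X = (X_t)_{t≥0} with continuous sample paths and X_0 = 0 almost surely such that 0 < sup_{t≥0} (E[(−M⁻_t)^p])^{1/p} < ∞ and sup_{t≥0} (E[(M⁺_t)^p])^{1/p} > c · sup_{t≥0} (E[(−M⁻_t)^p])^{1/p}. Here c_p^p = (1/p − 1)^p + ∫_{1/p−1}^∞ s^{p−1}/(s+1) ds, M⁺_t(ω) = sup_{0≤s≤t} max(X_s(ω),0) and M⁻_t(ω) = inf_{0≤s≤t} min(X_s(ω),0). -/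
open MeasureTheory Filter Set
open scoped NNReal
open ProbabilityTheory
open scoped ENNReal Topology

section Isonormal

variable {Ω : Type*} {mΩ : MeasurableSpace Ω} {P : Measure Ω}

lemma integrable_cexp_ofReal_mul_I [IsFiniteMeasure P] {f : Ω → ℝ} (hf : AEStronglyMeasurable f P) :
    Integrable (fun ω ↦ Complex.exp (f ω * Complex.I)) P := by
  refine Integrable.of_bound (C := 1) ?_ (ae_of_all _ fun ω ↦ ?_)
  · have := Complex.continuous_ofReal.comp_aestronglyMeasurable hf
    exact Complex.continuous_exp.comp_aestronglyMeasurable (this.mul_const _)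
  · rw [Complex.norm_exp_ofReal_mul_I]

lemma norm_cexp_sub_cexp_le (a b : ℝ) :
    ‖Complex.exp (a * Complex.I) - Complex.exp (b * Complex.I)‖ ≤ |a - b| := by
  have h : Complex.exp (a * Complex.I) - Complex.exp (b * Complex.I)
      = Complex.exp (b * Complex.I) * (Complex.exp (Complex.I * (a - b : ℝ)) - 1) := by
    rw [mul_sub, ← Complex.exp_add, mul_one]
    congr 2
    push_cast
    ring
  rw [h, norm_mul, Complex.norm_exp_ofReal_mul_I, one_mul]
  exact Real.norm_exp_I_mul_ofReal_sub_one_le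

lemma continuous_integral_cexp_Lp [IsProbabilityMeasure P] :
    Continuous fun f : Lp ℝ 2 P ↦ ∫ ω, Complex.exp (f ω * Complex.I) ∂P := by
  refine (LipschitzWith.of_dist_le_mul (K := 1) fun f g ↦ ?_).continuous
  rw [dist_eq_norm, dist_eq_norm, NNReal.coe_one, one_mul,
    ← integral_sub (integrable_cexp_ofReal_mul_I (Lp.aestronglyMeasurable f))
      (integrable_cexp_ofReal_mul_I (Lp.aestronglyMeasurable g))]
  have hfg : AEStronglyMeasurable (⇑f - ⇑g) P :=
    (Lp.aestronglyMeasurable f).sub (Lp.aestronglyMeasurable g)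
  have hint : Integrable (⇑f - ⇑g) P :=
    ((Lp.memLp f).sub (Lp.memLp g)).integrable (by norm_num)
  calc _ ≤ ∫ ω, ‖(⇑f - ⇑g) ω‖ ∂P := by
        refine norm_integral_le_of_norm_le hint.norm (ae_of_all _ fun ω ↦ ?_)
        exact norm_cexp_sub_cexp_le _ _
    _ = (eLpNorm (⇑f - ⇑g) 1 P).toReal := by
        rw [integral_norm_eq_lintegral_enorm hfg, eLpNorm_one_eq_lintegral_enorm]
    _ ≤ (eLpNorm (⇑f - ⇑g) 2 P).toReal := by
        refine ENNReal.toReal_mono ((Lp.memLp f).sub (Lp.memLp g)).eLpNorm_ne_top ?_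
        exact eLpNorm_le_eLpNorm_of_exponent_le (by norm_num) hfg
    _ = ‖f - g‖ := by rw [Lp.norm_def, eLpNorm_congr_ae (Lp.coeFn_sub f g)]

lemma Lp_two_integral_sq (f : Lp ℝ 2 P) : ∫ ω, f ω ^ 2 ∂P = ‖f‖ ^ 2 := by
  rw [← real_inner_self_eq_norm_sq, L2.inner_def]
  refine integral_congr_ae (ae_of_all _ fun ω ↦ ?_)
  simp [pow_two]

lemma integral_cexp_of_hasGaussianLaw [IsProbabilityMeasure P] (f : Lp ℝ 2 P)
    (hf : HasGaussianLaw f P) (h0 : ∫ ω, f ω ∂P = 0) :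
    ∫ ω, Complex.exp (f ω * Complex.I) ∂P = Complex.exp (-‖f‖ ^ 2 / 2) := by
  have h := charFun_gaussianReal (μ := 0) (v := Var[f; P].toNNReal) 1
  have hm := hf.map_eq_gaussianReal
  rw [h0] at hm
  rw [← hm, charFun_apply_real, integral_map hf.aemeasurable
    (by exact Continuous.aestronglyMeasurable (by fun_prop))] at h
  have hv : Var[f; P] = ‖f‖ ^ 2 := by
    rw [variance_eq_integral hf.aemeasurable, h0, ← Lp_two_integral_sq]
    simp
  rw [hv, Real.coe_toNNReal _ (sq_nonneg _)] at h
  simp only [Complex.ofReal_one, one_mul] at h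
  rw [h]
  congr 1
  push_cast
  ring

/-- An isonormal Gaussian process over a real Hilbert space. -/
theorem exists_isonormal (H : Type) [NormedAddCommGroup H] [InnerProductSpace ℝ H]
    [CompleteSpace H] :
    ∃ (Ω : Type) (mΩ : MeasurableSpace Ω) (P : Measure Ω) (_ : IsProbabilityMeasure P)
      (W : H →ₗᵢ[ℝ] Lp ℝ 2 P), ∀ h, HasLaw (W h) (gaussianReal 0 (‖h‖₊ ^ 2)) P := by
  obtain ⟨w, b, -⟩ := exists_hilbertBasis ℝ H
  obtain ⟨Ω, mΩ, P, ξ, hξm, hξ, hind, hP⟩ := exists_iid w (gaussianReal 0 1)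
  have hgauss i : HasGaussianLaw (ξ i) P := (hξ i).hasGaussianLaw
  have hmem i : MemLp (ξ i) 2 P := (hgauss i).memLp_two
  have hmean i : ∫ ω, ξ i ω ∂P = 0 := by
    rw [(hξ i).integral_eq, integral_id_gaussianReal]
  have hvar i : Var[ξ i; P] = 1 := by
    rw [(hξ i).variance_eq, variance_id_gaussianReal]
    simp
  let η i : Lp ℝ 2 P := (hmem i).toLp
  have hη i : η i =ᵐ[P] ξ i := MemLp.coeFn_toLp _
  have hinner i j : inner ℝ (η i) (η j) = ∫ ω, ξ i ω * ξ j ω ∂P := by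
    rw [L2.inner_def]
    refine integral_congr_ae ?_
    filter_upwards [hη i, hη j] with ω h1 h2
    simp [h1, h2, mul_comm]
  have hon : Orthonormal ℝ η := by
    refine ⟨fun i ↦ ?_, fun i j hij ↦ ?_⟩
    · have : ‖η i‖ ^ 2 = 1 := by
        rw [← real_inner_self_eq_norm_sq, hinner, ← hvar i,
          variance_eq_integral (hgauss i).aemeasurable, hmean]
        simp [pow_two]
      nlinarith [norm_nonneg (η i)]
    · change inner ℝ (η i) (η j) = 0
      rw [hinner, (hind.indepFun hij).integral_fun_mul_eq_mul_integral
        (hξm i).aestronglyMeasurable (hξm j).aestronglyMeasurable, hmean, zero_mul]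
  let W : H →ₗᵢ[ℝ] Lp ℝ 2 P :=
    hon.orthogonalFamily.linearIsometry.comp b.repr.toLinearIsometry
  have hsum h : HasSum (fun i ↦ b.repr h i • η i) (W h) := by
    have := hon.orthogonalFamily.hasSum_linearIsometry (b.repr h)
    simpa using! this
  have hfin (s : Finset w) (c : w → ℝ) :
      ∫ ω, Complex.exp ((∑ i ∈ s, c i • η i : Lp ℝ 2 P) ω * Complex.I) ∂P
        = Complex.exp (-‖∑ i ∈ s, c i • η i‖ ^ 2 / 2) := by
    have hae : (∑ i : s, fun ω ↦ c i * ξ i ω) =ᵐ[P] (∑ i ∈ s, c i • η i : Lp ℝ 2 P) := by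
      have h1 : ⇑(∑ i ∈ s, c i • η i : Lp ℝ 2 P) =ᵐ[P] fun ω ↦ ∑ i ∈ s, (c i • η i : Lp ℝ 2 P) ω := by
        classical
        induction s using Finset.induction_on with
        | empty => simpa using! Lp.coeFn_zero ℝ 2 P
        | insert a s ha ih =>
          rw [Finset.sum_insert ha]
          filter_upwards [Lp.coeFn_add (c a • η a) (∑ i ∈ s, c i • η i), ih] with ω h1 h2
          rw [h1, Pi.add_apply, h2, Finset.sum_insert ha]
      have h2 : ∀ᵐ ω ∂P, ∀ i : s, (c i • η i : Lp ℝ 2 P) ω = c i * ξ i ω := by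
        rw [ae_all_iff]
        intro i
        filter_upwards [Lp.coeFn_smul (c i) (η i), hη i] with ω h1 h2
        simp [h1, h2]
      filter_upwards [h1, h2] with ω h1 h2
      rw [h1, Finset.sum_apply, ← Finset.sum_coe_sort s (fun i ↦ (c i • η i : Lp ℝ 2 P) ω)]
      exact (Finset.sum_congr rfl fun i _ ↦ h2 i).symm
    refine integral_cexp_of_hasGaussianLaw _ ?_ ?_
    · refine HasGaussianLaw.congr (iIndepFun.hasGaussianLaw_sum (fun i ↦ ?_) ?_) hae
      · exact (hgauss i).map (c i • ContinuousLinearMap.id ℝ ℝ)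
      · have h1 : iIndepFun (fun i : s ↦ ξ i) P := hind.precomp Subtype.val_injective
        exact h1.comp (fun i x ↦ c i * x) fun i ↦ by fun_prop
    · rw [← integral_congr_ae hae]
      simp only [Finset.sum_apply]
      rw [integral_finsetSum _ fun (i : s) _ ↦
        ((hmem i.1).integrable (by norm_num)).const_mul (c i.1)]
      simp [integral_const_mul, hmean]
  have hW h : ∫ ω, Complex.exp (W h ω * Complex.I) ∂P = Complex.exp (-‖h‖ ^ 2 / 2) := by
    rw [← W.norm_map h]
    have hcl : IsClosed {f : Lp ℝ 2 P | ∫ ω, Complex.exp (f ω * Complex.I) ∂P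
        = Complex.exp (-‖f‖ ^ 2 / 2)} :=
      isClosed_eq continuous_integral_cexp_Lp (by fun_prop)
    exact hcl.mem_of_tendsto (hsum h) (Eventually.of_forall fun s ↦ hfin s _)
  refine ⟨Ω, mΩ, P, hP, W, fun h ↦ ⟨(Lp.aestronglyMeasurable _).aemeasurable, ?_⟩⟩
  have hm := (Lp.aestronglyMeasurable (W h)).aemeasurable
  have : IsProbabilityMeasure (P.map (W h)) := Measure.isProbabilityMeasure_map hm
  refine Measure.ext_of_charFun ?_
  ext t
  rw [charFun_gaussianReal, charFun_apply_real, integral_map hm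
    (by exact Continuous.aestronglyMeasurable (by fun_prop))]
  have h1 : ∫ ω, Complex.exp (t * W h ω * Complex.I) ∂P
      = ∫ ω, Complex.exp (W (t • h) ω * Complex.I) ∂P := by
    refine integral_congr_ae ?_
    rw [map_smul]
    filter_upwards [Lp.coeFn_smul t (W h)] with ω h1
    simp [h1]
  rw [h1, hW, norm_smul]
  congr 1
  rw [Real.norm_eq_abs]
  push_cast
  rw [mul_pow, ← Complex.ofReal_pow |t|, sq_abs]
  push_cast
  simp
  ring

end Isonormal

/-- There exists a pre-Brownian motion. -/
theorem exists_isPreBrownianReal :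
    ∃ (Ω : Type) (mΩ : MeasurableSpace Ω) (P : Measure Ω) (_ : IsProbabilityMeasure P)
      (X : ℝ≥0 → Ω → ℝ), (∀ t, Measurable (X t)) ∧ IsPreBrownianReal X P := by
  obtain ⟨Ω, mΩ, P, hP, W, hW⟩ := exists_isonormal (Lp ℝ 2 (volume : Measure ℝ))
  let e (t : ℝ≥0) : Lp ℝ 2 (volume : Measure ℝ) :=
    indicatorConstLp 2 (measurableSet_Icc (a := (0 : ℝ)) (b := t)) (by simp) 1
  have he s t : inner ℝ (e s) (e t) = ((min s t : ℝ≥0) : ℝ) := by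
    rw [L2.inner_indicatorConstLp_indicatorConstLp measurableSet_Icc measurableSet_Icc
      measure_Icc_lt_top.ne measure_Icc_lt_top.ne, Icc_inter_Icc]
    simp
  refine ⟨Ω, mΩ, P, hP, fun t ↦ W (e t), fun t ↦ (Lp.stronglyMeasurable _).measurable, ?_⟩
  have hg h : HasGaussianLaw (W h) P := (hW h).hasGaussianLaw
  have hmean h : ∫ ω, W h ω ∂P = 0 := by rw [(hW h).integral_eq, integral_id_gaussianReal]
  refine IsGaussianProcess.isPreBrownianReal_of_covariance ⟨fun I ↦ ⟨?_⟩⟩ (fun t ↦ hmean _)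
    fun s t hst ↦ ?_
  · have hm : AEMeasurable (fun ω ↦ I.restrict (fun t ↦ W (e t) ω)) P :=
      aemeasurable_pi_lambda _ fun i ↦ (Lp.aestronglyMeasurable _).aemeasurable
    refine isGaussian_of_isGaussian_map fun L ↦ ?_
    rw [AEMeasurable.map_map_of_aemeasurable (by fun_prop) hm]
    have hL : (L ∘ fun ω ↦ I.restrict (fun t ↦ W (e t) ω))
        =ᵐ[P] W (∑ i : I, L (Pi.single i 1) • e i) := by
      have h1 : ∀ s : Finset I, ⇑(W (∑ i ∈ s, L (Pi.single i 1) • e i))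
          =ᵐ[P] fun ω ↦ ∑ i ∈ s, L (Pi.single i 1) * W (e i) ω := by
        intro s
        induction s using Finset.induction_on with
        | empty => simpa using! Lp.coeFn_zero ℝ 2 P
        | insert a s ha ih =>
          rw [Finset.sum_insert ha, map_add, map_smul]
          filter_upwards [Lp.coeFn_add (L (Pi.single a 1) • W (e a)) (W (∑ i ∈ s, L (Pi.single i 1) • e i)), ih,
            Lp.coeFn_smul (L (Pi.single a 1)) (W (e a))] with ω h1 h2 h3
          rw [h1, Pi.add_apply, h2, h3, Finset.sum_insert ha]
          simp
      filter_upwards [h1 Finset.univ] with ω h1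
      rw [h1, Function.comp_apply]
      conv_lhs => rw [← Finset.univ_sum_single (I.restrict (fun t ↦ W (e t) ω))]
      rw [map_sum]
      refine Finset.sum_congr rfl fun i _ ↦ ?_
      have : (Pi.single i (I.restrict (fun t ↦ W (e t) ω) i) : I → ℝ)
          = (W (e i) ω) • Pi.single i (1 : ℝ) := by
        ext j
        simp [Pi.single_apply]
      rw [this, map_smul, smul_eq_mul, mul_comm]
    rw [Measure.map_congr hL]
    exact (hg _).isGaussian_map
  · rw [covariance_eq_sub (hg _).memLp_two (hg _).memLp_two, hmean, zero_mul, sub_zero]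
    have := W.inner_map_map (e s) (e t)
    rw [he, min_eq_left hst, L2.inner_def] at this
    rw [← this]
    refine integral_congr_ae (ae_of_all _ fun ω ↦ ?_)
    exact mul_comm (W (e s) ω) (W (e t) ω)

/-- Approximation of a path by its values at the dyadic points of level `n`. -/
noncomputable def dyadicStep (x : ℝ≥0 → ℝ) (n : ℕ) (t : ℝ≥0) : ℝ :=
  x ((⌊2 ^ n * t⌋₊ : ℝ≥0) / 2 ^ n)

lemma abs_dyadicStep_succ_sub_le {x : ℝ≥0 → ℝ} {N n : ℕ} {δ : ℝ} (hδ : 0 ≤ δ)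
    (hx : ∀ k < N * 2 ^ (n + 1), |x ((k + 1 : ℕ) / 2 ^ (n + 1)) - x (k / 2 ^ (n + 1))| ≤ δ)
    {t : ℝ≥0} (ht : t < N) :
    |dyadicStep x (n + 1) t - dyadicStep x n t| ≤ δ := by
  unfold dyadicStep
  set k := ⌊2 ^ n * t⌋₊ with hk
  have h1 : (k : ℝ≥0) ≤ 2 ^ n * t := Nat.floor_le zero_le
  have h2 : 2 ^ n * t < k + 1 := Nat.lt_floor_add_one _
  have hkN : k < N * 2 ^ n := by
    have : (k : ℝ≥0) < (N * 2 ^ n : ℕ) := by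
      push_cast
      refine h1.trans_lt ?_
      rw [mul_comm]
      gcongr
    exact_mod_cast this
  have h3 : (2 : ℝ≥0) ^ (n + 1) * t = 2 * (2 ^ n * t) := by ring
  have h4 : 2 * k ≤ ⌊2 ^ (n + 1) * t⌋₊ := by
    rw [Nat.le_floor_iff zero_le, h3]
    push_cast
    gcongr
  have h5 : ⌊2 ^ (n + 1) * t⌋₊ < 2 * k + 2 := by
    rw [Nat.floor_lt zero_le, h3]
    push_cast
    calc 2 * (2 ^ n * t) < 2 * (k + 1 : ℝ≥0) := by gcongr
      _ = _ := by ring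
  have h6 : (k : ℝ≥0) / 2 ^ n = (2 * k : ℕ) / 2 ^ (n + 1) := by
    push_cast
    rw [pow_succ']
    field_simp
  rw [h6]
  obtain h | h : ⌊2 ^ (n + 1) * t⌋₊ = 2 * k ∨ ⌊2 ^ (n + 1) * t⌋₊ = 2 * k + 1 := by omega
  · rw [h]; simpa
  · rw [h]
    exact hx _ (by rw [pow_succ]; lia)

lemma abs_dyadicStep_sub_le {x : ℝ≥0 → ℝ} {N n : ℕ} {δ : ℝ} (hδ : 0 ≤ δ)
    (hx : ∀ k < N * 2 ^ n, |x ((k + 1 : ℕ) / 2 ^ n) - x (k / 2 ^ n)| ≤ δ)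
    {s t : ℝ≥0} (hst : s ≤ t) (ht : t < N) (hd : t < s + (2 ^ n)⁻¹) :
    |dyadicStep x n t - dyadicStep x n s| ≤ δ := by
  unfold dyadicStep
  set k := ⌊2 ^ n * s⌋₊ with hk
  have h1 : (k : ℝ≥0) ≤ 2 ^ n * s := Nat.floor_le zero_le
  have h2 : 2 ^ n * s < k + 1 := Nat.lt_floor_add_one _
  have hkN : k < N * 2 ^ n := by
    have : (k : ℝ≥0) < (N * 2 ^ n : ℕ) := by
      push_cast
      refine h1.trans_lt ?_
      rw [mul_comm]
      gcongr
      exact hst.trans_lt ht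
    exact_mod_cast this
  have h4 : k ≤ ⌊2 ^ n * t⌋₊ := Nat.floor_mono (by gcongr)
  have h5 : ⌊2 ^ n * t⌋₊ < k + 2 := by
    rw [Nat.floor_lt zero_le]
    push_cast
    calc 2 ^ n * t < 2 ^ n * (s + (2 ^ n)⁻¹) := by gcongr
      _ = 2 ^ n * s + 1 := by rw [mul_add, mul_inv_cancel₀ (by positivity)]
      _ < k + 1 + 1 := by gcongr
      _ = _ := by ring
  obtain h | h : ⌊2 ^ n * t⌋₊ = k ∨ ⌊2 ^ n * t⌋₊ = k + 1 := by omega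
  · rw [h]; simpa
  · rw [h]
    exact hx _ hkN

lemma exists_continuousOn_tendsto_dyadicStep {x : ℝ≥0 → ℝ} {N : ℕ} {d : ℕ → ℝ} (hd : Summable d)
    (hd0 : ∀ n, 0 ≤ d n)
    (hx : ∀ n, ∀ k < N * 2 ^ n, |x ((k + 1 : ℕ) / 2 ^ n) - x (k / 2 ^ n)| ≤ d n) :
    ∃ f : ℝ≥0 → ℝ, ContinuousOn f (Iio (N : ℝ≥0)) ∧
      ∀ t < (N : ℝ≥0), Tendsto (fun n ↦ dyadicStep x n t) atTop (𝓝 (f t)) := by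
  have hd' : Summable fun n ↦ d (n + 1) := (summable_nat_add_iff 1).2 hd
  have hdist t (ht : t < (N : ℝ≥0)) n :
      dist (dyadicStep x n t) (dyadicStep x (n + 1) t) ≤ d (n + 1) := by
    rw [dist_comm, Real.dist_eq]
    exact abs_dyadicStep_succ_sub_le (hd0 _) (hx (n + 1)) ht
  have hlim t (ht : t < (N : ℝ≥0)) : ∃ y, Tendsto (fun n ↦ dyadicStep x n t) atTop (𝓝 y) :=
    cauchySeq_tendsto_of_complete (cauchySeq_of_dist_le_of_summable _ (hdist t ht) hd')
  choose! f hf using hlim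
  refine ⟨f, ?_, hf⟩
  let r n := ∑' m, d (n + m + 1)
  have hr t (ht : t < (N : ℝ≥0)) n : |dyadicStep x n t - f t| ≤ r n :=
    dist_le_tsum_of_dist_le_of_tendsto _ (hdist t ht) hd' (hf t ht) n
  have hr0 : Tendsto r atTop (𝓝 0) := by
    have := tendsto_sum_nat_add fun n ↦ d (n + 1)
    refine this.congr fun n ↦ ?_
    exact tsum_congr fun m ↦ by congr 1; omega
  have htot : Tendsto (fun n ↦ 2 * r n + d n) atTop (𝓝 0) := by
    simpa using (hr0.const_mul 2).add hd.tendsto_atTop_zero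
  intro t ht
  rw [mem_Iio] at ht
  rw [Metric.continuousWithinAt_iff]
  intro ε hε
  obtain ⟨n, hn⟩ := (htot.eventually_lt_const hε).exists
  have key {s u : ℝ≥0} (hsu : s ≤ u) (hu : u < N) (hd : u < s + (2 ^ n)⁻¹) : |f u - f s| < ε := by
    have h1 := abs_le.1 (hr s (hsu.trans_lt hu) n)
    have h2 := abs_le.1 (hr u hu n)
    have h3 := abs_le.1 (abs_dyadicStep_sub_le (hd0 n) (hx n) hsu hu hd)
    rw [abs_lt]
    constructor <;> linarith [h1.1, h1.2, h2.1, h2.2, h3.1, h3.2]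
  refine ⟨(2 ^ n)⁻¹, by positivity, fun s hs hst ↦ ?_⟩
  rw [NNReal.dist_eq, abs_lt] at hst
  rw [Real.dist_eq]
  rcases le_total s t with h | h
  · rw [abs_sub_comm]
    refine key h ht ?_
    rw [← NNReal.coe_lt_coe]; push_cast; linarith [hst.1]
  · refine key h hs ?_
    rw [← NNReal.coe_lt_coe]; push_cast; linarith [hst.2]

lemma ae_summable_of_summable_integral {Ω : Type*} {mΩ : MeasurableSpace Ω} {P : Measure Ω}
    {f : ℕ → Ω → ℝ} (hf : ∀ n ω, 0 ≤ f n ω) (hi : ∀ n, Integrable (f n) P)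
    (hs : Summable fun n ↦ ∫ ω, f n ω ∂P) : ∀ᵐ ω ∂P, Summable fun n ↦ f n ω := by
  have h1 : ∫⁻ ω, ∑' n, ENNReal.ofReal (f n ω) ∂P ≠ ∞ := by
    rw [lintegral_tsum fun n ↦ (hi n).aemeasurable.ennreal_ofReal]
    simp_rw [← ofReal_integral_eq_lintegral_ofReal (hi _) (ae_of_all _ (hf _))]
    exact hs.tsum_ofReal_ne_top
  have h2 := ae_lt_top' (AEMeasurable.tsum
    fun n ↦ (hi n).aemeasurable.ennreal_ofReal) h1
  filter_upwards [h2] with ω hω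
  have := ENNReal.summable_toReal hω.ne
  exact this.congr fun n ↦ ENNReal.toReal_ofReal (hf n ω)

lemma integral_pow_four_gaussianReal (v : ℝ≥0) :
    ∫ x, x ^ 4 ∂gaussianReal 0 v = (∫ x, x ^ 4 ∂gaussianReal 0 1) * v ^ 2 := by
  have h := gaussianReal_map_const_mul (μ := 0) (v := 1) (NNReal.sqrt v : ℝ)
  have h2 : NNReal.mk ((NNReal.sqrt v : ℝ) ^ 2) (sq_nonneg _) * 1 = v := by
    ext
    simp
  rw [mul_zero, h2] at h
  rw [← h, integral_map (by fun_prop) (by fun_prop), ← integral_mul_const]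
  refine integral_congr_ae (ae_of_all _ fun x ↦ ?_)
  have h3 : (NNReal.sqrt v : ℝ) ^ 2 = v := by
    simp
  dsimp only
  rw [← h3]
  ring

section Continuity

variable {Ω : Type*} {mΩ : MeasurableSpace Ω} {P : Measure Ω} {X : ℝ≥0 → Ω → ℝ}

lemma integral_sub_pow_four (h : IsPreBrownianReal X P) (s t : ℝ≥0) :
    Integrable (fun ω ↦ (X s ω - X t ω) ^ 4) P ∧
      ∫ ω, (X s ω - X t ω) ^ 4 ∂P = (∫ x, x ^ 4 ∂gaussianReal 0 1) * ((s : ℝ) - t) ^ 2 := by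
  have hl := h.hasLaw_sub s t
  have hi : Integrable (fun x : ℝ ↦ x ^ 4) (gaussianReal 0 (nndist s.1 t.1)) := by
    have := (memLp_id_gaussianReal (μ := 0) (v := nndist s.1 t.1) 4).integrable_norm_pow (p := 4)
      (by norm_num)
    refine this.congr (ae_of_all _ fun x ↦ ?_)
    simp [Even.pow_abs (by decide : Even 4)]
  constructor
  · have := hl.map_eq ▸ hi
    exact this.comp_aemeasurable hl.aemeasurable
  · have := hl.integral_comp (f := fun x ↦ x ^ 4) (by fun_prop)
    rw [integral_pow_four_gaussianReal] at this
    rw [coe_nndist, Real.dist_eq, sq_abs] at this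
    exact this

lemma integral_sub_sq (h : IsPreBrownianReal X P) (s t : ℝ≥0) :
    Integrable (fun ω ↦ (X s ω - X t ω) ^ 2) P ∧
      ∫ ω, (X s ω - X t ω) ^ 2 ∂P = |(s : ℝ) - t| := by
  have hl := h.hasLaw_sub s t
  have hi := (memLp_id_gaussianReal (μ := 0) (v := nndist s.1 t.1) 2).integrable_sq
  constructor
  · have := hl.map_eq ▸ hi
    exact this.comp_aemeasurable hl.aemeasurable
  · have := hl.integral_comp (f := fun x ↦ x ^ 2) (by fun_prop)
    have h2 := variance_eq_integral (X := id) (μ := gaussianReal 0 (nndist s.1 t.1)) (by fun_prop)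
    simp only [variance_id_gaussianReal, integral_id_gaussianReal, id, sub_zero] at h2
    rw [← h2, coe_nndist, Real.dist_eq] at this
    exact this

lemma le_add_pow_four_div {a ε : ℝ} (ha : 0 ≤ a) (hε : 0 < ε) : a ≤ ε + a ^ 4 / ε ^ 3 := by
  rcases le_total a ε with h | h
  · have : 0 ≤ a ^ 4 / ε ^ 3 := by positivity
    linarith
  · have : a ≤ a ^ 4 / ε ^ 3 := by
      rw [le_div_iff₀ (by positivity)]
      calc a * ε ^ 3 ≤ a * a ^ 3 := by gcongr
        _ = a ^ 4 := by ring
    linarith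

lemma ae_tendsto_dyadicStep (h : IsPreBrownianReal X P) (t : ℝ≥0) :
    ∀ᵐ ω ∂P, Tendsto (fun n ↦ dyadicStep (X · ω) n t) atTop (𝓝 (X t ω)) := by
  let u n : ℝ≥0 := (⌊2 ^ n * t⌋₊ : ℝ≥0) / 2 ^ n
  have hu n : |(u n : ℝ) - t| ≤ (1 / 2) ^ n := by
    have h1 : ((⌊2 ^ n * t⌋₊ : ℝ≥0) : ℝ) ≤ 2 ^ n * t := by
      exact_mod_cast Nat.floor_le (zero_le : 0 ≤ 2 ^ n * t)
    have h2 : 2 ^ n * (t : ℝ) < ((⌊2 ^ n * t⌋₊ : ℝ≥0) : ℝ) + 1 := by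
      exact_mod_cast Nat.lt_floor_add_one (2 ^ n * t)
    have h3 : (u n : ℝ) = ((⌊2 ^ n * t⌋₊ : ℝ≥0) : ℝ) / 2 ^ n := by simp [u]
    have hpos : (0 : ℝ) < 2 ^ n := by positivity
    rw [h3, abs_le, div_pow, one_pow]
    constructor
    · have : t - 1 / 2 ^ n ≤ ((⌊2 ^ n * t⌋₊ : ℝ≥0) : ℝ) / 2 ^ n := by
        rw [le_div_iff₀ hpos, sub_mul, div_mul_cancel₀ _ hpos.ne']
        linarith
      linarith
    · have : ((⌊2 ^ n * t⌋₊ : ℝ≥0) : ℝ) / 2 ^ n ≤ t := by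
        rw [div_le_iff₀ hpos]
        linarith
      have : (0 : ℝ) < 1 / 2 ^ n := by positivity
      linarith
  have hs : Summable fun n ↦ ∫ ω, (X (u n) ω - X t ω) ^ 2 ∂P := by
    refine Summable.of_nonneg_of_le (fun n ↦ integral_nonneg fun ω ↦ sq_nonneg _) (fun n ↦ ?_)
      summable_geometric_two
    rw [(integral_sub_sq h _ _).2]
    exact hu n
  filter_upwards [ae_summable_of_summable_integral (fun n ω ↦ sq_nonneg _)
    (fun n ↦ (integral_sub_sq h (u n) t).1) hs] with ω hω
  have h1 := hω.tendsto_atTop_zero.sqrt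
  simp only [Real.sqrt_sq_eq_abs, Real.sqrt_zero] at h1
  exact tendsto_iff_dist_tendsto_zero.2 h1

lemma ae_exists_continuousOn_dyadicStep (h : IsPreBrownianReal X P) (N : ℕ) :
    ∀ᵐ ω ∂P, ∃ f : ℝ≥0 → ℝ, ContinuousOn f (Iio (N : ℝ≥0)) ∧
      ∀ t < (N : ℝ≥0), Tendsto (fun n ↦ dyadicStep (X · ω) n t) atTop (𝓝 (f t)) := by
  let R n ω := ∑ k ∈ Finset.range (N * 2 ^ n),
    (X ((k + 1 : ℕ) / 2 ^ n) ω - X (k / 2 ^ n) ω) ^ 4 / ((9 / 10 : ℝ) ^ n) ^ 3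
  have hR0 n ω : 0 ≤ R n ω := Finset.sum_nonneg fun k _ ↦ by positivity
  have hRi n : Integrable (R n) P :=
    integrable_finsetSum _ fun k _ ↦ (integral_sub_pow_four h _ _).1.div_const _
  have hR n : ∫ ω, R n ω ∂P = (N * ∫ x, x ^ 4 ∂gaussianReal 0 1) * (500 / 729) ^ n := by
    have h1 : (500 / 729 : ℝ) ^ n = 2 ^ n * ((1 / 2 ^ n) ^ 2 / ((9 / 10 : ℝ) ^ n) ^ 3) := by
      rw [← pow_mul, ← one_div_pow, pow_right_comm, mul_comm n 3, pow_mul, ← div_pow, ← mul_pow]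
      norm_num
    rw [integral_finsetSum _ fun k _ ↦ (integral_sub_pow_four h _ _).1.div_const _]
    have h2 k : ∫ ω, (X ((k + 1 : ℕ) / 2 ^ n) ω - X (k / 2 ^ n) ω) ^ 4 / ((9 / 10 : ℝ) ^ n) ^ 3 ∂P
        = (∫ x, x ^ 4 ∂gaussianReal 0 1) * (1 / 2 ^ n) ^ 2 / ((9 / 10 : ℝ) ^ n) ^ 3 := by
      rw [integral_div, (integral_sub_pow_four h _ _).2]
      congr 3
      push_cast
      ring
    simp only [h2, Finset.sum_const, Finset.card_range, nsmul_eq_mul, h1]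
    push_cast
    ring
  have hs : Summable fun n ↦ ∫ ω, R n ω ∂P := by
    simp only [hR]
    exact (summable_geometric_of_lt_one (by norm_num) (by norm_num)).mul_left _
  filter_upwards [ae_summable_of_summable_integral hR0 hRi hs] with ω hω
  refine exists_continuousOn_tendsto_dyadicStep (d := fun n ↦ (9 / 10) ^ n + R n ω)
    ((summable_geometric_of_lt_one (by norm_num) (by norm_num)).add hω)
    (fun n ↦ add_nonneg (by positivity) (hR0 n ω)) fun n k hk ↦ ?_
  refine (le_add_pow_four_div (abs_nonneg _) (ε := (9 / 10) ^ n) (by positivity)).trans ?_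
  gcongr
  rw [Even.pow_abs (by decide)]
  exact Finset.single_le_sum (f := fun k : ℕ ↦
    (X ((k + 1 : ℕ) / 2 ^ n) ω - X (k / 2 ^ n) ω) ^ 4 / ((9 / 10 : ℝ) ^ n) ^ 3)
    (fun k _ ↦ by positivity) (Finset.mem_range.2 hk)

end Continuity

/-- Existence of Brownian motion on some probability space. -/
theorem exists_isBrownianReal :
    ∃ (Ω : Type) (mΩ : MeasurableSpace Ω) (P : Measure Ω) (_ : IsProbabilityMeasure P)
      (B : ℝ≥0 → Ω → ℝ), (∀ t, Measurable (B t)) ∧ IsBrownianReal B P := by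
  obtain ⟨Ω, mΩ, P, hP, X, hXm, hX⟩ := exists_isPreBrownianReal
  let Y (t : ℝ≥0) (ω : Ω) : ℝ := limUnder atTop fun n ↦ dyadicStep (X · ω) n t
  have hY t : Measurable (Y t) := (StronglyMeasurable.limUnder fun n ↦ (hXm _).stronglyMeasurable).measurable
  have hXY t : X t =ᵐ[P] Y t := by
    filter_upwards [ae_tendsto_dyadicStep hX t] with ω hω
    exact hω.limUnder_eq.symm
  refine ⟨Ω, mΩ, P, hP, Y, hY, ⟨hX.congr hXY, ?_⟩⟩
  filter_upwards [ae_all_iff.2 (ae_exists_continuousOn_dyadicStep hX)] with ω hω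
  rw [continuous_iff_continuousAt]
  intro t
  obtain ⟨N, hN⟩ := exists_nat_gt t
  obtain ⟨f, hf, hlim⟩ := hω N
  have h1 : ContinuousAt f t := hf.continuousAt (Iio_mem_nhds hN)
  refine h1.congr ?_
  filter_upwards [Iio_mem_nhds hN] with s hs
  exact (hlim s hs).limUnder_eq.symm

section GaussTail

/-- Probability that a centered Gaussian variable of variance `v`, shifted by `y`, is positive. -/
noncomputable def gaussPos (y : ℝ) (v : ℝ≥0) : ℝ := (gaussianReal 0 v).real {x | 0 < y + x}

lemma gaussPos_nonneg (y : ℝ) (v : ℝ≥0) : 0 ≤ gaussPos y v := measureReal_nonneg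

lemma gaussPos_le_one (y : ℝ) (v : ℝ≥0) : gaussPos y v ≤ 1 := measureReal_le_one

lemma gaussPos_zero (y : ℝ) : gaussPos y 0 = if 0 < y then 1 else 0 := by
  have hm : MeasurableSet {x : ℝ | 0 < y + x} := measurableSet_lt (by fun_prop) (by fun_prop)
  rw [gaussPos, gaussianReal_zero_var, measureReal_def, Measure.dirac_apply' _ hm]
  by_cases h : 0 < y <;> simp [h]

lemma gaussPos_eq_integral (y : ℝ) (v : ℝ≥0) :
    gaussPos y v =
      ∫ x, {x | 0 < y + NNReal.sqrt v * x}.indicator (fun _ ↦ (1 : ℝ)) x ∂gaussianReal 0 1 := by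
  have h := gaussianReal_map_const_mul (μ := 0) (v := 1) (NNReal.sqrt v : ℝ)
  have h2 : NNReal.mk ((NNReal.sqrt v : ℝ) ^ 2) (sq_nonneg _) * 1 = v := by
    ext
    simp
  rw [mul_zero, h2] at h
  have hm : MeasurableSet {x : ℝ | 0 < y + x} := measurableSet_lt (by fun_prop) (by fun_prop)
  have hm' : MeasurableSet {x : ℝ | 0 < y + NNReal.sqrt v * x} :=
    measurableSet_lt (by fun_prop) (by fun_prop)
  rw [integral_indicator_const _ hm', gaussPos, ← h, map_measureReal_apply (by fun_prop) hm]
  simp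

lemma continuousAt_gaussPos {a : ℝ × ℝ≥0} (ha : a ≠ 0) :
    ContinuousAt (fun b : ℝ × ℝ≥0 ↦ gaussPos b.1 b.2) a := by
  simp only [gaussPos_eq_integral]
  refine tendsto_integral_filter_of_dominated_convergence (fun _ ↦ 1) ?_ ?_
    (integrable_const _) ?_
  · refine Eventually.of_forall fun b ↦ Measurable.aestronglyMeasurable ?_
    exact measurable_const.indicator (measurableSet_lt (by fun_prop) (by fun_prop))
  · refine Eventually.of_forall fun b ↦ ae_of_all _ fun x ↦ ?_
    exact (norm_indicator_le_norm_self _ _).trans (by simp)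
  · have h1 : ∀ᵐ x ∂gaussianReal 0 1, a.1 + NNReal.sqrt a.2 * x ≠ 0 := by
      by_cases h : a.2 = 0
      · have h0 : a.1 ≠ 0 := fun h' ↦ ha (Prod.ext h' h)
        exact ae_of_all _ fun x ↦ by simpa [h] using h0
      · have h0 : (NNReal.sqrt a.2 : ℝ) ≠ 0 := by simpa using h
        have := nullSingletonClass_gaussianReal (μ := 0) one_ne_zero
        filter_upwards [Measure.ae_ne (gaussianReal 0 1) (-a.1 / NNReal.sqrt a.2)] with x hx h
        refine hx ?_
        rw [eq_div_iff h0]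
        linarith
    filter_upwards [h1] with x hx
    have hc : ContinuousAt (fun b : ℝ × ℝ≥0 ↦ b.1 + NNReal.sqrt b.2 * x) a := by fun_prop
    rcases hx.lt_or_gt with h | h
    · refine tendsto_const_nhds.congr' ?_
      filter_upwards [hc.eventually_lt_const h] with b hb
      simp only [indicator, mem_ofPred_eq, h.not_gt, hb.not_gt]
    · refine tendsto_const_nhds.congr' ?_
      filter_upwards [hc.eventually_const_lt h] with b hb
      simp only [indicator, mem_ofPred_eq, h, hb]

lemma exists_gaussPos_eq {θ : ℝ} (h0 : 0 < θ) (h1 : θ < 1) : ∃ q, gaussPos (-q) 1 = θ := by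
  have hc : Continuous fun q : ℝ ↦ gaussPos (-q) 1 := by
    rw [continuous_iff_continuousAt]
    intro q
    exact (continuousAt_gaussPos (a := (-q, 1)) (by simp)).comp
      (f := fun q : ℝ ↦ (-q, (1 : ℝ≥0))) (by fun_prop)
  have hcdf q : gaussPos (-q) 1 = 1 - cdf (gaussianReal 0 1) q := by
    rw [cdf_eq_real, gaussPos, ← probReal_compl_eq_one_sub measurableSet_Iic]
    congr 1
    ext x
    simp
  have ht := tendsto_cdf_atTop (gaussianReal 0 1)
  have hb := tendsto_cdf_atBot (gaussianReal 0 1)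
  obtain ⟨a, ha⟩ := (ht.eventually_const_lt (show 1 - θ < 1 by linarith)).exists
  obtain ⟨b, hb⟩ := (hb.eventually_lt_const (show 0 < 1 - θ by linarith)).exists
  exact mem_range_of_exists_le_of_exists_ge hc ⟨a, by simp only [hcdf]; linarith⟩
    ⟨b, by simp only [hcdf]; linarith⟩

end GaussTail

section Freezing

lemma setIntegral_preimage_comp_of_indepFun {Ω Ω' : Type*} {mΩ : MeasurableSpace Ω}
    {mΩ' : MeasurableSpace Ω'} {P : Measure Ω} [IsProbabilityMeasure P] {T : Ω → Ω'}
    (hT : Measurable T) {Z : Ω → ℝ} (hZ : Measurable Z) (hTZ : IndepFun T Z P)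
    {Φ : Ω' × ℝ → ℝ} (hΦ : Measurable Φ) {C : ℝ} (hC : ∀ y, |Φ y| ≤ C)
    {A : Set Ω'} (hA : MeasurableSet A) :
    ∫ ω in T ⁻¹' A, ∫ z, Φ (T ω, z) ∂P.map Z ∂P = ∫ ω in T ⁻¹' A, Φ (T ω, Z ω) ∂P := by
  have : IsProbabilityMeasure (P.map Z) := Measure.isProbabilityMeasure_map hZ.aemeasurable
  have : IsProbabilityMeasure (P.map T) := Measure.isProbabilityMeasure_map hT.aemeasurable
  have hprod := hTZ.map_prod_eq_prod_map_map hT.aemeasurable hZ.aemeasurable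
  have hi : Integrable Φ ((P.map T).prod (P.map Z)) :=
    .of_bound hΦ.aestronglyMeasurable C (ae_of_all _ hC)
  have hpre : T ⁻¹' A = (fun ω ↦ (T ω, Z ω)) ⁻¹' (A ×ˢ univ) := by ext; simp
  rw [← setIntegral_map hA (f := fun y ↦ ∫ z, Φ (y, z) ∂P.map Z)
    (hΦ.stronglyMeasurable.integral_prod_right').aestronglyMeasurable hT.aemeasurable, hpre,
    ← setIntegral_map (hA.prod MeasurableSet.univ) hΦ.aestronglyMeasurable
      (hT.prodMk hZ).aemeasurable, hprod, setIntegral_prod _ hi.integrableOn]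
  simp

lemma condExp_comp_of_indep {Ω E : Type*} {m m0 : MeasurableSpace Ω} {P : Measure Ω}
    [IsProbabilityMeasure P] [MeasurableSpace E] (hm : m ≤ m0) {Y : Ω → E} (hY : Measurable[m] Y)
    {Z : Ω → ℝ} (hZ : Measurable[m0] Z)
    (hYZ : Indep m (MeasurableSpace.comap Z inferInstance) P)
    {Φ : E × ℝ → ℝ} (hΦ : Measurable Φ) {C : ℝ} (hC : ∀ ω z, |Φ (Y ω, z)| ≤ C) :
    P[fun ω ↦ Φ (Y ω, Z ω) | m] =ᵐ[P] fun ω ↦ ∫ z, Φ (Y ω, z) ∂P.map Z := by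
  have : IsProbabilityMeasure (P.map Z) := Measure.isProbabilityMeasure_map hZ.aemeasurable
  have hYZ' : @IndepFun Ω Ω ℝ m0 m _ id Z P := by
    refine (IndepFun_iff_Indep (mβ := m) _ _ _).2 ?_
    rwa [MeasurableSpace.comap_id]
  have hg : StronglyMeasurable fun y ↦ ∫ z, Φ (y, z) ∂P.map Z :=
    hΦ.stronglyMeasurable.integral_prod_right'
  have hgC ω : ‖∫ z, Φ (Y ω, z) ∂P.map Z‖ ≤ C := by
    simpa using norm_integral_le_of_norm_le_const (μ := P.map Z) (f := fun z ↦ Φ (Y ω, z))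
      (ae_of_all _ fun z ↦ hC ω z)
  have hgi : Integrable (fun ω ↦ ∫ z, Φ (Y ω, z) ∂P.map Z) P :=
    .of_bound (hg.comp_measurable (hY.mono hm le_rfl)).aestronglyMeasurable C
      (ae_of_all _ fun ω ↦ hgC _)
  refine (ae_eq_condExp_of_forall_setIntegral_eq hm ?_ (fun _ _ _ ↦ hgi.integrableOn)
    (fun A hA _ ↦ ?_) (hg.comp_measurable hY).aestronglyMeasurable).symm
  · exact .of_bound (hΦ.comp ((hY.mono hm le_rfl).prodMk hZ)).aestronglyMeasurable C
      (ae_of_all _ fun ω ↦ hC _ _)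
  · exact setIntegral_preimage_comp_of_indepFun (mΩ' := m) (T := id) (measurable_id'' hm) hZ hYZ'
      (Φ := fun x ↦ Φ (Y x.1, x.2))
      (@Measurable.comp _ _ _ (_) _ _ _ _ hΦ
        (Measurable.prodMk (hY.comp measurable_fst) measurable_snd)) (fun _ ↦ hC _ _) hA

end Freezing

section BrownianIncrement

variable {Ω : Type*} {mΩ : MeasurableSpace Ω} {P : Measure Ω} {B : ℝ≥0 → Ω → ℝ}

lemma indep_natural_increment (hB : IsPreBrownianReal B P) (hm : ∀ t, Measurable (B t))
    {s t : ℝ≥0} (hst : s ≤ t) :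
    Indep (Filtration.natural B (fun t ↦ (hm t).stronglyMeasurable) s)
      (MeasurableSpace.comap (fun ω ↦ B t ω - B s ω) inferInstance) P := by
  rw [Filtration.natural_eq_comap]
  have h := (hB.indepFun_shift s).symm.comp (φ := id) (ψ := fun x ↦ x (t - s)) measurable_id
    (measurable_pi_apply (X := fun _ : ℝ≥0 ↦ ℝ) (t - s))
  rw [IndepFun_iff_Indep] at h
  simpa [Function.comp_def, add_tsub_cancel_of_le hst] using h

lemma map_increment (hB : IsPreBrownianReal B P) {s t : ℝ≥0} (hst : s ≤ t) :
    P.map (fun ω ↦ B t ω - B s ω) = gaussianReal 0 (t - s) := by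
  have h := (hB.hasLaw_sub t s).map_eq
  have h2 : nndist t.1 s.1 = t - s := by
    ext
    rw [coe_nndist, Real.dist_eq, NNReal.coe_sub hst, abs_of_nonneg]
    · rfl
    · exact sub_nonneg.2 (NNReal.coe_le_coe.2 hst)
  rwa [h2] at h

end BrownianIncrement

/-- Existence of Brownian motion on some complete probability space. -/
theorem exists_isBrownianReal_isComplete :
    ∃ (Ω : Type) (_ : MeasurableSpace Ω) (P : Measure Ω), IsProbabilityMeasure P ∧ P.IsComplete ∧
      ∃ B : ℝ≥0 → Ω → ℝ, (∀ t, Measurable (B t)) ∧ IsBrownianReal B P := by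
  obtain ⟨Ω, mΩ, P, hP, B, hm, hB⟩ := exists_isBrownianReal
  let f : NullMeasurableSpace Ω P → Ω := fun ω ↦ ω
  have hf : Measurable f := fun s hs ↦ MeasurableSet.nullMeasurableSet (μ := P) hs
  have hmap : P.completion.map f = P := by
    ext s hs
    rw [Measure.map_apply hf hs]
    exact Measure.completion_apply P s
  have hI (I : Finset ℝ≥0) : Measurable fun ω ↦ I.restrict (B · ω) :=
    measurable_pi_lambda _ fun i ↦ hm i
  refine ⟨NullMeasurableSpace Ω P, inferInstance, P.completion, ⟨?_⟩, inferInstance,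
    fun t ↦ B t ∘ f, fun t ↦ (hm t).comp hf, ⟨⟨fun I ↦ ⟨?_, ?_⟩⟩, ?_⟩⟩
  · exact measure_univ (μ := P)
  · exact ((hI I).comp hf).aemeasurable
  · rw [← (hB.hasLaw I).map_eq]
    conv_rhs => rw [← hmap, Measure.map_map (hI I) hf]
    rfl
  · exact hB.cont

section Augmentation

variable {Ω : Type*} {m0 : MeasurableSpace Ω}

/-- The filtration obtained by adding all null sets to every σ-algebra of a filtration. -/
def MeasureTheory.Filtration.augment {ι : Type*} [Preorder ι] (ℱ : Filtration ι m0)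
    (P : Measure Ω) [P.IsComplete] : Filtration ι m0 where
  seq t := eventuallyMeasurableSpace (ℱ t) (ae P)
  mono' := fun _ _ hst _ ⟨_, hA, h⟩ ↦ ⟨_, ℱ.mono hst _ hA, h⟩
  le' := fun t _ ⟨_, hA, h⟩ ↦
    ((ℱ.le t _ hA).nullMeasurableSet.congr h.symm).measurable_of_complete

lemma MeasureTheory.Martingale.augment_of_ae_eq {ι : Type*} [Preorder ι] {ℱ : Filtration ι m0}
    {P : Measure Ω} [IsFiniteMeasure P] [P.IsComplete] {X Y : ι → Ω → ℝ} (hX : Martingale X ℱ P)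
    (hXY : ∀ t, Y t =ᵐ[P] X t) : Martingale Y (ℱ.augment P) P := by
  have hY t : Measurable[ℱ.augment P t] (Y t) :=
    Measurable.eventuallyMeasurable_of_eventuallyEq (hX.1 t).measurable (hXY t)
  refine ⟨fun t ↦ (hY t).stronglyMeasurable, fun s t hst ↦ ?_⟩
  have hi t : Integrable (Y t) P := (hX.integrable t).congr (hXY t).symm
  refine (ae_eq_condExp_of_forall_setIntegral_eq ((ℱ.augment P).le s) (hi t)
    (fun _ _ _ ↦ (hi s).integrableOn) ?_ (hY s).stronglyMeasurable.aestronglyMeasurable).symm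
  rintro A ⟨A', hA', h⟩ -
  rw [setIntegral_congr_set h, setIntegral_congr_set h,
    setIntegral_congr_ae (ℱ.le s _ hA') ((hXY s).mono fun _ h _ ↦ h),
    setIntegral_congr_ae (ℱ.le s _ hA') ((hXY t).mono fun _ h _ ↦ h),
    hX.setIntegral_eq hst hA']

end Augmentation

/-- Data of a Markov chain with two possible transitions from each state, driven by a sequence of
real-valued increments: from `s` the chain goes to `up s` if the increment exceeds `q s`, and to
`dn s` otherwise. -/
structure BinaryChain (S : Type*) where
  start : S
  q : S → ℝ
  up : S → S
  dn : S → S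

namespace BinaryChain

variable {S Ω : Type*} (c : BinaryChain S) (B : ℝ≥0 → Ω → ℝ)

/-- Probability to go up when the increments are standard Gaussian. -/
noncomputable def prob (s : S) : ℝ := gaussPos (-c.q s) 1

/-- A function is harmonic when its mean is preserved by the transitions of the chain. -/
def Harmonic (f : S → ℝ) : Prop := ∀ s, f s = f (c.dn s) + (f (c.up s) - f (c.dn s)) * c.prob s

open Classical in
/-- The chain driven by the increments of `B` between successive integers. -/
noncomputable def state : ℕ → Ω → S
  | 0, _ => c.start
  | n + 1, ω => if c.q (state n ω) < B (n + 1) ω - B n ω then c.up (state n ω)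
      else c.dn (state n ω)

/-- Conditional expectation of `f (state (n + 1))` at time `t ∈ [n, n + 1]`. -/
noncomputable def piece (f : S → ℝ) (n : ℕ) (t : ℝ≥0) (ω : Ω) : ℝ :=
  f (c.dn (c.state B n ω)) + (f (c.up (c.state B n ω)) - f (c.dn (c.state B n ω))) *
    gaussPos (B t ω - B n ω - c.q (c.state B n ω)) (n + 1 - t)

/-- Continuous time interpolation of `f (state n)`. -/
noncomputable def interp (f : S → ℝ) (t : ℝ≥0) (ω : Ω) : ℝ := c.piece B f ⌊t⌋₊ t ω

variable {c B} {f : S → ℝ}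

lemma state_succ (n : ℕ) (ω : Ω) : c.state B (n + 1) ω =
    (open Classical in if c.q (c.state B n ω) < B (n + 1) ω - B n ω then c.up (c.state B n ω)
      else c.dn (c.state B n ω)) := rfl

lemma state_succ_eq_or (n : ℕ) (ω : Ω) : c.state B (n + 1) ω = c.up (c.state B n ω) ∨
    c.state B (n + 1) ω = c.dn (c.state B n ω) := by
  rw [state_succ]
  split_ifs <;> simp

lemma piece_self (hf : c.Harmonic f) (n : ℕ) (ω : Ω) :
    c.piece B f n n ω = f (c.state B n ω) := by
  rw [hf (c.state B n ω), piece, prob]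
  simp

lemma piece_succ (n : ℕ) (ω : Ω) :
    c.piece B f n (n + 1 : ℕ) ω = f (c.state B (n + 1) ω) := by
  rw [piece, state_succ]
  push_cast
  rw [tsub_self, gaussPos_zero]
  simp only [sub_pos]
  split_ifs <;> simp

lemma interp_natCast (hf : c.Harmonic f) (n : ℕ) (ω : Ω) :
    c.interp B f n ω = f (c.state B n ω) := by
  rw [interp, Nat.floor_natCast, piece_self hf]

lemma interp_eq_piece (hf : c.Harmonic f) {n : ℕ} {t : ℝ≥0} (h1 : n ≤ t) (h2 : t ≤ n + 1) (ω : Ω) :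
    c.interp B f t ω = c.piece B f n t ω := by
  rcases h2.lt_or_eq with h | rfl
  · rw [interp, (Nat.floor_eq_iff zero_le).2 ⟨h1, h⟩]
  · have := piece_succ (c := c) (B := B) (f := f) n ω
    rw [← interp_natCast hf] at this
    exact_mod_cast this.symm

lemma min_le_piece (n : ℕ) (t : ℝ≥0) (ω : Ω) :
    min (f (c.dn (c.state B n ω))) (f (c.up (c.state B n ω))) ≤ c.piece B f n t ω := by
  rw [piece]
  set g := gaussPos (B t ω - B n ω - c.q (c.state B n ω)) (n + 1 - t)
  have h0 : 0 ≤ g := gaussPos_nonneg _ _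
  have h1 : g ≤ 1 := gaussPos_le_one _ _
  rcases le_total (f (c.dn (c.state B n ω))) (f (c.up (c.state B n ω))) with h | h
  · rw [min_eq_left h]; nlinarith
  · rw [min_eq_right h]; nlinarith

lemma abs_piece_le (n : ℕ) (t : ℝ≥0) (ω : Ω) :
    |c.piece B f n t ω| ≤ |f (c.dn (c.state B n ω))| + |f (c.up (c.state B n ω))| := by
  rw [piece]
  set g := gaussPos (B t ω - B n ω - c.q (c.state B n ω)) (n + 1 - t)
  have h0 : 0 ≤ g := gaussPos_nonneg _ _
  have h1 : g ≤ 1 := gaussPos_le_one _ _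
  have : f (c.dn (c.state B n ω)) + (f (c.up (c.state B n ω)) - f (c.dn (c.state B n ω))) * g
    = f (c.dn (c.state B n ω)) * (1 - g) + f (c.up (c.state B n ω)) * g := by ring
  rw [this]
  refine (abs_add_le _ _).trans ?_
  rw [abs_mul, abs_mul, abs_of_nonneg h0, abs_of_nonneg (sub_nonneg.2 h1)]
  gcongr
  · exact mul_le_of_le_one_right (abs_nonneg _) (by linarith)
  · exact mul_le_of_le_one_right (abs_nonneg _) h1

lemma exists_abs_state_le (n : ℕ) (f : S → ℝ) : ∃ C, ∀ ω, |f (c.state B n ω)| ≤ C := by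
  induction n generalizing f with
  | zero => exact ⟨|f c.start|, fun ω ↦ le_rfl⟩
  | succ n ih =>
    obtain ⟨C, hC⟩ := ih fun s ↦ |f (c.up s)| + |f (c.dn s)|
    refine ⟨C, fun ω ↦ le_trans ?_ ((le_abs_self _).trans (hC ω))⟩
    rcases state_succ_eq_or (c := c) (B := B) n ω with h | h <;> rw [h] <;> simp

lemma exists_forall_abs_state_le {T : ℕ} (hT : ∀ n ≥ T, ∀ ω, c.state B n ω = c.state B T ω)
    (f : S → ℝ) : ∃ C, ∀ n ω, |f (c.state B n ω)| ≤ C := by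
  choose C hC using fun n ↦ exists_abs_state_le (c := c) (B := B) n f
  rcases isEmpty_or_nonempty Ω with h | ⟨⟨ω₀⟩⟩
  · exact ⟨0, fun n ω ↦ isEmptyElim ω⟩
  have hle {n} (hn : n ≤ T) : C n ≤ ∑ i ∈ Finset.range (T + 1), C i :=
    Finset.single_le_sum (fun i _ ↦ (abs_nonneg _).trans (hC i ω₀)) (Finset.mem_range.2 (by lia))
  refine ⟨∑ i ∈ Finset.range (T + 1), C i, fun n ω ↦ ?_⟩
  rcases le_total n T with h | h
  · exact (hC n ω).trans (hle h)
  · rw [hT n h]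
    exact (hC T ω).trans (hle le_rfl)

section Continuity

lemma continuousOn_piece {ω : Ω} (hc : Continuous (B · ω)) (n : ℕ)
    (hq : B (n + 1) ω - B n ω ≠ c.q (c.state B n ω)) :
    ContinuousOn (fun t ↦ c.piece B f n t ω) (Icc n (n + 1)) := by
  intro t ht
  refine ContinuousAt.continuousWithinAt ?_
  refine continuousAt_const.add (continuousAt_const.mul ?_)
  refine (continuousAt_gaussPos (a := (B t ω - B n ω - c.q (c.state B n ω), (n : ℝ≥0) + 1 - t))
    fun h ↦ ?_).comp (f := fun t : ℝ≥0 ↦ (B t ω - B n ω - c.q (c.state B n ω), (n : ℝ≥0) + 1 - t))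
    (by fun_prop)
  rw [Prod.mk_eq_zero] at h
  have : t = n + 1 := le_antisymm ht.2 (tsub_eq_zero_iff_le.1 h.2)
  subst this
  exact hq (sub_eq_zero.1 h.1)

lemma continuous_interp (hf : c.Harmonic f) {ω : Ω} (hc : Continuous (B · ω))
    (hq : ∀ n : ℕ, B (n + 1) ω - B n ω ≠ c.q (c.state B n ω)) :
    Continuous fun t ↦ c.interp B f t ω := by
  have hlf : LocallyFinite fun n : ℕ ↦ Icc (n : ℝ≥0) (n + 1) := by
    intro x
    refine ⟨Iio (x + 1), Iio_mem_nhds (by simp), (finite_Iic ⌊x + 1⌋₊).subset ?_⟩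
    rintro n ⟨y, hy1, hy2⟩
    exact Nat.le_floor (hy1.1.trans (le_of_lt hy2))
  refine hlf.continuous ?_ (fun n ↦ isClosed_Icc) fun n ↦ ?_
  · rw [eq_univ_iff_forall]
    intro t
    exact mem_iUnion.2 ⟨⌊t⌋₊, Nat.floor_le zero_le, (Nat.lt_floor_add_one t).le⟩
  · exact (continuousOn_piece hc n (hq n)).congr fun t ht ↦ interp_eq_piece hf ht.1 ht.2 ω

end Continuity

lemma ae_increment_ne [Countable S] {m0 : MeasurableSpace Ω} {P : Measure Ω}
    (hB : IsPreBrownianReal B P) :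
    ∀ᵐ ω ∂P, ∀ n : ℕ, B (n + 1) ω - B n ω ≠ c.q (c.state B n ω) := by
  have h (n : ℕ) (s : S) : ∀ᵐ ω ∂P, B (n + 1) ω - B n ω ≠ c.q s := by
    have hn : (n : ℝ≥0) ≤ n + 1 := by simp
    have h1 : ((n : ℝ≥0) + 1) - n ≠ 0 := by simp
    have := nullSingletonClass_gaussianReal (μ := 0) h1
    have h2 := Measure.ae_ne (gaussianReal 0 ((n : ℝ≥0) + 1 - n)) (c.q s)
    rw [← map_increment hB hn] at h2
    exact ae_of_ae_map ((hB.aemeasurable _).sub (hB.aemeasurable _)) h2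
  filter_upwards [ae_all_iff.2 fun n ↦ ae_all_iff.2 (h n)] with ω hω n
  exact hω n _

section Martingale

variable [MeasurableSpace S] [DiscreteMeasurableSpace S] {m0 : MeasurableSpace Ω}
  {P : Measure Ω}

lemma measurable_state {m : MeasurableSpace Ω} {n : ℕ} (hB : ∀ k ≤ n, Measurable (B k)) :
    Measurable (c.state B n) := by
  induction n with
  | zero => exact measurable_const
  | succ n ih =>
    have h := ih fun k hk ↦ hB k (hk.trans n.le_succ)
    have h1 : Measurable (B (n + 1)) := by exact_mod_cast hB (n + 1) le_rfl
    refine Measurable.ite (measurableSet_lt ?_ ?_) ?_ ?_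
    · exact (Measurable.of_discrete (f := c.q)).comp h
    · exact h1.sub (hB n n.le_succ)
    · exact (Measurable.of_discrete (f := c.up)).comp h
    · exact (Measurable.of_discrete (f := c.dn)).comp h

lemma measurable_gaussPos_left (v : ℝ≥0) : Measurable (gaussPos · v) := by
  refine Monotone.measurable fun x y hxy ↦ measureReal_mono ?_
  intro z hz
  have hz' : 0 < x + z := hz
  show 0 < y + z
  linarith

lemma measurable_piece {m : MeasurableSpace Ω} {n : ℕ} {t : ℝ≥0}
    (hB : ∀ k ≤ n, Measurable (B k)) (ht : Measurable (B t)) : Measurable (c.piece B f n t) := by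
  have h := measurable_state (c := c) hB
  have hd : Measurable fun ω ↦ f (c.dn (c.state B n ω)) :=
    (Measurable.of_discrete (f := fun s ↦ f (c.dn s))).comp h
  have hu : Measurable fun ω ↦ f (c.up (c.state B n ω)) :=
    (Measurable.of_discrete (f := fun s ↦ f (c.up s))).comp h
  have hq : Measurable fun ω ↦ c.q (c.state B n ω) := (Measurable.of_discrete (f := c.q)).comp h
  exact hd.add ((hu.sub hd).mul
    ((measurable_gaussPos_left _).comp ((ht.sub (hB n le_rfl)).sub hq)))

lemma integrable_comp_state [IsFiniteMeasure P] (hm : ∀ t, Measurable (B t)) (n : ℕ) (f : S → ℝ) :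
    Integrable (fun ω ↦ f (c.state B n ω)) P := by
  obtain ⟨C, hC⟩ := exists_abs_state_le (c := c) (B := B) n f
  exact .of_bound ((Measurable.of_discrete (f := f)).comp
    (measurable_state fun k _ ↦ hm k)).aestronglyMeasurable C (ae_of_all _ hC)

variable [IsProbabilityMeasure P]

lemma condExp_state_succ (hB : IsPreBrownianReal B P) (hm : ∀ t, Measurable (B t)) (f : S → ℝ)
    {n : ℕ} {t : ℝ≥0} (h1 : n ≤ t) (h2 : t ≤ n + 1) :
    P[fun ω ↦ f (c.state B (n + 1) ω) |
      Filtration.natural B (fun t ↦ (hm t).stronglyMeasurable) t] =ᵐ[P] c.piece B f n t := by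
  set ℱ := Filtration.natural B (fun t ↦ (hm t).stronglyMeasurable)
  have had {u} (hu : u ≤ t) : Measurable[ℱ t] (B u) :=
    ((Filtration.stronglyAdapted_natural fun t ↦ (hm t).stronglyMeasurable) u).measurable.mono
      (ℱ.mono hu) le_rfl
  have hst : Measurable[ℱ t] (c.state B n) :=
    measurable_state fun k hk ↦ had ((Nat.cast_le.2 hk).trans h1)
  classical
  let Φ : (S × ℝ) × ℝ → ℝ := fun x ↦
    if c.q x.1.1 < x.1.2 + x.2 then f (c.up x.1.1) else f (c.dn x.1.1)
  have hΦ : Measurable Φ := by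
    have hs (g : S → ℝ) : Measurable fun x : (S × ℝ) × ℝ ↦ g x.1.1 :=
      (Measurable.of_discrete (f := g)).comp (by fun_prop)
    exact Measurable.ite (measurableSet_lt (hs c.q) (by fun_prop)) (hs fun s ↦ f (c.up s))
      (hs fun s ↦ f (c.dn s))
  obtain ⟨C, hC⟩ := exists_abs_state_le (c := c) (B := B) n fun s ↦ |f (c.up s)| + |f (c.dn s)|
  have key := condExp_comp_of_indep (P := P) (ℱ.le t)
    (Y := fun ω ↦ (c.state B n ω, B t ω - B n ω)) (hst.prodMk ((had le_rfl).sub (had h1)))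
    (Z := fun ω ↦ B (n + 1) ω - B t ω) ((hm _).sub (hm _)) (indep_natural_increment hB hm h2)
    (Φ := Φ) hΦ (C := C) fun ω z ↦ by
      refine le_trans ?_ ((le_abs_self _).trans (hC ω))
      simp only [Φ]
      split_ifs <;> simp
  rw [map_increment hB h2] at key
  have hL : (fun ω ↦ f (c.state B (n + 1) ω))
      = fun ω ↦ Φ ((c.state B n ω, B t ω - B n ω), B (n + 1) ω - B t ω) := by
    funext ω
    simp only [Φ, state_succ, sub_add_sub_cancel', apply_ite f]
  rw [hL]
  refine key.trans (ae_of_all _ fun ω ↦ ?_)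
  have hset : MeasurableSet {z : ℝ | 0 < B t ω - B n ω - c.q (c.state B n ω) + z} :=
    measurableSet_lt (by fun_prop) (by fun_prop)
  have : ∀ z, Φ ((c.state B n ω, B t ω - B n ω), z) = f (c.dn (c.state B n ω)) +
      {z : ℝ | 0 < B t ω - B n ω - c.q (c.state B n ω) + z}.indicator
        (fun _ ↦ f (c.up (c.state B n ω)) - f (c.dn (c.state B n ω))) z := by
    intro z
    by_cases h : c.q (c.state B n ω) < B t ω - B n ω + z
    · have h' : 0 < B t ω - B n ω - c.q (c.state B n ω) + z := by linarith
      simp [Φ, h, h', indicator]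
    · have h' : ¬ 0 < B t ω - B n ω - c.q (c.state B n ω) + z := by linarith
      simp only [Φ, h, indicator, mem_ofPred_eq, h', if_false, add_zero]
  simp only [this]
  rw [integral_add (integrable_const _) ((integrable_const _).indicator hset),
    integral_indicator_const _ hset]
  simp [piece, gaussPos, mul_comm]

lemma condExp_state (hB : IsPreBrownianReal B P) (hm : ∀ t, Measurable (B t))
    (hf : c.Harmonic f) {n : ℕ} {t : ℝ≥0} (h : t ≤ n) :
    P[fun ω ↦ f (c.state B n ω) |
      Filtration.natural B (fun t ↦ (hm t).stronglyMeasurable) t] =ᵐ[P] c.interp B f t := by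
  set ℱ := Filtration.natural B (fun t ↦ (hm t).stronglyMeasurable)
  induction n with
  | zero =>
    have ht : t = (0 : ℕ) := by simpa using h
    subst ht
    have h0 : c.interp B f (0 : ℕ) = fun ω ↦ f c.start := by
      funext ω
      rw [interp_natCast hf, state]
    rw [h0]
    simp only [state]
    rw [condExp_const (ℱ.le _)]
  | succ n ih =>
    rcases le_total (n : ℝ≥0) t with h1 | h1
    · have h2 : t ≤ n + 1 := by exact_mod_cast h
      exact (condExp_state_succ hB hm f h1 h2).trans
        (ae_of_all _ fun ω ↦ (interp_eq_piece hf h1 h2 ω).symm)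
    · refine (condExp_condExp_of_le (ℱ.mono h1) (ℱ.le _)).symm.trans
        ((condExp_congr_ae ?_).trans (ih h1))
      refine (condExp_state_succ hB hm f le_rfl (by simp)).trans ?_
      exact ae_of_all _ fun ω ↦ piece_self hf n ω

lemma martingale_interp (hB : IsPreBrownianReal B P) (hm : ∀ t, Measurable (B t))
    (hf : c.Harmonic f) :
    Martingale (c.interp B f) (Filtration.natural B fun t ↦ (hm t).stronglyMeasurable) P := by
  set ℱ := Filtration.natural B (fun t ↦ (hm t).stronglyMeasurable)
  have had {u t} (hu : u ≤ t) : Measurable[ℱ t] (B u) :=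
    ((Filtration.stronglyAdapted_natural fun t ↦ (hm t).stronglyMeasurable) u).measurable.mono
      (ℱ.mono hu) le_rfl
  refine ⟨fun t ↦ ?_, fun s t hst ↦ ?_⟩
  · refine Measurable.stronglyMeasurable ?_
    exact measurable_piece (n := ⌊t⌋₊) (fun k hk ↦ had ((Nat.le_floor_iff zero_le).1 hk))
      (had le_rfl)
  · obtain ⟨n, hn⟩ := exists_nat_ge t
    refine (condExp_congr_ae (condExp_state hB hm hf hn).symm).trans ?_
    exact (condExp_condExp_of_le (ℱ.mono hst) (ℱ.le _)).trans (condExp_state hB hm hf (hst.trans hn))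

lemma integral_state_succ (hB : IsPreBrownianReal B P) (hm : ∀ t, Measurable (B t)) (f : S → ℝ)
    (n : ℕ) : ∫ ω, f (c.state B (n + 1) ω) ∂P = ∫ ω, c.piece B f n n ω ∂P := by
  rw [← integral_congr_ae (condExp_state_succ (c := c) hB hm f le_rfl (by simp)),
    integral_condExp (Filtration.le _ _)]

lemma integral_state (hB : IsPreBrownianReal B P) (hm : ∀ t, Measurable (B t))
    (hf : c.Harmonic f) (n : ℕ) : ∫ ω, f (c.state B n ω) ∂P = f c.start := by
  induction n with
  | zero => simp [state]
  | succ n ih =>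
    rw [integral_state_succ hB hm, ← ih]
    simp only [piece_self hf]

end Martingale

end BinaryChain

section RunningSup

variable {Ω : Type*} {m0 : MeasurableSpace Ω} {X : ℝ≥0 → Ω → ℝ} {M : ℝ} {t : ℝ≥0}

lemma neg_iInf_min_zero {ι : Sort*} (f : ι → ℝ) : -⨅ i, min (f i) 0 = ⨆ i, max (-f i) 0 := by
  rw [iInf, Real.sInf_def, neg_neg, ← Set.image_neg_eq_neg, ← range_comp, iSup]
  congr 2
  funext i
  simp [← max_neg_neg]

/-- Running supremum of the positive part. -/
noncomputable def runSup (X : ℝ≥0 → Ω → ℝ) (t : ℝ≥0) (ω : Ω) : ℝ :=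
  ⨆ s : Icc (0 : ℝ≥0) t, max (X s ω) 0

lemma runSup_nonneg (ω : Ω) : 0 ≤ runSup X t ω := Real.iSup_nonneg fun _ ↦ le_max_right _ _

lemma runSup_le {ω : Ω} {R : ℝ} (hR : 0 ≤ R) (h : ∀ s ≤ t, X s ω ≤ R) : runSup X t ω ≤ R :=
  Real.iSup_le (fun s ↦ max_le (h s s.2.2) hR) hR

lemma le_runSup {ω : Ω} (hM : ∀ t, |X t ω| ≤ M) {s : ℝ≥0} (hs : s ≤ t) :
    max (X s ω) 0 ≤ runSup X t ω := by
  refine le_ciSup (f := fun s : Icc (0 : ℝ≥0) t ↦ max (X s ω) 0) ⟨M, ?_⟩ ⟨s, zero_le, hs⟩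
  rintro _ ⟨u, rfl⟩
  exact max_le ((le_abs_self _).trans (hM u)) ((abs_nonneg _).trans (hM u))

lemma measurable_runSup (hX : ∀ t, Measurable (X t)) (hc : ∀ ω, Continuous (X · ω))
    (t : ℝ≥0) : Measurable (runSup X t) := by
  have : Nonempty (Icc (0 : ℝ≥0) t) := ⟨0, le_rfl, zero_le⟩
  have h : runSup X t = fun ω ↦ ⨆ n : ℕ, max (X (TopologicalSpace.denseSeq (Icc (0 : ℝ≥0) t) n) ω) 0 := by
    funext ω
    have hcont : Continuous fun s : Icc (0 : ℝ≥0) t ↦ max (X s ω) 0 :=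
      ((hc ω).comp continuous_subtype_val).max continuous_const
    rw [runSup, ← (TopologicalSpace.denseRange_denseSeq (Icc (0 : ℝ≥0) t)).ciSup' hcont]
    exact (rangeFactorization_surjective.iSup_comp _).symm
  rw [h]
  exact Measurable.iSup fun n ↦ (hX _).max measurable_const

lemma integrable_rpow_runSup {P : Measure Ω} [IsFiniteMeasure P] {p : ℝ} (hp : 0 ≤ p)
    (hX : ∀ t, Measurable (X t)) (hc : ∀ ω, Continuous (X · ω)) (hM : ∀ t ω, |X t ω| ≤ M)
    (t : ℝ≥0) : Integrable (fun ω ↦ runSup X t ω ^ p) P := by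
  refine .of_bound ((measurable_runSup hX hc t).pow_const p).aestronglyMeasurable (M ^ p)
    (ae_of_all _ fun ω ↦ ?_)
  rw [Real.norm_of_nonneg (Real.rpow_nonneg (runSup_nonneg ω) p)]
  exact Real.rpow_le_rpow (runSup_nonneg ω) (runSup_le ((abs_nonneg _).trans (hM 0 ω))
    fun s _ ↦ (le_abs_self _).trans (hM s ω)) hp

end RunningSup

namespace BinaryChain

variable {S Ω : Type*} {c : BinaryChain S} {B : ℝ≥0 → Ω → ℝ}

lemma state_eq_of_rank {rk : S → ℕ} (hu : ∀ s, rk (c.up s) ≤ rk s - 1)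
    (hd : ∀ s, rk (c.dn s) ≤ rk s - 1) (h0 : ∀ s, rk s = 0 → c.up s = s ∧ c.dn s = s) {n : ℕ}
    (hn : rk c.start ≤ n) (ω : Ω) :
    rk (c.state B n ω) = 0 ∧ c.state B n ω = c.state B (rk c.start) ω := by
  have hr (n : ℕ) : rk (c.state B n ω) ≤ rk c.start - n := by
    induction n with
    | zero => exact le_rfl
    | succ n ih =>
      have h1 := hu (c.state B n ω)
      have h2 := hd (c.state B n ω)
      rcases state_succ_eq_or (c := c) (B := B) n ω with h | h <;> rw [h] <;> lia
  have hz {n : ℕ} (hn : rk c.start ≤ n) : rk (c.state B n ω) = 0 := by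
    have := hr n
    lia
  refine ⟨hz hn, ?_⟩
  induction n, hn using Nat.le_induction with
  | base => rfl
  | succ n hn ih =>
    have := h0 _ (hz hn)
    rcases state_succ_eq_or (c := c) (B := B) n ω with h | h <;> rw [h, ← ih]
    · exact this.1
    · exact this.2

lemma apply_state_le {z h : S → ℝ} (h0 : h c.start ≤ 0)
    (hu : ∀ s, h (c.up s) ≤ max (h s) (z (c.up s)))
    (hd : ∀ s, h (c.dn s) ≤ max (h s) (z (c.dn s))) {n : ℕ} {ω : Ω} {R : ℝ}
    (hR : 0 ≤ R) (hz : ∀ k ≤ n, z (c.state B k ω) ≤ R) : h (c.state B n ω) ≤ R := by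
  induction n with
  | zero => exact h0.trans hR
  | succ n ih =>
    have h1 := ih fun k hk ↦ hz k (hk.trans n.le_succ)
    have h2 := hz (n + 1) le_rfl
    rcases state_succ_eq_or (c := c) (B := B) n ω with h | h <;> rw [h] at h2 ⊢
    · exact (hu _).trans (max_le h1 h2)
    · exact (hd _).trans (max_le h1 h2)

lemma neg_interp_le {z l : S → ℝ} (hz : c.Harmonic z) (hdu : ∀ s, z (c.dn s) ≤ z (c.up s))
    (h0 : -z c.start ≤ l c.start)
    (hu : ∀ s, l s ≤ l (c.up s)) (hd : ∀ s, l s ≤ l (c.dn s))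
    (hzu : ∀ s, -z (c.dn s) ≤ l (c.up s)) (hzd : ∀ s, -z (c.dn s) ≤ l (c.dn s))
    {n : ℕ} {t : ℝ≥0} (ht : t ≤ n) (ω : Ω) : -c.interp B z t ω ≤ l (c.state B n ω) := by
  induction n with
  | zero =>
    have ht : t = (0 : ℕ) := by simpa using ht
    subst ht
    rw [interp_natCast hz]
    exact h0
  | succ n ih =>
    rcases le_total t n with h1 | h1
    · refine (ih h1).trans ?_
      rcases state_succ_eq_or (c := c) (B := B) n ω with h | h <;> rw [h]
      · exact hu _
      · exact hd _
    · rw [interp_eq_piece hz h1 (by exact_mod_cast ht)]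
      have := min_le_piece (c := c) (B := B) (f := z) n t ω
      rw [min_eq_left (hdu _)] at this
      refine (neg_le_neg this).trans ?_
      rcases state_succ_eq_or (c := c) (B := B) n ω with h | h <;> rw [h]
      · exact hzu _
      · exact hzd _

end BinaryChain

namespace BinaryChain

variable {S Ω : Type*} {c : BinaryChain S} {B : ℝ≥0 → Ω → ℝ}

lemma abs_interp_le {f : S → ℝ} {T : ℕ} (hT : ∀ n ≥ T, ∀ ω, c.state B n ω = c.state B T ω) :
    ∃ M, ∀ t ω, |c.interp B f t ω| ≤ M := by
  obtain ⟨C, hC⟩ := exists_forall_abs_state_le hT fun s ↦ |f (c.dn s)| + |f (c.up s)|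
  exact ⟨C, fun t ω ↦ (abs_piece_le _ _ _).trans ((le_abs_self _).trans (hC _ ω))⟩

/-- A continuous martingale embedding a finite-horizon chain with values `z`, whose running
supremum and infimum are controlled by the functions `h` and `l` of the chain. -/
theorem exists_martingale_of_chain {S : Type} [Countable S] [MeasurableSpace S]
    [DiscreteMeasurableSpace S] {c : BinaryChain S} {z h l W : S → ℝ} {rk : S → ℕ} {p C C' : ℝ}
    (hp : 0 < p) (hz : c.Harmonic z) (hW : c.Harmonic W) (hz0 : z c.start = 0)
    (hdu : ∀ s, z (c.dn s) ≤ z (c.up s))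
    (hru : ∀ s, rk (c.up s) ≤ rk s - 1) (hrd : ∀ s, rk (c.dn s) ≤ rk s - 1)
    (hr0 : ∀ s, rk s = 0 → c.up s = s ∧ c.dn s = s)
    (hh : ∀ s, 0 ≤ h s) (hh0 : h c.start ≤ 0)
    (hhu : ∀ s, h (c.up s) ≤ max (h s) (z (c.up s)))
    (hhd : ∀ s, h (c.dn s) ≤ max (h s) (z (c.dn s)))
    (hl : ∀ s, 0 ≤ l s) (hlu : ∀ s, l s ≤ l (c.up s)) (hld : ∀ s, l s ≤ l (c.dn s))
    (hzu : ∀ s, -z (c.dn s) ≤ l (c.up s)) (hzd : ∀ s, -z (c.dn s) ≤ l (c.dn s))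
    (hWle : ∀ s, rk s = 0 → W s ≤ h s ^ p - C * l s ^ p) (hW0 : 0 < W c.start) (hC : 0 ≤ C)
    (hdn : z (c.dn c.start) < 0) (hprob : c.prob c.start < 1) (hC' : C' ≤ C ^ (1 / p)) :
    ∃ (Ω : Type) (m0 : MeasurableSpace Ω) (P : Measure Ω),
      IsProbabilityMeasure P ∧ P.IsComplete ∧
      ∃ (ℱ : Filtration ℝ≥0 m0) (X : ℝ≥0 → Ω → ℝ),
        Martingale X ℱ P ∧
        (∀ ω, Continuous fun t => X t ω) ∧
        (∀ᵐ ω ∂P, X 0 ω = 0) ∧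
        (0 < ⨆ t : ℝ≥0, (∫ ω, runSup (-X) t ω ^ p ∂P) ^ (1 / p)) ∧
        BddAbove (range fun t : ℝ≥0 => (∫ ω, runSup (-X) t ω ^ p ∂P) ^ (1 / p)) ∧
        (⨆ t : ℝ≥0, (∫ ω, runSup X t ω ^ p ∂P) ^ (1 / p)) >
          C' * ⨆ t : ℝ≥0, (∫ ω, runSup (-X) t ω ^ p ∂P) ^ (1 / p) := by
  obtain ⟨Ω, m0, P, hP, hPc, B, hm, hB⟩ := exists_isBrownianReal_isComplete
  refine ⟨Ω, m0, P, hP, hPc, ?_⟩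
  set T := rk c.start with hTdef
  have hT0 (ω : Ω) : rk (c.state B T ω) = 0 := (state_eq_of_rank hru hrd hr0 le_rfl ω).1
  have hT (n : ℕ) (hn : n ≥ T) (ω : Ω) : c.state B n ω = c.state B T ω :=
    (state_eq_of_rank hru hrd hr0 hn ω).2
  obtain ⟨M, hM⟩ := abs_interp_le (f := z) hT
  let G : Set Ω := {ω | Continuous (B · ω) ∧ ∀ n : ℕ, B (n + 1) ω - B n ω ≠ c.q (c.state B n ω)}
  have hG : ∀ᵐ ω ∂P, ω ∈ G := by
    filter_upwards [hB.cont, ae_increment_ne (c := c) hB.toIsPreBrownianReal] with ω h1 h2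
    exact ⟨h1, h2⟩
  classical
  let Y : ℝ≥0 → Ω → ℝ := fun t ω ↦ if ω ∈ G then c.interp B z t ω else 0
  have hYG {ω} (hω : ω ∈ G) (t : ℝ≥0) : Y t ω = c.interp B z t ω := if_pos hω
  have hYc (ω : Ω) : Continuous fun t ↦ Y t ω := by
    by_cases hω : ω ∈ G
    · simp only [hYG hω]
      exact continuous_interp hz hω.1 hω.2
    · simp only [Y, if_neg hω]
      exact continuous_const
  have hYM (t : ℝ≥0) (ω : Ω) : |Y t ω| ≤ M := by
    by_cases hω : ω ∈ G
    · rw [hYG hω]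
      exact hM t ω
    · simp only [Y, if_neg hω, abs_zero]
      exact (abs_nonneg _).trans (hM t ω)
  have hYmart : Martingale Y _ P := (martingale_interp hB.toIsPreBrownianReal hm hz).augment_of_ae_eq
    fun t ↦ hG.mono fun ω hω ↦ hYG hω t
  have hYm (t : ℝ≥0) : Measurable (Y t) :=
    ((hYmart.stronglyAdapted t).mono (Filtration.le _ t)).measurable
  have hnm (t : ℝ≥0) : Measurable ((-Y) t) := (hYm t).neg
  have hnc (ω : Ω) : Continuous ((-Y) · ω) := (hYc ω).neg
  have hnM (t : ℝ≥0) (ω : Ω) : |(-Y) t ω| ≤ M := by simpa using hYM t ω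
  have hSint := integrable_rpow_runSup (P := P) hp.le hYm hYc hYM
  have hIint := integrable_rpow_runSup (P := P) hp.le hnm hnc hnM
  have hstate (n : ℕ) {ω : Ω} (hω : ω ∈ G) : Y n ω = z (c.state B n ω) := by
    rw [hYG hω, interp_natCast hz]
  have hint (n : ℕ) (f : S → ℝ) := integrable_comp_state (c := c) (P := P) hm n f
  have hIle (t : ℝ≥0) : ∫ ω, runSup (-Y) t ω ^ p ∂P ≤ ∫ ω, l (c.state B T ω) ^ p ∂P := by
    refine integral_mono_ae (hIint t) (hint T fun s ↦ l s ^ p) (hG.mono fun ω hω ↦ ?_)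
    refine Real.rpow_le_rpow (runSup_nonneg ω) (runSup_le (hl _) fun s hs ↦ ?_) hp.le
    obtain ⟨n, hn⟩ := exists_nat_ge (max t T)
    have h2 : T ≤ n := by exact_mod_cast (le_max_right t (T : ℝ≥0)).trans hn
    rw [Pi.neg_apply, Pi.neg_apply, hYG hω, ← hT n h2 ω]
    exact neg_interp_le hz hdu (by simpa [hz0] using hl c.start) hlu hld hzu hzd
      (hs.trans ((le_max_left _ _).trans hn)) ω
  have hleS : ∫ ω, h (c.state B T ω) ^ p ∂P ≤ ∫ ω, runSup Y T ω ^ p ∂P := by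
    refine integral_mono_ae (hint T fun s ↦ h s ^ p) (hSint T) (hG.mono fun ω hω ↦ ?_)
    refine Real.rpow_le_rpow (hh _) ?_ hp.le
    refine apply_state_le hh0 hhu hhd (runSup_nonneg ω) fun k hk ↦ ?_
    rw [← hstate k hω]
    exact (le_max_left _ _).trans (le_runSup (fun t ↦ hYM t ω) (Nat.cast_le.2 hk))
  have hlt : C * ∫ ω, l (c.state B T ω) ^ p ∂P < ∫ ω, h (c.state B T ω) ^ p ∂P := by
    have h1 : W c.start ≤ ∫ ω, (h (c.state B T ω) ^ p - C * l (c.state B T ω) ^ p) ∂P := by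
      rw [← integral_state (P := P) hB.toIsPreBrownianReal hm hW T]
      exact integral_mono (hint T W) (hint T fun s ↦ h s ^ p - C * l s ^ p)
        fun ω ↦ hWle _ (hT0 ω)
    rw [integral_sub (hint T fun s ↦ h s ^ p) (hint T fun s ↦ C * l s ^ p),
      integral_const_mul] at h1
    linarith
  have hlnn : 0 ≤ ∫ ω, l (c.state B T ω) ^ p ∂P :=
    integral_nonneg fun ω ↦ Real.rpow_nonneg (hl _) p
  have hInn (t : ℝ≥0) : 0 ≤ ∫ ω, runSup (-Y) t ω ^ p ∂P :=
    integral_nonneg fun ω ↦ Real.rpow_nonneg (runSup_nonneg ω) p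
  have hSnn (t : ℝ≥0) : 0 ≤ ∫ ω, runSup Y t ω ^ p ∂P :=
    integral_nonneg fun ω ↦ Real.rpow_nonneg (runSup_nonneg ω) p
  have hp' : 0 < 1 / p := by positivity
  have hIle' (t : ℝ≥0) : (∫ ω, runSup (-Y) t ω ^ p ∂P) ^ (1 / p) ≤
      (∫ ω, l (c.state B T ω) ^ p ∂P) ^ (1 / p) := Real.rpow_le_rpow (hInn t) (hIle t) hp'.le
  have hIbdd : BddAbove (range fun t : ℝ≥0 => (∫ ω, runSup (-Y) t ω ^ p ∂P) ^ (1 / p)) :=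
    ⟨_, by rintro _ ⟨t, rfl⟩; exact hIle' t⟩
  have hSbdd : BddAbove (range fun t : ℝ≥0 => (∫ ω, runSup Y t ω ^ p ∂P) ^ (1 / p)) := by
    refine ⟨(M ^ p) ^ (1 / p), ?_⟩
    rintro _ ⟨t, rfl⟩
    refine Real.rpow_le_rpow (hSnn t) ?_ hp'.le
    refine (integral_mono (hSint t) (integrable_const (M ^ p)) fun ω ↦ ?_).trans_eq (by simp)
    exact Real.rpow_le_rpow (runSup_nonneg ω) (runSup_le ((abs_nonneg _).trans (hYM 0 ω))
      fun s _ ↦ (le_abs_self _).trans (hYM s ω)) hp.le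
  refine ⟨_, Y, hYmart, hYc, ?_, ?_, hIbdd, ?_⟩
  · filter_upwards [hG] with ω hω
    simpa [state, hz0] using hstate 0 hω
  · refine lt_of_lt_of_le ?_ (le_ciSup hIbdd 1)
    refine Real.rpow_pos_of_pos ?_ _
    have h1 : ∫ ω, max (-z (c.state B 1 ω)) 0 ^ p ∂P ≤ ∫ ω, runSup (-Y) 1 ω ^ p ∂P := by
      refine integral_mono_ae (hint 1 fun s ↦ max (-z s) 0 ^ p) (hIint 1)
        (hG.mono fun ω hω ↦ ?_)
      refine Real.rpow_le_rpow (le_max_right _ _) ?_ hp.le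
      have := le_runSup (fun t ↦ hnM t ω) (le_refl 1)
      rw [Pi.neg_apply, Pi.neg_apply, ← Nat.cast_one, hstate 1 hω] at this
      exact_mod_cast this
    refine lt_of_lt_of_le ?_ h1
    have h2 := integral_state_succ (c := c) (P := P) hB.toIsPreBrownianReal hm
      (fun s ↦ max (-z s) 0 ^ p) 0
    rw [zero_add] at h2
    rw [h2]
    have h3 (ω : Ω) : c.piece B (fun s ↦ max (-z s) 0 ^ p) 0 (0 : ℕ) ω =
        max (-z (c.dn c.start)) 0 ^ p * (1 - c.prob c.start) +
          max (-z (c.up c.start)) 0 ^ p * c.prob c.start := by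
      simp only [piece, state, prob]
      simp
      ring
    simp only [h3]
    simp only [integral_const, probReal_univ, one_smul]
    have h4 : 0 < max (-z (c.dn c.start)) 0 ^ p :=
      Real.rpow_pos_of_pos (lt_max_of_lt_left (by linarith)) p
    have h5 : 0 ≤ max (-z (c.up c.start)) 0 ^ p := Real.rpow_nonneg (le_max_right _ _) p
    have h6 : 0 ≤ c.prob c.start := gaussPos_nonneg _ _
    have h7 : 0 < 1 - c.prob c.start := by linarith
    positivity
  · have hsup : (⨆ t : ℝ≥0, (∫ ω, runSup (-Y) t ω ^ p ∂P) ^ (1 / p)) ≤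
        (∫ ω, l (c.state B T ω) ^ p ∂P) ^ (1 / p) := ciSup_le hIle'
    have hsup0 : 0 ≤ ⨆ t : ℝ≥0, (∫ ω, runSup (-Y) t ω ^ p ∂P) ^ (1 / p) :=
      Real.iSup_nonneg fun t ↦ Real.rpow_nonneg (hInn t) _
    calc C' * ⨆ t : ℝ≥0, (∫ ω, runSup (-Y) t ω ^ p ∂P) ^ (1 / p)
        ≤ C ^ (1 / p) * (∫ ω, l (c.state B T ω) ^ p ∂P) ^ (1 / p) :=
          mul_le_mul hC' hsup hsup0 (Real.rpow_nonneg hC _)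
      _ = (C * ∫ ω, l (c.state B T ω) ^ p ∂P) ^ (1 / p) := (Real.mul_rpow hC hlnn).symm
      _ < (∫ ω, runSup Y T ω ^ p ∂P) ^ (1 / p) :=
          Real.rpow_lt_rpow (mul_nonneg hC hlnn) (hlt.trans_le hleS) hp'
      _ ≤ _ := le_ciSup hSbdd (T : ℝ≥0)

end BinaryChain

/-- Mean of the `p`-th power of the maximum for a walk on the points `a * r ^ i` started at index
`j`, which moves up one step or is killed at `-1`, stopped after `m` steps. -/
noncomputable def ladderMean (p a r : ℝ) : ℕ → ℕ → ℝ
  | 0, j => (a * r ^ j) ^ p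
  | m + 1, j => (a * r ^ j) ^ p +
      (ladderMean p a r m (j + 1) - (a * r ^ j) ^ p) * ((a * r ^ j + 1) / (a * r ^ (j + 1) + 1))

section Numerics

variable {p a r : ℝ}

lemma continuousOn_rpow_div (p : ℝ) : ContinuousOn (fun s : ℝ ↦ s ^ (p - 1) / (s + 1)) (Ioi 0) := by
  intro s hs
  have hs : 0 < s := hs
  refine ContinuousAt.continuousWithinAt ?_
  exact (Real.continuousAt_rpow_const _ _ (.inl hs.ne')).div (by fun_prop) (by positivity)

lemma intervalIntegrable_rpow_div {x y : ℝ} (hx : 0 < x) (hy : 0 < y) :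
    IntervalIntegrable (fun s : ℝ ↦ s ^ (p - 1) / (s + 1)) volume x y :=
  ((continuousOn_rpow_div p).mono fun _ hs ↦ (lt_min hx hy).trans_le hs.1).intervalIntegrable

lemma integrableOn_rpow_div (hp1 : p < 1) (ha : 0 < a) :
    IntegrableOn (fun s : ℝ ↦ s ^ (p - 1) / (s + 1)) (Ioi a) := by
  refine Integrable.mono' (integrableOn_Ioi_rpow_of_lt (a := p - 2) (by linarith) ha)
    (((continuousOn_rpow_div p).mono (Ioi_subset_Ioi ha.le)).aestronglyMeasurable
      measurableSet_Ioi) ?_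
  refine (ae_restrict_iff' measurableSet_Ioi).2 (ae_of_all _ fun s (hs : a < s) ↦ ?_)
  have hs0 : 0 < s := ha.trans hs
  rw [Real.norm_of_nonneg (by positivity), show p - 2 = p - 1 - 1 by ring, Real.rpow_sub_one hs0.ne' (p - 1)]
  exact div_le_div_of_nonneg_left (by positivity) hs0 (by linarith)

lemma ladderMean_ge (hp : 0 < p) (ha : 0 < a) (hr : 1 < r) (m j : ℕ) :
    (a * r ^ j) ^ p + (a * r ^ j + 1) / r *
      (p * ∫ s in (a * r ^ j)..(a * r ^ (j + m)), s ^ (p - 1) / (s + 1)) ≤ ladderMean p a r m j := by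
  have hr0 : 0 < r := one_pos.trans hr
  induction m generalizing j with
  | zero => simp [ladderMean]
  | succ m ih =>
    have hx : 0 < a * r ^ j := by positivity
    have hxy : a * r ^ j ≤ a * r ^ (j + 1) := by
      gcongr
      · exact hr.le
      · simp
    have hy : 0 < a * r ^ (j + 1) := by positivity
    have hw : 0 < a * r ^ (j + 1 + m) := by positivity
    have hyx : a * r ^ (j + 1) = r * (a * r ^ j) := by ring
    have ih := ih (j + 1)
    rw [ladderMean, show j + (m + 1) = j + 1 + m by ring,
      ← intervalIntegral.integral_add_adjacent_intervals (intervalIntegrable_rpow_div hx hy)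
        (intervalIntegrable_rpow_div hy hw)]
    set x := a * r ^ j
    set y := a * r ^ (j + 1)
    set I₁ := ∫ s in x..y, s ^ (p - 1) / (s + 1)
    set I₂ := ∫ s in y..(a * r ^ (j + 1 + m)), s ^ (p - 1) / (s + 1)
    have hI : (y + 1) / r * (p * I₁) ≤ y ^ p - x ^ p := by
      have h1 : ∫ s in x..y, s ^ (p - 1) = (y ^ p - x ^ p) / p := by
        rw [integral_rpow (.inl (by linarith))]
        simp
      have h2 : ∫ s in x..y, (y + 1) / r * (s ^ (p - 1) / (s + 1)) ≤ ∫ s in x..y, s ^ (p - 1) := by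
        refine intervalIntegral.integral_mono_on hxy
          ((intervalIntegrable_rpow_div hx hy).const_mul _)
          (intervalIntegral.intervalIntegrable_rpow (.inr ?_)) fun s hs ↦ ?_
        · rw [uIcc_of_le hxy]
          exact fun h ↦ hx.not_ge h.1
        · have hs0 : 0 < s := hx.trans_le hs.1
          have h3 : 0 ≤ s ^ (p - 1) := by positivity
          rw [div_mul_div_comm, div_le_iff₀ (by positivity), mul_comm]
          refine mul_le_mul_of_nonneg_left ?_ h3
          have := mul_le_mul_of_nonneg_left hs.1 hr0.le
          linarith
      rw [intervalIntegral.integral_const_mul, h1, le_div_iff₀ hp] at h2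
      linarith
    have hθ : 0 < (x + 1) / (y + 1) := by positivity
    calc x ^ p + (x + 1) / r * (p * (I₁ + I₂))
        = x ^ p + ((y + 1) / r * (p * I₁) + (y + 1) / r * (p * I₂)) * ((x + 1) / (y + 1)) := by
          field_simp
      _ ≤ x ^ p + (ladderMean p a r m (j + 1) - x ^ p) * ((x + 1) / (y + 1)) := by
          gcongr
          linarith

lemma exists_ladderMean_gt (hp : 0 < p) (hp1 : p < 1) (ha : 0 < a) (hap : (a + 1) * p = 1) {C : ℝ}
    (hC : C < a ^ p + ∫ s in Ioi a, s ^ (p - 1) / (s + 1)) :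
    ∃ r > 1, ∃ J, C * r ^ p < ladderMean p a r J 0 := by
  have hlim := intervalIntegral_tendsto_integral_Ioi a (integrableOn_rpow_div hp1 ha) tendsto_id
  obtain ⟨y, hy, hay⟩ := (((hlim.const_add (a ^ p)).eventually (lt_mem_nhds hC)).and
    (eventually_ge_atTop a)).exists
  simp only [id] at hy
  set I := ∫ s in a..y, s ^ (p - 1) / (s + 1)
  have hcont : ContinuousAt (fun r : ℝ ↦ a ^ p + 1 / r * I - C * r ^ p) 1 := by
    have h1 : ContinuousAt (fun r : ℝ ↦ 1 / r) 1 := continuousAt_const.div continuousAt_id one_ne_zero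
    have h2 : ContinuousAt (fun r : ℝ ↦ r ^ p) 1 := Real.continuousAt_rpow_const _ _ (.inl one_ne_zero)
    exact (continuousAt_const.add (h1.mul continuousAt_const)).sub (continuousAt_const.mul h2)
  have hev : ∀ᶠ r : ℝ in 𝓝[>] 1, 0 < a ^ p + 1 / r * I - C * r ^ p :=
    nhdsWithin_le_nhds (hcont.eventually (lt_mem_nhds (by simpa using hy)))
  obtain ⟨r, hr, hr1⟩ := (hev.and self_mem_nhdsWithin).exists
  have hr1 : 1 < r := hr1
  have hr0 : 0 < r := one_pos.trans hr1
  obtain ⟨J, hJ⟩ := pow_unbounded_of_one_lt (y / a) hr1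
  refine ⟨r, hr1, J, ?_⟩
  have hJ : y ≤ a * r ^ J := by
    rw [div_lt_iff₀ ha] at hJ
    linarith
  have hmono : I ≤ ∫ s in a..(a * r ^ J), s ^ (p - 1) / (s + 1) := by
    refine intervalIntegral.integral_mono_interval le_rfl hay hJ ?_
      (intervalIntegrable_rpow_div ha (by positivity))
    refine (ae_restrict_iff' measurableSet_Ioc).2 (ae_of_all _ fun s hs ↦ ?_)
    have : 0 < s := ha.trans hs.1
    exact div_nonneg (by positivity) (by positivity)
  have h := ladderMean_ge hp ha hr1 J 0
  rw [pow_zero, mul_one, zero_add, ← mul_assoc, div_mul_eq_mul_div, hap] at h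
  have : 1 / r * I ≤ 1 / r * ∫ s in a..(a * r ^ J), s ^ (p - 1) / (s + 1) := by gcongr
  linarith

/-- Value, up to scaling, of the chain descending along `-r ^ k`, with `m` steps remaining. -/
noncomputable def descentValue (C π D ρ : ℝ) : ℕ → ℝ
  | 0 => -C
  | m + 1 => π * D + ρ * descentValue C π D ρ m

lemma exists_descentValue_nonneg {C π D ρ : ℝ} (hπ : 0 < π) (hD : 0 < D) (hρ : 0 ≤ ρ)
    (hρ1 : ρ ≤ 1) : ∃ K, 0 ≤ descentValue C π D ρ K := by
  have hπD : 0 < π * D := mul_pos hπ hD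
  have key (m : ℕ) : 0 ≤ descentValue C π D ρ m ∨ m * (π * D) - C ≤ descentValue C π D ρ m := by
    induction m with
    | zero => simp [descentValue]
    | succ m ih =>
      rw [descentValue]
      rcases le_total 0 (descentValue C π D ρ m) with h | h
      · left
        positivity
      · have h1 : descentValue C π D ρ m ≤ ρ * descentValue C π D ρ m := by nlinarith
        rcases ih with h2 | h2
        · left
          linarith
        · right
          push_cast
          linarith
  obtain ⟨K, hK⟩ := exists_nat_ge (C / (π * D))
  rw [div_le_iff₀ hπD] at hK
  refine ⟨K, ?_⟩
  rcases key K with h | h <;> linarith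

lemma rho_le_one (hp1 : p ≤ 1) (hp : 0 < p) (ha : 0 < a) (hap : (a + 1) * p = 1) (hr : 1 < r) :
    (a + 1) / (r + a) * r ^ p ≤ 1 := by
  have h := rpow_one_add_le_one_add_mul_self (s := r - 1) (by linarith) hp.le hp1
  rw [add_sub_cancel] at h
  have h0 : 0 < r + a := by linarith
  rw [div_mul_eq_mul_div, div_le_one h0]
  calc (a + 1) * r ^ p ≤ (a + 1) * (1 + p * (r - 1)) := by gcongr
    _ = r + a := by linear_combination (r - 1) * hap

end Numerics

/-- States of the extremal chain. It descends along the points `-r ^ k` (`desc k`), each time with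
a chance of jumping to `a * r ^ k` instead; it then climbs the points `a * r ^ (k + j)` (`asc k j`),
each time with a chance of falling back to `-r ^ k`, where it is absorbed (`dead k j`). -/
inductive LadderState
  | start
  | desc (k : ℕ)
  | asc (k j : ℕ)
  | dead (k j : ℕ)

namespace LadderState

/-- Injective encoding of the states. -/
def encode : LadderState → ℕ × ℕ × ℕ
  | start => (0, 0, 0)
  | desc k => (1, k, 0)
  | asc k j => (2, k, j)
  | dead k j => (3, k, j)

instance : Countable LadderState := by
  refine Function.Injective.countable (f := encode) ?_
  rintro (_ | _ | _ | _) (_ | _ | _ | _) h <;> simp_all [encode]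

instance : MeasurableSpace LadderState := ⊤

instance : DiscreteMeasurableSpace LadderState := ⟨fun _ ↦ trivial⟩

/-- Upward transition. -/
def up (K J : ℕ) : LadderState → LadderState
  | start => asc 0 0
  | desc k => if k < K then asc k 0 else desc k
  | asc k j => if j < J then asc k (j + 1) else asc k j
  | dead k j => dead k j

/-- Downward transition. -/
def dn (K J : ℕ) : LadderState → LadderState
  | start => desc 0
  | desc k => if k < K then desc (k + 1) else desc k
  | asc k j => if j < J then dead k j else asc k j
  | dead k j => dead k j

/-- Number of transitions before absorption is certain. -/
def rank (K J : ℕ) : LadderState → ℕ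
  | start => K + J + 2
  | desc k => if k < K then K - k + J + 1 else 0
  | asc _ j => J - j
  | dead _ _ => 0

/-- Probability of the upward transition. -/
noncomputable def upProb (p a r : ℝ) : LadderState → ℝ
  | start => p
  | desc _ => (r - 1) / (r + a)
  | asc _ j => (a * r ^ j + 1) / (a * r ^ (j + 1) + 1)
  | dead _ _ => 1 / 2

/-- Position of the walk. -/
noncomputable def pos (a r : ℝ) : LadderState → ℝ
  | start => 0
  | desc k => -r ^ k
  | asc k j => r ^ k * (a * r ^ j)
  | dead k _ => -r ^ k

/-- Maximum reached by the walk. -/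
noncomputable def top (a r : ℝ) : LadderState → ℝ
  | start => 0
  | desc _ => 0
  | asc k j => r ^ k * (a * r ^ j)
  | dead k j => r ^ k * (a * r ^ j)

/-- Bound for the depth reached by the walk. -/
noncomputable def depth (r : ℝ) : LadderState → ℝ
  | start => 0
  | desc k => r ^ k
  | asc k _ => r ^ (k + 1)
  | dead k _ => r ^ (k + 1)

/-- Mean of the final value of `top ^ p - C * depth ^ p`. -/
noncomputable def gain (p a r C : ℝ) (K J : ℕ) : LadderState → ℝ
  | start => p * (ladderMean p a r J 0 - C * r ^ p) + (1 - p) *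
      descentValue C ((r - 1) / (r + a)) (ladderMean p a r J 0 - C * r ^ p)
        ((a + 1) / (r + a) * r ^ p) K
  | desc k => (r ^ k) ^ p *
      descentValue C ((r - 1) / (r + a)) (ladderMean p a r J 0 - C * r ^ p)
        ((a + 1) / (r + a) * r ^ p) (K - k)
  | asc k j => (r ^ k) ^ p * ladderMean p a r (J - j) j - C * (r ^ (k + 1)) ^ p
  | dead k j => (r ^ k) ^ p * (a * r ^ j) ^ p - C * (r ^ (k + 1)) ^ p

variable {p a r C : ℝ} {K J : ℕ}

lemma upProb_mem (hp : 0 < p) (hp1 : p < 1) (ha : 0 < a) (hr : 1 < r) (s : LadderState) :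
    0 < upProb p a r s ∧ upProb p a r s < 1 := by
  have hr0 : 0 < r := one_pos.trans hr
  rcases s with _ | _ | ⟨k, j⟩ | _ <;> simp only [upProb]
  · exact ⟨hp, hp1⟩
  · have h : 0 < r + a := by linarith
    exact ⟨div_pos (by linarith) h, (div_lt_one h).2 (by linarith)⟩
  · refine ⟨by positivity, (div_lt_one (by positivity)).2 ?_⟩
    have : a * r ^ j < a * r ^ (j + 1) := by
      gcongr
      simp
    linarith
  · norm_num

lemma pos_eq (ha : 0 < a) (hap : (a + 1) * p = 1) (hr : 1 < r) (s : LadderState) :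
    pos a r s = pos a r (dn K J s) + (pos a r (up K J s) - pos a r (dn K J s)) * upProb p a r s := by
  have hr0 : 0 < r := one_pos.trans hr
  rcases s with _ | k | ⟨k, j⟩ | _ <;> simp only [up, dn]
  · simp only [pos, upProb]
    linear_combination -hap
  · split_ifs
    · simp only [pos, upProb]
      field_simp
      ring
    · ring
  · split_ifs
    · simp only [pos, upProb]
      field_simp
      ring
    · ring
  · ring

lemma gain_eq (ha : 0 < a) (hr : 1 < r) (s : LadderState) :
    gain p a r C K J s = gain p a r C K J (dn K J s) +
      (gain p a r C K J (up K J s) - gain p a r C K J (dn K J s)) * upProb p a r s := by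
  have hr0 : 0 < r := one_pos.trans hr
  have hpow (k : ℕ) : (r ^ (k + 1)) ^ p = (r ^ k) ^ p * r ^ p := by
    rw [pow_succ, Real.mul_rpow (by positivity) hr0.le]
  rcases s with _ | k | ⟨k, j⟩ | _ <;> simp only [up, dn]
  · simp [gain, upProb]
    ring
  · split_ifs with h
    · obtain ⟨m, rfl⟩ : ∃ m, K = k + (m + 1) := ⟨K - k - 1, by lia⟩
      simp only [gain, upProb, add_tsub_cancel_left, show k + (m + 1) - (k + 1) = m by lia,
        descentValue, hpow, tsub_zero]
      field_simp
      ring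
    · ring
  · split_ifs with h
    · obtain ⟨m, rfl⟩ : ∃ m, J = j + (m + 1) := ⟨J - j - 1, by lia⟩
      simp only [gain, upProb, add_tsub_cancel_left, show j + (m + 1) - (j + 1) = m by lia,
        ladderMean]
      ring
    · ring
  · ring

lemma rank_up (s : LadderState) : rank K J (up K J s) ≤ rank K J s - 1 := by
  rcases s with _ | k | ⟨k, j⟩ | _ <;> simp only [up, rank] <;> grind [rank]

lemma rank_dn (s : LadderState) : rank K J (dn K J s) ≤ rank K J s - 1 := by
  rcases s with _ | k | ⟨k, j⟩ | _ <;> simp only [dn, rank] <;> grind [rank]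

lemma eq_of_rank_eq_zero (s : LadderState) (h : rank K J s = 0) : up K J s = s ∧ dn K J s = s := by
  rcases s with _ | k | ⟨k, j⟩ | _ <;> simp only [rank] at h <;> simp only [up, dn] <;> grind

lemma top_nonneg (ha : 0 < a) (hr : 0 < r) (s : LadderState) : 0 ≤ top a r s := by
  rcases s with _ | _ | _ | _ <;> simp only [top] <;> positivity

lemma depth_nonneg (hr : 0 < r) (s : LadderState) : 0 ≤ depth r s := by
  rcases s with _ | _ | _ | _ <;> simp only [depth] <;> positivity

lemma pos_dn_le (ha : 0 < a) (hr : 0 < r) (s : LadderState) :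
    pos a r (dn K J s) ≤ pos a r (up K J s) := by
  rcases s with _ | k | ⟨k, j⟩ | _ <;> simp only [up, dn] <;> (try split_ifs) <;>
    try exact le_rfl
  all_goals
    simp only [pos]
    exact (neg_nonpos.2 (by positivity)).trans (by positivity)

lemma top_up_le (s : LadderState) :
    top a r (up K J s) ≤ max (top a r s) (pos a r (up K J s)) := by
  rcases s with _ | k | ⟨k, j⟩ | _ <;> simp only [up] <;> (try split_ifs) <;>
    first | exact le_max_left _ _ | exact le_max_right _ _

lemma top_dn_le (s : LadderState) :
    top a r (dn K J s) ≤ max (top a r s) (pos a r (dn K J s)) := by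
  rcases s with _ | k | ⟨k, j⟩ | _ <;> simp only [dn] <;> (try split_ifs) <;>
    exact le_max_left _ _

lemma depth_le_up (hr : 1 < r) (s : LadderState) : depth r s ≤ depth r (up K J s) := by
  have hr0 : 0 < r := one_pos.trans hr
  rcases s with _ | k | ⟨k, j⟩ | _ <;> simp only [up] <;> (try split_ifs) <;> try exact le_rfl
  · simp only [depth]
    positivity
  · exact pow_le_pow_right₀ hr.le k.le_succ

lemma depth_le_dn (hr : 1 < r) (s : LadderState) : depth r s ≤ depth r (dn K J s) := by
  rcases s with _ | k | ⟨k, j⟩ | _ <;> simp only [dn] <;> (try split_ifs) <;> try exact le_rfl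
  · simp [depth]
  · exact pow_le_pow_right₀ hr.le k.le_succ

lemma neg_pos_le_depth (ha : 0 < a) (hr : 1 < r) (s : LadderState) : -pos a r s ≤ depth r s := by
  have hr0 : 0 < r := one_pos.trans hr
  rcases s with _ | k | ⟨k, j⟩ | ⟨k, j⟩ <;> simp only [pos, depth, neg_neg, neg_zero, le_refl]
  · exact (neg_nonpos.2 (by positivity)).trans (by positivity)
  · exact pow_le_pow_right₀ hr.le k.le_succ

lemma neg_pos_dn_le_depth_up (ha : 0 < a) (hr : 1 < r) (s : LadderState) :
    -pos a r (dn K J s) ≤ depth r (up K J s) := by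
  refine (neg_pos_le_depth ha hr _).trans ?_
  rcases s with _ | k | ⟨k, j⟩ | _ <;> simp only [up, dn] <;> (try split_ifs) <;> try exact le_rfl
  exact pow_le_pow_right₀ hr.le (Nat.zero_le 1)

lemma gain_le (hp : 0 < p) (ha : 0 < a) (hr : 0 < r) (s : LadderState) (h : rank K J s = 0) :
    gain p a r C K J s ≤ top a r s ^ p - C * depth r s ^ p := by
  have hmul (k j : ℕ) : (r ^ k * (a * r ^ j)) ^ p = (r ^ k) ^ p * (a * r ^ j) ^ p :=
    Real.mul_rpow (by positivity) (by positivity)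
  rcases s with _ | k | ⟨k, j⟩ | ⟨k, j⟩ <;> simp only [rank] at h
  · lia
  · have h : K - k = 0 := by grind
    simp only [gain, top, depth, h, descentValue, Real.zero_rpow hp.ne']
    linarith
  · simp only [gain, top, depth, h, ladderMean, hmul, le_refl]
  · simp only [gain, top, depth, hmul, le_refl]

end LadderState

open LadderState in
theorem exists_martingale_of_lt {p c : ℝ} (hp : 0 < p) (hp1 : p < 1)
    (hc : c < ((1 / p - 1) ^ p + ∫ s in Ioi (1 / p - 1), s ^ (p - 1) / (s + 1)) ^ (1 / p)) :
    ∃ (Ω : Type) (m0 : MeasurableSpace Ω) (P : Measure Ω),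
      IsProbabilityMeasure P ∧ P.IsComplete ∧
      ∃ (ℱ : Filtration ℝ≥0 m0) (X : ℝ≥0 → Ω → ℝ),
        Martingale X ℱ P ∧
        (∀ ω, Continuous fun t => X t ω) ∧
        (∀ᵐ ω ∂P, X 0 ω = 0) ∧
        (0 < ⨆ t : ℝ≥0, (∫ ω, runSup (-X) t ω ^ p ∂P) ^ (1 / p)) ∧
        BddAbove (range fun t : ℝ≥0 => (∫ ω, runSup (-X) t ω ^ p ∂P) ^ (1 / p)) ∧
        (⨆ t : ℝ≥0, (∫ ω, runSup X t ω ^ p ∂P) ^ (1 / p)) >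
          c * ⨆ t : ℝ≥0, (∫ ω, runSup (-X) t ω ^ p ∂P) ^ (1 / p) := by
  set a := 1 / p - 1 with ha_def
  have ha : 0 < a := by
    rw [ha_def, sub_pos]
    exact one_lt_one_div hp hp1
  have hap : (a + 1) * p = 1 := by
    rw [ha_def]
    field_simp
    ring
  have hint : 0 ≤ ∫ s in Ioi a, s ^ (p - 1) / (s + 1) := by
    refine setIntegral_nonneg measurableSet_Ioi fun s hs ↦ ?_
    have : 0 < s := ha.trans hs
    positivity
  have hC : max c 0 ^ p < a ^ p + ∫ s in Ioi a, s ^ (p - 1) / (s + 1) := by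
    have h0 : 0 < a ^ p + ∫ s in Ioi a, s ^ (p - 1) / (s + 1) :=
      add_pos_of_pos_of_nonneg (Real.rpow_pos_of_pos ha p) hint
    have h1 : max c 0 < (a ^ p + ∫ s in Ioi a, s ^ (p - 1) / (s + 1)) ^ (1 / p) :=
      max_lt hc (Real.rpow_pos_of_pos h0 _)
    have h2 := Real.rpow_lt_rpow (le_max_right _ _) h1 hp
    rwa [← Real.rpow_mul h0.le, one_div_mul_cancel hp.ne', Real.rpow_one] at h2
  set C := max c 0 ^ p
  have hC0 : 0 ≤ C := Real.rpow_nonneg (le_max_right _ _) p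
  have hcC : c ≤ C ^ (1 / p) := by
    rw [← Real.rpow_mul (le_max_right _ _), mul_one_div_cancel hp.ne', Real.rpow_one]
    exact le_max_left _ _
  obtain ⟨r, hr, J, hJ⟩ := exists_ladderMean_gt hp hp1 ha hap hC
  have hr : 1 < r := hr
  have hr0 : 0 < r := one_pos.trans hr
  have hD : 0 < ladderMean p a r J 0 - C * r ^ p := sub_pos.2 hJ
  have hra : 0 < r + a := by positivity
  obtain ⟨K, hK⟩ := exists_descentValue_nonneg (C := C) (π := (r - 1) / (r + a))
    (ρ := (a + 1) / (r + a) * r ^ p) (div_pos (sub_pos.2 hr) hra) hD (by positivity)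
    (rho_le_one hp1.le hp ha hap hr)
  choose q hq using fun s ↦ exists_gaussPos_eq (upProb_mem hp hp1 ha hr s).1
    (upProb_mem hp hp1 ha hr s).2
  have hprob (s : LadderState) : gaussPos (-q s) 1 = upProb p a r s := hq s
  refine BinaryChain.exists_martingale_of_chain (c := ⟨start, q, up K J, dn K J⟩) (z := pos a r)
    (h := top a r) (l := depth r) (W := gain p a r C K J) (rk := rank K J) hp
    (fun s ↦ (pos_eq ha hap hr s).trans (by rw [BinaryChain.prob, hprob]))
    (fun s ↦ (gain_eq ha hr s).trans (by rw [BinaryChain.prob, hprob]))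
    rfl (pos_dn_le ha hr0) rank_up rank_dn eq_of_rank_eq_zero (top_nonneg ha hr0) le_rfl
    top_up_le top_dn_le (depth_nonneg hr0) (depth_le_up hr) (depth_le_dn hr)
    (neg_pos_dn_le_depth_up ha hr) (fun s ↦ neg_pos_le_depth ha hr _)
    (gain_le hp ha hr0) ?_ hC0 ?_ ?_ hcC
  · exact add_pos_of_pos_of_nonneg (mul_pos hp hD) (mul_nonneg (by linarith) hK)
  · simp [pos, dn]
  · rw [BinaryChain.prob, hprob]
    exact hp1

/-- Sharpness of the constant `c_p` in `sup_t ‖M⁺_t‖_p ≤ c_p · sup_t ‖M⁻_t‖_p`, where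
`c_p^p = (1/p − 1)^p + ∫_{1/p−1}^∞ s^(p−1)/(s+1) ds`: for each `0 < p < 1` and each
`c < c_p` there is a continuous martingale starting from `0` with
`0 < sup_t ‖M⁻_t‖_p < ∞` and `sup_t ‖M⁺_t‖_p > c · sup_t ‖M⁻_t‖_p`. -/
theorem sharpness_cp (p : ℝ) (hp : 0 < p) (hp1 : p < 1)
    (c : ℝ)
    (hc : c < ((1 / p - 1) ^ p
      + ∫ s in Set.Ioi (1 / p - 1), s ^ (p - 1) / (s + 1)) ^ (1 / p)) :
    ∃ (Ω : Type) (m0 : MeasurableSpace Ω) (P : Measure Ω),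
      IsProbabilityMeasure P ∧ P.IsComplete ∧
      ∃ (ℱ : Filtration ℝ≥0 m0) (X : ℝ≥0 → Ω → ℝ),
        Martingale X ℱ P ∧
        (∀ ω, Continuous fun t => X t ω) ∧
        (∀ᵐ ω ∂P, X 0 ω = 0) ∧
        (0 < ⨆ t : ℝ≥0,
          (∫ ω, (-(⨅ s : Set.Icc (0 : ℝ≥0) t, min (X s.1 ω) 0)) ^ p ∂P) ^ (1 / p)) ∧
        BddAbove (Set.range fun t : ℝ≥0 =>
          (∫ ω, (-(⨅ s : Set.Icc (0 : ℝ≥0) t, min (X s.1 ω) 0)) ^ p ∂P) ^ (1 / p)) ∧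
        (⨆ t : ℝ≥0,
            (∫ ω, (⨆ s : Set.Icc (0 : ℝ≥0) t, max (X s.1 ω) 0) ^ p ∂P) ^ (1 / p))
          > c * ⨆ t : ℝ≥0,
              (∫ ω, (-(⨅ s : Set.Icc (0 : ℝ≥0) t, min (X s.1 ω) 0)) ^ p ∂P) ^ (1 / p) := by
  simp only [neg_iInf_min_zero]
  exact exists_martingale_of_lt hp hp1 hc
end
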